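/- (Global boundedness, critical case, solutions in X_V.) Assume conditions (O) and (H₂). Then every u ∈ C¹(ℝ^N) which (a) satisfies ρ_V(u) < ∞ and is the limit, in the Luxemburg norm ‖·‖ associated with ρ_V, of a sequence of C_c^∞(ℝ^N) functions, and (b) satisfies, for every φ ∈ C_c^∞(ℝ^N), ∫_{ℝ^N} 𝒜(x,u,∇u)·∇φ dx + ∫_{ℝ^N} V(x)(|u|^{p(x)−2}u + a(x)|u|^{q(x)−2}u) φ dx = ∫_{ℝ^N} ℬ(x,u,∇u) φ dx, belongs to L^∞(ℝ^N). -/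

import Mathlib

open MeasureTheory Filter
open scoped ENNReal

/-- The double phase integrand `H(x,t) = t^{p(x)} + a(x) t^{q(x)}`. -/
noncomputable def Hfun {N : ℕ} (p q a : EuclideanSpace ℝ (Fin N) → ℝ)
    (x : EuclideanSpace ℝ (Fin N)) (t : ℝ) : ℝ :=
  t ^ p x + a x * t ^ q x

/-- The modular `ρ_V(u) = ∫_{ℝ^N} [H(x,|∇u|) + V(x) H(x,|u|)] dx`. -/
noncomputable def rhoV {N : ℕ} (p q a V : EuclideanSpace ℝ (Fin N) → ℝ)
    (u : EuclideanSpace ℝ (Fin N) → ℝ) : ℝ≥0∞ :=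
  ∫⁻ x, (ENNReal.ofReal (Hfun p q a x ‖gradient u x‖) +
    ENNReal.ofReal (V x * Hfun p q a x |u x|))

/-- The Luxemburg norm `‖u‖ = inf {τ > 0 : ρ_V(u/τ) ≤ 1}` associated with `ρ_V`. -/
noncomputable def VNorm {N : ℕ} (p q a V : EuclideanSpace ℝ (Fin N) → ℝ)
    (u : EuclideanSpace ℝ (Fin N) → ℝ) : ℝ :=
  sInf {τ : ℝ | 0 < τ ∧
    (∫⁻ x, (ENNReal.ofReal (Hfun p q a x (‖gradient u x‖ / τ)) +
      ENNReal.ofReal (V x * Hfun p q a x (|u x| / τ)))) ≤ 1}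

/-- The Luxemburg norm `‖u‖_{L^Φ(U)}` of a Musielak integrand `Φ` on a set `U`. -/
noncomputable def luxNormOn {N : ℕ} (Φ : EuclideanSpace ℝ (Fin N) → ℝ → ℝ)
    (U : Set (EuclideanSpace ℝ (Fin N))) (u : EuclideanSpace ℝ (Fin N) → ℝ) : ℝ :=
  sInf {τ : ℝ | 0 < τ ∧ (∫⁻ x in U, ENNReal.ofReal (Φ x (|u x| / τ))) ≤ 1}

/-- The Sobolev Luxemburg norm `‖u‖_{W^{1,H}(U)}`. -/
noncomputable def sobNormOn {N : ℕ} (p q a : EuclideanSpace ℝ (Fin N) → ℝ)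
    (U : Set (EuclideanSpace ℝ (Fin N))) (u : EuclideanSpace ℝ (Fin N) → ℝ) : ℝ :=
  sInf {τ : ℝ | 0 < τ ∧
    (∫⁻ x in U, (ENNReal.ofReal (Hfun p q a x (‖gradient u x‖ / τ)) +
      ENNReal.ofReal (Hfun p q a x (|u x| / τ)))) ≤ 1}

/-- The open cube `Q_{y,ε}` centered at `y` with edges parallel to the axes of length `ε`. -/
def cube {N : ℕ} (y : EuclideanSpace ℝ (Fin N)) (ε : ℝ) : Set (EuclideanSpace ℝ (Fin N)) :=
  {x | ∀ i, |x i - y i| < ε / 2}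

/-- Condition (D): `p, q` bounded Lipschitz with `1 < inf p`, `sup q < N`,
`p < q < N` pointwise, `sup q/p < 1 + 1/N`; `a ≥ 0` bounded Lipschitz. -/
structure CondD (N : ℕ) (p q a : EuclideanSpace ℝ (Fin N) → ℝ) : Prop where
  lip_p : ∃ K : NNReal, LipschitzWith K p
  lip_q : ∃ K : NNReal, LipschitzWith K q
  lip_a : ∃ K : NNReal, LipschitzWith K a
  inf_p : ∃ c > (1 : ℝ), ∀ x, c ≤ p x
  sup_q : ∃ c < (N : ℝ), ∀ x, q x ≤ c
  p_lt_q : ∀ x, p x < q x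
  q_lt_N : ∀ x, q x < N
  ratio : ∃ c < 1 + 1 / (N : ℝ), ∀ x, q x / p x ≤ c
  a_nonneg : ∀ x, 0 ≤ a x
  a_bdd : ∃ C : ℝ, ∀ x, a x ≤ C

/-- Condition (O): condition (D) together with `V ∈ L¹_loc`, `V ≥ 0` a.e., one of the
two structural alternatives on the potential, and the log-Hölder-type decay of `p`
towards `p_∞` when `ess inf V = 0`. -/
structure CondO (N : ℕ) (p q a V : EuclideanSpace ℝ (Fin N) → ℝ)
    extends CondD N p q a : Prop where
  V_loc : LocallyIntegrable V volume
  V_nonneg : ∀ᵐ x ∂(volume : Measure (EuclideanSpace ℝ (Fin N))), 0 ≤ V x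
  V_alt : (∃ K₀ > (0 : ℝ), {x | V x ≤ K₀}.Nonempty ∧ volume {x | V x ≤ K₀} < ⊤) ∨
    (∃ R > (0 : ℝ),
      0 < essInf V (volume.restrict {x : EuclideanSpace ℝ (Fin N) | R ≤ ‖x‖}))
  V_log : essInf V (volume : Measure (EuclideanSpace ℝ (Fin N))) = 0 →
    ∃ pinf : ℝ, 1 < pinf ∧ pinf < N ∧
      ∃ C : ℝ, ∀ x, |p x - pinf| * Real.log (Real.exp 1 + ‖x‖) ≤ C

theorem ofReal_le_lintegral_of_absolutelyContinuous {α β : ℝ} {w G : ℝ → ℝ}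
    (hw : AbsolutelyContinuousOnInterval w α β) (hw0 : ∀ t, 0 ≤ w t)
    (hG : ∀ᵐ t, t ∈ Set.Ioo α β → ∀ w', HasDerivAt w w' t → |w'| + w t / (β - α) ≤ G t)
    {x : ℝ} (hx : x ∈ Set.Ioo α β) :
    ENNReal.ofReal (w x) ≤ ∫⁻ t in Set.Ioo α β, ENNReal.ofReal (G t) := by
  have hαβ : α < β := hx.1.trans hx.2
  have hfi : IntervalIntegrable (deriv w) volume α β := hw.intervalIntegrable_deriv
  have hcont : ContinuousOn w (Set.uIcc α β) := hw.continuousOn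
  have hwint : IntervalIntegrable w volume α β := hcont.intervalIntegrable
  have hxI : x ∈ Set.uIcc α β := by
    rw [Set.uIcc_of_le hαβ.le]; exact ⟨hx.1.le, hx.2.le⟩
  have key : ∀ t ∈ Set.Icc α β, w x ≤ w t + (∫ s in α..β, |deriv w s|) := by
    intro t ht
    have htI : t ∈ Set.uIcc α β := by rwa [Set.uIcc_of_le hαβ.le]
    have h1 : ∫ s in t..x, deriv w s = w x - w t :=
      (hw.mono (Set.uIcc_subset_uIcc htI hxI)).integral_deriv_eq_sub
    have h2 : |∫ s in t..x, deriv w s| ≤ |∫ s in t..x, (|deriv w s|)| := by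
      simpa [Real.norm_eq_abs] using
        intervalIntegral.norm_integral_le_abs_integral_norm (f := deriv w) (a := t) (b := x)
          (μ := volume)
    have h3 : |∫ s in t..x, (|deriv w s|)| ≤ |∫ s in α..β, (|deriv w s|)| := by
      apply intervalIntegral.abs_integral_mono_interval
      · rw [Set.uIoc_of_le hαβ.le]
        intro y hy
        rw [Set.mem_uIoc] at hy
        rcases hy with hy | hy
        · exact ⟨lt_of_le_of_lt ht.1 hy.1, hy.2.trans hx.2.le⟩
        · exact ⟨lt_trans hx.1 hy.1, hy.2.trans ht.2⟩
      · exact Eventually.of_forall fun y => abs_nonneg _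
      · exact hfi.abs
    rw [abs_of_nonneg (a := ∫ s in α..β, |deriv w s|)
      (intervalIntegral.integral_nonneg hαβ.le fun _ _ => abs_nonneg _)] at h3
    have := le_abs_self (∫ s in t..x, deriv w s)
    linarith
  have hpos : 0 < β - α := sub_pos.2 hαβ
  have havg : w x ≤ ∫ t in α..β, (|deriv w t| + w t / (β - α)) := by
    have h1 : ∫ _t in α..β, w x ≤ ∫ t in α..β, (w t + ∫ s in α..β, |deriv w s|) :=
      intervalIntegral.integral_mono_on hαβ.le (by simp) (hwint.add (by simp)) key
    rw [intervalIntegral.integral_add hwint (by simp)] at h1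
    rw [intervalIntegral.integral_add hfi.abs (hwint.div_const _),
      intervalIntegral.integral_div]
    simp only [intervalIntegral.integral_const, smul_eq_mul] at h1
    have h2 : w x ≤ ((∫ t in α..β, w t) + (β - α) * ∫ s in α..β, |deriv w s|) / (β - α) := by
      rw [le_div_iff₀ hpos]; linarith
    calc w x ≤ _ := h2
      _ = _ := by field_simp; ring
  have hI : IntegrableOn (fun t => |deriv w t| + w t / (β - α)) (Set.Ioo α β) := by
    have := (hfi.abs.add (hwint.div_const (β - α)))
    rw [intervalIntegrable_iff_integrableOn_Ioo_of_le hαβ.le] at this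
    exact this
  rw [intervalIntegral.integral_of_le hαβ.le, integral_Ioc_eq_integral_Ioo] at havg
  calc ENNReal.ofReal (w x)
      ≤ ENNReal.ofReal (∫ t in Set.Ioo α β, (|deriv w t| + w t / (β - α))) := by
        exact ENNReal.ofReal_le_ofReal havg
    _ = ∫⁻ t in Set.Ioo α β, ENNReal.ofReal (|deriv w t| + w t / (β - α)) := by
        apply ofReal_integral_eq_lintegral_ofReal hI
        exact Eventually.of_forall fun t => add_nonneg (abs_nonneg _) (div_nonneg (hw0 t) hpos.le)
    _ ≤ _ := by
        apply lintegral_mono_ae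
        rw [ae_restrict_iff' measurableSet_Ioo]
        filter_upwards [hG, hw.ae_differentiableAt] with t h1 h2 ht
        apply ENNReal.ofReal_le_ofReal
        refine h1 ht _ (h2 ?_).hasDerivAt
        rw [Set.uIcc_of_le hαβ.le]; exact Set.Ioo_subset_Icc_self ht

/-- Gagliardo-type inequality on a box: a nonnegative function dominated by the integral of `G`
along every coordinate line has its `L^{N/(N-1)}` norm controlled by the integral of `G`. -/
theorem lintegral_rpow_le_of_forall_line {N : ℕ} (hN : 2 ≤ N)
    {f G : EuclideanSpace ℝ (Fin N) → ℝ≥0∞} (hG : Measurable G)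
    (h : ∀ x i, f x ≤ ∫⁻ t : ℝ, G (x + (t - x i) • EuclideanSpace.single i (1 : ℝ))) :
    ∫⁻ x, f x ^ ((N : ℝ) / (N - 1)) ≤ (∫⁻ x, G x) ^ ((N : ℝ) / (N - 1)) := by
  have hN1 : (0 : ℝ) < N - 1 := by
    have : (2 : ℝ) ≤ N := by exact_mod_cast hN
    linarith
  have hp : Real.HolderConjugate (Fintype.card (Fin N)) ((N : ℝ) / (N - 1)) := by
    rw [Fintype.card_fin]
    exact Real.HolderConjugate.conjExponent (by linarith)
  have hpres := PiLp.volume_preserving_toLp (Fin N)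
  have hemb : MeasurableEmbedding (WithLp.toLp 2 : (Fin N → ℝ) → EuclideanSpace ℝ (Fin N)) :=
    (MeasurableEquiv.toLp 2 (Fin N → ℝ)).measurableEmbedding
  rw [← hpres.lintegral_comp_emb hemb, ← hpres.lintegral_comp_emb hemb]
  have hmain := lintegral_prod_lintegral_pow_le (fun _ : Fin N => (volume : Measure ℝ)) hp
    (f := fun x => G (WithLp.toLp 2 x)) (hG.comp hemb.measurable)
  rw [← volume_pi] at hmain
  refine le_trans (lintegral_mono fun x => ?_) hmain
  have hline : ∀ i t, WithLp.toLp 2 (Function.update x i t) =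
      (WithLp.toLp 2 x : EuclideanSpace ℝ (Fin N)) +
        (t - x i) • EuclideanSpace.single i (1 : ℝ) := by
    intro i t
    ext j
    by_cases hj : j = i
    · subst hj; simp
    · simp [hj]
  have : f (WithLp.toLp 2 x) ^ ((N : ℝ) / (N - 1)) =
      ∏ _i : Fin N, f (WithLp.toLp 2 x) ^ ((1 : ℝ) / (Fintype.card (Fin N) - 1 : ℝ)) := by
    rw [Finset.prod_const, Finset.card_univ, Fintype.card_fin, ← ENNReal.rpow_mul_natCast]
    congr 1; field_simp
  rw [this]
  refine Finset.prod_le_prod' fun i _ => ?_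
  refine ENNReal.rpow_le_rpow ?_ (by rw [Fintype.card_fin]; positivity)
  simp only [hline]
  exact h (WithLp.toLp 2 x) i

theorem measurableSet_cube {N : ℕ} (y : EuclideanSpace ℝ (Fin N)) (ℓ : ℝ) :
    MeasurableSet (cube y ℓ) := by
  have : cube y ℓ = ⋂ i, {x : EuclideanSpace ℝ (Fin N) | |x i - y i| < ℓ / 2} := by
    ext; simp [cube]
  rw [this]
  exact MeasurableSet.iInter fun i => measurableSet_lt (by fun_prop) (by fun_prop)

/-- Gagliardo's inequality on a cube of side `ℓ`, for a function `w` that is absolutely continuous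
along coordinate lines, with partial derivatives controlled by `G - w / ℓ`. -/
theorem lintegral_cube_rpow_le {N : ℕ} (hN : 2 ≤ N) (y : EuclideanSpace ℝ (Fin N)) {ℓ : ℝ}
    {w G : EuclideanSpace ℝ (Fin N) → ℝ} (hG : Measurable G) (hw0 : ∀ x, 0 ≤ w x)
    (hac : ∀ z i α β, AbsolutelyContinuousOnInterval
      (fun t : ℝ => w (z + t • EuclideanSpace.single i (1 : ℝ))) α β)
    (hder : ∀ z i, ∀ᵐ t : ℝ, z + t • EuclideanSpace.single i (1 : ℝ) ∈ cube y ℓ →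
      ∀ w', HasDerivAt (fun t : ℝ => w (z + t • EuclideanSpace.single i (1 : ℝ))) w' t →
        |w'| + w (z + t • EuclideanSpace.single i (1 : ℝ)) / ℓ ≤
          G (z + t • EuclideanSpace.single i (1 : ℝ))) :
    ∫⁻ x in cube y ℓ, ENNReal.ofReal (w x) ^ ((N : ℝ) / (N - 1)) ≤
      (∫⁻ x in cube y ℓ, ENNReal.ofReal (G x)) ^ ((N : ℝ) / (N - 1)) := by
  have hQ := measurableSet_cube y ℓ
  have hN1 : (0 : ℝ) < N - 1 := by
    have : (2 : ℝ) ≤ N := by exact_mod_cast hN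
    linarith
  have hpos : 0 < (N : ℝ) / (N - 1) := by
    have : (0 : ℝ) < N := by linarith
    positivity
  have := lintegral_rpow_le_of_forall_line hN
    (f := (cube y ℓ).indicator fun x => ENNReal.ofReal (w x))
    (G := (cube y ℓ).indicator fun x => ENNReal.ofReal (G x))
    ((hG.ennreal_ofReal).indicator hQ) ?_
  · rw [lintegral_indicator hQ] at this
    refine le_trans (le_of_eq ?_) this
    rw [← lintegral_indicator hQ]
    congr 1; ext x
    by_cases hx : x ∈ cube y ℓ
    · simp [hx]
    · simp [hx, hpos]
  intro x i
  by_cases hx : x ∈ cube y ℓ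
  swap
  · simp [hx]
  have hmem : ∀ t : ℝ, (x + (t - x i) • EuclideanSpace.single i (1 : ℝ) ∈ cube y ℓ ↔
      t ∈ Set.Ioo (y i - ℓ / 2) (y i + ℓ / 2)) := by
    intro t
    have hco : ∀ j, (x + (t - x i) • EuclideanSpace.single i (1 : ℝ)) j = if j = i then t else x j := by
      intro j
      by_cases hj : j = i
      · subst hj; simp
      · simp [hj]
    constructor
    · intro h
      have := h i
      rw [hco, if_pos rfl, abs_lt] at this
      constructor <;> linarith [this.1, this.2]
    · intro h j
      rw [hco]
      split_ifs with hj
      · subst hj; rw [abs_lt]; constructor <;> linarith [h.1, h.2]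
      · exact hx j
  rw [Set.indicator_of_mem hx]
  have hxi : x i ∈ Set.Ioo (y i - ℓ / 2) (y i + ℓ / 2) := by
    rw [← hmem]; simpa using hx
  have hrw : ∀ t : ℝ, x + (t - x i) • EuclideanSpace.single i (1 : ℝ) =
      (x - (x i) • EuclideanSpace.single i (1 : ℝ)) + t • EuclideanSpace.single i (1 : ℝ) := by
    intro t; rw [sub_smul]; abel
  have h1 := ofReal_le_lintegral_of_absolutelyContinuous (α := y i - ℓ / 2) (β := y i + ℓ / 2)
    (w := fun t => w ((x - (x i) • EuclideanSpace.single i (1 : ℝ)) +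
      t • EuclideanSpace.single i (1 : ℝ)))
    (G := fun t => G ((x - (x i) • EuclideanSpace.single i (1 : ℝ)) +
      t • EuclideanSpace.single i (1 : ℝ))) (hac _ _ _ _) (fun t => hw0 _) ?_ hxi
  · simp only [sub_add_cancel] at h1
    refine h1.trans (le_of_eq ?_)
    rw [← lintegral_indicator measurableSet_Ioo]
    congr 1; ext t
    by_cases ht : t ∈ Set.Ioo (y i - ℓ / 2) (y i + ℓ / 2)
    · rw [Set.indicator_of_mem ht, Set.indicator_of_mem ((hmem t).2 ht), hrw]
    · rw [Set.indicator_of_notMem ht, Set.indicator_of_notMem (mt (hmem t).1 ht)]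
  · filter_upwards [hder (x - (x i) • EuclideanSpace.single i (1 : ℝ)) i] with t ht htI w' hw'
    have := ht (by rw [← hrw]; exact (hmem t).2 htI) w' hw'
    convert this using 3
    ring

/-- The critical Sobolev exponent `n p / (n - p)`. -/
noncomputable def critExp (n p : ℝ) : ℝ := n * p / (n - p)

/-- The power `critExp n p * (n - 1) / n` to which Gagliardo's inequality is applied. -/
noncomputable def gagExp (n p : ℝ) : ℝ := (n - 1) * (n * (1 / (n - p)) - 1)

theorem critExp_eq_gagExp_mul {n p : ℝ} (hn : 2 ≤ n) (hp : p < n) :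
    critExp n p = gagExp n p * (n / (n - 1)) := by
  have h1 : n - p ≠ 0 := by linarith
  have h2 : n - 1 ≠ 0 := by linarith
  unfold critExp gagExp; field_simp; ring

theorem gagExp_eq {n p : ℝ} (hn : 2 ≤ n) (hp : p < n) :
    gagExp n p = critExp n p * ((n - 1) / n) := by
  have h1 : n - 1 ≠ 0 := by linarith
  have h2 : n ≠ 0 := by linarith
  rw [critExp_eq_gagExp_mul hn hp]; field_simp

theorem gagExp_sub_one_eq {n p : ℝ} (hp1 : 1 < p) (hp : p < n) :
    gagExp n p - 1 = critExp n p * ((p - 1) / p) := by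
  have h1 : n - p ≠ 0 := by linarith
  have h2 : p ≠ 0 := by linarith
  unfold critExp gagExp; field_simp; ring

theorem lt_critExp {n p : ℝ} (hp1 : 1 < p) (hp : p < n) : p < critExp n p := by
  have h1 : 0 < n - p := by linarith
  unfold critExp; rw [lt_div_iff₀ h1]; nlinarith

theorem one_lt_gagExp {n p : ℝ} (hn : 2 ≤ n) (hp1 : 1 < p) (hp : p < n) : 1 < gagExp n p := by
  have h := gagExp_sub_one_eq hp1 hp
  have h2 := lt_critExp hp1 hp
  have : 0 < critExp n p * ((p - 1) / p) :=
    mul_pos (by linarith) (div_pos (by linarith) (by linarith))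
  linarith

theorem critExp_le {n p q₁ : ℝ} (hp0 : 0 < p) (hp : p ≤ q₁) (hq : q₁ < n) :
    critExp n p ≤ n * n / (n - q₁) := by
  unfold critExp
  apply div_le_div₀ <;> nlinarith

theorem gagExp_le {n p q₁ : ℝ} (hn : 2 ≤ n) (hp0 : 0 < p) (hp : p ≤ q₁) (hq : q₁ < n) :
    gagExp n p ≤ n * n / (n - q₁) := by
  refine le_trans ?_ (critExp_le hp0 hp hq)
  rw [gagExp_eq hn (by linarith)]
  apply mul_le_of_le_one_right
  · unfold critExp; apply div_nonneg <;> nlinarith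
  · rw [div_le_one (by linarith)]; linarith

/-- Weighted Young inequality. -/
theorem rpow_mul_le_young {p A T μ : ℝ} (hp : 1 < p) (hA : 0 ≤ A) (hT : 0 ≤ T) (hμ : 0 < μ) :
    A ^ ((p - 1) / p) * T ≤ μ * A + μ ^ (-(p - 1)) * T ^ p := by
  have hp0 : 0 < p := by linarith
  have hp1 : 0 < p - 1 := by linarith
  have hpq : (p / (p - 1)).HolderConjugate p := (Real.HolderConjugate.conjExponent hp).symm
  have h := Real.young_inequality_of_nonneg (a := μ ^ ((p - 1) / p) * A ^ ((p - 1) / p))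
    (b := μ ^ (-((p - 1) / p)) * T) (by positivity) (by positivity) hpq
  rw [← Real.mul_rpow hμ.le hA, ← Real.rpow_mul (by positivity),
    Real.mul_rpow (x := μ ^ (-((p - 1) / p))) (by positivity) hT, ← Real.rpow_mul hμ.le] at h
  have e1 : (p - 1) / p * (p / (p - 1)) = 1 := by field_simp
  have e2 : -((p - 1) / p) * p = -(p - 1) := by field_simp
  rw [e1, e2, Real.rpow_one] at h
  have e3 : (μ * A) ^ ((p - 1) / p) * (μ ^ (-((p - 1) / p)) * T) = A ^ ((p - 1) / p) * T := by
    rw [Real.mul_rpow hμ.le hA, Real.rpow_neg hμ.le]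
    have : μ ^ ((p - 1) / p) ≠ 0 := by positivity
    field_simp
  rw [e3] at h
  refine h.trans (add_le_add ?_ ?_)
  · apply div_le_self (by positivity)
    rw [le_div_iff₀ hp1]; linarith
  · exact div_le_self (by positivity) hp.le

theorem rpow_mul_rpow_le_one_add {X Y α β : ℝ} (hX : 0 ≤ X) (hY : 0 ≤ Y) (hα : 0 ≤ α)
    (hβ : 0 ≤ β) (h : α + β ≤ 1) : X ^ α * Y ^ β ≤ 1 + X + Y := by
  have hM : 1 ≤ 1 + X + Y := by linarith
  calc X ^ α * Y ^ β ≤ (1 + X + Y) ^ α * (1 + X + Y) ^ β := by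
        gcongr <;> linarith
    _ = (1 + X + Y) ^ (α + β) := by rw [Real.rpow_add (by linarith)]
    _ ≤ (1 + X + Y) ^ (1 : ℝ) := Real.rpow_le_rpow_of_exponent_le hM h
    _ = _ := Real.rpow_one _

theorem rpow_gagExp_sub_one_mul_le {n p V T μ : ℝ} (hn : 2 ≤ n) (hp1 : 1 < p) (hp : p < n)
    (hV : 0 ≤ V) (hT : 0 ≤ T) (hμ : 0 < μ) :
    V ^ (gagExp n p - 1) * T ≤ μ * V ^ critExp n p + μ ^ (-(p - 1)) * T ^ p := by
  have h := rpow_mul_le_young hp1 (A := V ^ critExp n p) (by positivity) hT hμ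
  rwa [← Real.rpow_mul hV, ← gagExp_sub_one_eq hp1 hp] at h

theorem rpow_mul_abs_log_le_one {v r : ℝ} (hv : 0 < v) (hv1 : v ≤ 1) (hr : 1 ≤ r) :
    v ^ r * |Real.log v| ≤ 1 := by
  have h1 : v ^ r ≤ v := by
    simpa using Real.rpow_le_rpow_of_exponent_ge hv hv1 hr
  have h2 := Real.abs_log_mul_self_lt v hv hv1
  rw [abs_mul, abs_of_pos hv] at h2
  nlinarith [abs_nonneg (Real.log v)]

theorem abs_log_le_mul_rpow {n v p : ℝ} (hn : 2 ≤ n) (hp1 : 1 < p) (hp : p < n) (hv1 : 1 ≤ v) :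
    |Real.log v| ≤ n * (v ^ critExp n p) ^ (1 / n) := by
  rw [abs_of_nonneg (Real.log_nonneg hv1)]
  have h := Real.log_le_rpow_div (x := v) (by linarith) (ε := 1 / n) (by positivity)
  have h2 : v ≤ v ^ critExp n p := by
    simpa using Real.rpow_le_rpow_of_exponent_le hv1 (hp1.trans (lt_critExp hp1 hp)).le
  calc Real.log v ≤ v ^ (1 / n) / (1 / n) := h
    _ = n * v ^ (1 / n) := by field_simp
    _ ≤ _ := by gcongr

/-- The logarithmic term produced by differentiating a variable exponent is of lower order. -/
theorem mul_abs_log_le {n p q v A S a : ℝ} (hn : 2 ≤ n) (hp1 : 1 < p) (hpq : p < n)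
    (hq1 : 1 < q) (hq : q < n) (hv : 0 < v) (hA : 1 ≤ A) (ha : 0 ≤ a) (haA : a ≤ A)
    (hS : (n - 1) * (1 / (n - q)) ≤ S) :
    a ^ ((n - 1) * (1 / (n - q))) * v ^ gagExp n q * |Real.log v| ≤
      (A ^ S + n) * (1 + v ^ critExp n p + a ^ (critExp n q / q) * v ^ critExp n q) := by
  have hnq : 0 < n - q := by linarith
  have hs0 : 0 ≤ (n - 1) * (1 / (n - q)) := mul_nonneg (by linarith) (by positivity)
  have hX : 0 ≤ v ^ critExp n p := by positivity
  have hY : 0 ≤ a ^ (critExp n q / q) * v ^ critExp n q := by positivity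
  have hAS : 0 ≤ A ^ S := by positivity
  rcases le_total v 1 with h1 | h1
  · have e1 := rpow_mul_abs_log_le_one hv h1 (one_lt_gagExp hn hq1 hq).le
    have e2 : a ^ ((n - 1) * (1 / (n - q))) ≤ A ^ S :=
      (Real.rpow_le_rpow ha haA hs0).trans (Real.rpow_le_rpow_of_exponent_le hA hS)
    calc _ = a ^ ((n - 1) * (1 / (n - q))) * (v ^ gagExp n q * |Real.log v|) := by ring
      _ ≤ A ^ S * 1 := by gcongr
      _ ≤ (A ^ S + n) * (1 + v ^ critExp n p + a ^ (critExp n q / q) * v ^ critExp n q) := by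
        apply mul_le_mul <;> linarith
  · have e1 := abs_log_le_mul_rpow hn hp1 hpq h1
    have e2 : a ^ ((n - 1) * (1 / (n - q))) * v ^ gagExp n q =
        (a ^ (critExp n q / q) * v ^ critExp n q) ^ ((n - 1) / n) := by
      rw [Real.mul_rpow (by positivity) (by positivity), ← Real.rpow_mul ha, ← Real.rpow_mul hv.le,
        ← gagExp_eq hn hq]
      congr 2
      unfold critExp; field_simp
    rw [e2]
    calc _ ≤ (a ^ (critExp n q / q) * v ^ critExp n q) ^ ((n - 1) / n) *
          (n * (v ^ critExp n p) ^ (1 / n)) := by gcongr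
      _ = n * ((v ^ critExp n p) ^ (1 / n) *
          (a ^ (critExp n q / q) * v ^ critExp n q) ^ ((n - 1) / n)) := by ring
      _ ≤ n * (1 + v ^ critExp n p + a ^ (critExp n q / q) * v ^ critExp n q) := by
        gcongr
        refine rpow_mul_rpow_le_one_add hX hY (by positivity)
          (div_nonneg (by linarith) (by linarith)) (le_of_eq ?_)
        field_simp; ring
      _ ≤ _ := by
        gcongr; linarith

/-- The term produced by differentiating the weight is of lower order: this is where the
restriction `q / p ≤ 1 + 1 / n` enters. -/
theorem rpow_sub_one_mul_le {n p q v a : ℝ} (hn : 2 ≤ n) (hp1 : 1 < p) (hp : p < n)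
    (hq1 : 1 < q) (hq : q < n) (hpq : q ≤ (1 + 1 / n) * p) (hv : 0 < v) (ha : 0 ≤ a) :
    a ^ ((n - 1) * (1 / (n - q)) - 1) * v ^ gagExp n q ≤
      1 + v ^ critExp n p + a ^ (critExp n q / q) * v ^ critExp n q := by
  have hnq : 0 < n - q := by linarith
  have hnp : 0 < n - p := by linarith
  have hc := lt_critExp hp1 hp
  have hc0 : 0 < critExp n p := by linarith
  have e : a ^ ((n - 1) * (1 / (n - q)) - 1) * v ^ gagExp n q =
      (v ^ critExp n p) ^ (q / critExp n p) *
        (a ^ (critExp n q / q) * v ^ critExp n q) ^ ((q - 1) / n) := by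
    rw [Real.mul_rpow (by positivity) (by positivity), ← Real.rpow_mul ha, ← Real.rpow_mul hv.le,
      ← Real.rpow_mul hv.le, mul_left_comm, ← Real.rpow_add hv]
    congr 2
    · unfold critExp; field_simp; ring
    · rw [mul_div_cancel₀ _ hc0.ne']
      unfold critExp gagExp; field_simp; ring
  rw [e]
  apply rpow_mul_rpow_le_one_add (by positivity) (by positivity) (by positivity)
  · exact div_nonneg (by linarith) (by linarith)
  · have : q / critExp n p = q * (n - p) / (n * p) := by unfold critExp; field_simp
    rw [this, div_add_div _ _ (by positivity) (by positivity), div_le_one (by positivity)]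
    have h2 : q * n ≤ (n + 1) * p := by
      have := mul_le_mul_of_nonneg_right hpq (by linarith : (0:ℝ) ≤ n)
      calc q * n ≤ _ := this
        _ = _ := by field_simp
    nlinarith

/-- Uniform quantitative form of the structural assumptions on exponents and weight. -/
structure PhaseBounds (N : ℕ) (p q a : EuclideanSpace ℝ (Fin N) → ℝ) (p₀ q₁ A : ℝ)
    (K : NNReal) : Prop where
  two_le : (2 : ℝ) ≤ N
  one_lt : 1 < p₀
  le_p : ∀ x, p₀ ≤ p x
  p_le_q : ∀ x, p x ≤ q x
  q_le : ∀ x, q x ≤ q₁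
  q_lt : q₁ < N
  lip_p : LipschitzWith K p
  lip_q : LipschitzWith K q
  lip_a : LipschitzWith K a
  a_nonneg : ∀ x, 0 ≤ a x
  a_le : ∀ x, a x ≤ A
  one_le : 1 ≤ A
  ratio : ∀ x, q x ≤ (1 + 1 / N) * p x

theorem PhaseBounds.fst {N : ℕ} {p q a : EuclideanSpace ℝ (Fin N) → ℝ} {p₀ q₁ A : ℝ}
    {K : NNReal} (h : PhaseBounds N p q a p₀ q₁ A K) :
    PhaseBounds N p p (fun _ => 1) p₀ q₁ A K where
  two_le := h.two_le
  one_lt := h.one_lt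
  le_p := h.le_p
  p_le_q := fun _ => le_rfl
  q_le := fun x => (h.p_le_q x).trans (h.q_le x)
  q_lt := h.q_lt
  lip_p := h.lip_p
  lip_q := h.lip_p
  lip_a := (LipschitzWith.const 1).weaken (zero_le)
  a_nonneg := fun _ => zero_le_one
  a_le := fun _ => h.one_le
  one_le := h.one_le
  ratio := fun x => by
    have h1 := h.le_p x
    have h2 := h.one_lt
    have h3 := h.two_le
    have : 0 ≤ 1 / (N : ℝ) * p x := mul_nonneg (by positivity) (by linarith)
    linarith

theorem abs_rpow_sub_rpow_le {M R s s' r r' : ℝ} (hM : 1 ≤ M) (hs : s ∈ Set.Icc 0 M)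
    (hs' : s' ∈ Set.Icc 0 M) (hr : r ∈ Set.Icc 1 R) (hr' : r' ∈ Set.Icc 1 R) :
    |s ^ r - s' ^ r'| ≤ (R * M ^ R) * |s - s'| + (1 + M ^ R * M) * |r - r'| := by
  have h1 : |s ^ r - s' ^ r| ≤ (R * M ^ R) * |s - s'| := by
    have := (convex_Icc (0:ℝ) M).norm_image_sub_le_of_norm_hasDerivWithin_le
      (f := fun x : ℝ => x ^ r) (f' := fun x => r * x ^ (r - 1)) (C := R * M ^ R)
      (fun x _ => (Real.hasDerivAt_rpow_const (Or.inr hr.1)).hasDerivWithinAt) ?_ hs' hs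
    · simpa [Real.norm_eq_abs] using this
    · intro x hx
      rw [Real.norm_eq_abs, abs_of_nonneg]
      · apply mul_le_mul hr.2 _ (Real.rpow_nonneg hx.1 _) (by linarith [hr.1, hr.2])
        calc x ^ (r - 1) ≤ M ^ (r - 1) := Real.rpow_le_rpow hx.1 hx.2 (by linarith [hr.1])
          _ ≤ M ^ R := Real.rpow_le_rpow_of_exponent_le hM (by linarith [hr.2])
      · exact mul_nonneg (by linarith [hr.1]) (Real.rpow_nonneg hx.1 _)
  have h2 : |s' ^ r - s' ^ r'| ≤ (1 + M ^ R * M) * |r - r'| := by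
    rcases hs'.1.eq_or_lt with h0 | h0
    · rw [← h0, Real.zero_rpow (by linarith [hr.1]), Real.zero_rpow (by linarith [hr'.1])]
      simp only [sub_zero, abs_zero]
      positivity
    · have := (convex_Icc (1:ℝ) R).norm_image_sub_le_of_norm_hasDerivWithin_le
        (f := fun y : ℝ => s' ^ y) (f' := fun y => s' ^ y * Real.log s') (C := 1 + M ^ R * M)
        (fun y _ => (Real.hasStrictDerivAt_const_rpow h0 y).hasDerivAt.hasDerivWithinAt) ?_ hr' hr
      · simpa [Real.norm_eq_abs] using this
      · intro y hy
        rw [Real.norm_eq_abs, abs_mul, abs_of_nonneg (Real.rpow_nonneg h0.le _)]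
        have hMR : 0 ≤ M ^ R := by positivity
        rcases le_total s' 1 with h3 | h3
        · have := rpow_mul_abs_log_le_one h0 h3 hy.1
          nlinarith
        · have e1 : s' ^ y ≤ M ^ R := (Real.rpow_le_rpow h0.le hs'.2 (by linarith [hy.1])).trans
            (Real.rpow_le_rpow_of_exponent_le hM hy.2)
          have e2 : |Real.log s'| ≤ M := by
            rw [abs_of_nonneg (Real.log_nonneg h3)]
            linarith [Real.log_le_sub_one_of_pos h0, hs'.2]
          calc s' ^ y * |Real.log s'| ≤ M ^ R * M := by gcongr
            _ ≤ _ := by linarith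
  calc |s ^ r - s' ^ r'| = |(s ^ r - s' ^ r) + (s' ^ r - s' ^ r')| := by ring_nf
    _ ≤ _ := (abs_add_le _ _).trans (add_le_add h1 h2)

theorem absolutelyContinuousOnInterval_rpow {f g : ℝ → ℝ} {α β R : ℝ} {C D : NNReal}
    (hf : LipschitzOnWith C f (Set.uIcc α β)) (hg : LipschitzOnWith D g (Set.uIcc α β))
    (hf0 : ∀ t, 0 ≤ f t) (hg1 : ∀ t, g t ∈ Set.Icc 1 R) :
    AbsolutelyContinuousOnInterval (fun t => f t ^ g t) α β := by
  obtain ⟨M, hM⟩ := (isCompact_uIcc.image_of_continuousOn hf.continuousOn).bddAbove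
  have hM' : ∀ t ∈ Set.uIcc α β, f t ∈ Set.Icc 0 (max M 1) := fun t ht =>
    ⟨hf0 t, (hM ⟨t, ht, rfl⟩).trans (le_max_left _ _)⟩
  have hR : 1 ≤ R := (hg1 0).1.trans (hg1 0).2
  set m := max M 1
  have hm : 1 ≤ m := le_max_right _ _
  have hmR : 0 ≤ m ^ R := by positivity
  refine LipschitzOnWith.absolutelyContinuousOnInterval
    (K := (R * m ^ R).toNNReal * C + (1 + m ^ R * m).toNNReal * D) ?_
  apply LipschitzOnWith.of_dist_le_mul
  intro t ht t' ht'
  have h1 := abs_rpow_sub_rpow_le hm (hM' t ht) (hM' t' ht') (hg1 t) (hg1 t')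
  have h2 := hf.dist_le_mul t ht t' ht'
  have h3 := hg.dist_le_mul t ht t' ht'
  rw [Real.dist_eq] at h2 h3 ⊢
  rw [NNReal.coe_add, NNReal.coe_mul, NNReal.coe_mul, Real.coe_toNNReal _ (by positivity),
    Real.coe_toNNReal _ (by positivity), add_mul, mul_assoc (R * m ^ R), mul_assoc (1 + m ^ R * m)]
  refine h1.trans (add_le_add ?_ ?_)
  · exact mul_le_mul_of_nonneg_left h2 (by positivity)
  · exact mul_le_mul_of_nonneg_left h3 (by positivity)

theorem lipschitzWith_one_div_sub {g : ℝ → ℝ} {n q₁ : ℝ} {K : NNReal} (hg : LipschitzWith K g)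
    (hq : ∀ t, g t ≤ q₁) (hn : q₁ < n) {c : ℝ} :
    ∃ L : NNReal, LipschitzWith L fun t => c * (1 / (n - g t)) := by
  have h0 : 0 < n - q₁ := sub_pos.2 hn
  refine ⟨(|c| * (1 / (n - q₁) ^ 2)).toNNReal * K, LipschitzWith.of_dist_le_mul fun s t => ?_⟩
  have h1 := hg.dist_le_mul s t
  have hs : n - q₁ ≤ n - g s := by linarith [hq s]
  have ht : n - q₁ ≤ n - g t := by linarith [hq t]
  have e : c * (1 / (n - g s)) - c * (1 / (n - g t)) =
      c * ((g s - g t) / ((n - g s) * (n - g t))) := by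
    have : n - g s ≠ 0 := by linarith
    have : n - g t ≠ 0 := by linarith
    field_simp; ring
  rw [Real.dist_eq] at h1 ⊢
  rw [e, abs_mul, abs_div, abs_of_pos (a := (n - g s) * (n - g t)) (by nlinarith)]
  rw [NNReal.coe_mul, Real.coe_toNNReal _ (by positivity), mul_assoc, mul_assoc]
  refine mul_le_mul_of_nonneg_left ?_ (abs_nonneg _)
  rw [one_div_mul_eq_div]
  apply div_le_div₀ (by positivity) h1 (by positivity)
  nlinarith

/-- The `a`-weighted power to which Gagliardo's inequality is applied. -/
noncomputable def gagFun (n q a v : ℝ) : ℝ := a ^ ((n - 1) * (1 / (n - q))) * v ^ gagExp n q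

theorem gagFun_nonneg {n q a v : ℝ} (ha : 0 ≤ a) (hv : 0 ≤ v) : 0 ≤ gagFun n q a v := by
  unfold gagFun; positivity

theorem gagFun_rpow {n q a v : ℝ} (hn : 2 ≤ n) (hq1 : 1 < q) (hq : q < n) (ha : 0 ≤ a)
    (hv : 0 ≤ v) :
    gagFun n q a v ^ (n / (n - 1)) = a ^ (critExp n q / q) * v ^ critExp n q := by
  have h1 : n - 1 ≠ 0 := by linarith
  have h2 : n - q ≠ 0 := by linarith
  have h3 : q ≠ 0 := by linarith
  unfold gagFun
  rw [Real.mul_rpow (by positivity) (by positivity), ← Real.rpow_mul ha, ← Real.rpow_mul hv,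
    ← critExp_eq_gagExp_mul hn hq]
  congr 2
  unfold critExp; field_simp

theorem gagFun_le {n q a v : ℝ} (hn : 2 ≤ n) (hq1 : 1 < q) (hq : q < n) (ha : 0 ≤ a)
    (hv : 0 ≤ v) : gagFun n q a v ≤ 1 + a ^ (critExp n q / q) * v ^ critExp n q := by
  rw [← gagFun_rpow hn hq1 hq ha hv]
  have h0 := gagFun_nonneg (n := n) (q := q) ha hv
  rcases le_total (gagFun n q a v) 1 with h | h
  · have : 0 ≤ gagFun n q a v ^ (n / (n - 1)) := by positivity
    linarith
  · have : gagFun n q a v ^ (1 : ℝ) ≤ gagFun n q a v ^ (n / (n - 1)) := by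
      apply Real.rpow_le_rpow_of_exponent_le h
      rw [one_le_div (by linarith)]; linarith
    rw [Real.rpow_one] at this
    linarith

theorem mul_abs_log_le_sq {a A : ℝ} (ha : 0 < a) (haA : a ≤ A) (hA : 1 ≤ A) :
    a * |Real.log a| ≤ A ^ 2 := by
  rcases le_total a 1 with h | h
  · have := Real.abs_log_mul_self_lt a ha h
    rw [abs_mul, abs_of_pos ha] at this
    nlinarith
  · rw [abs_of_nonneg (Real.log_nonneg h)]
    have := Real.log_le_sub_one_of_pos ha
    nlinarith

/-- Constant in the pointwise bound for the derivative of `gagFun` along lines. -/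
noncomputable def gagConst (n q₁ A K : ℝ) : ℝ :=
  n / (n - q₁) * K + n ^ 2 / (n - q₁) ^ 2 * K * A ^ 2 +
    n ^ 2 / (n - q₁) ^ 2 * K * (A ^ (n / (n - q₁)) + n) + n * n / (n - q₁)

theorem gagConst_nonneg {n q₁ A K : ℝ} (hn : 2 ≤ n) (hq : q₁ < n) (hA : 1 ≤ A) (hK : 0 ≤ K) :
    0 ≤ gagConst n q₁ A K := by
  have : 0 < n - q₁ := sub_pos.2 hq
  unfold gagConst; positivity

theorem hasDerivAt_gagFun {n q' a' v' t : ℝ} {q a v : ℝ → ℝ} (hqn : q t < n)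
    (ha : 0 < a t) (hv : 0 < v t) (hq' : HasDerivAt q q' t) (ha' : HasDerivAt a a' t)
    (hv' : HasDerivAt v v' t) :
    HasDerivAt (fun s => gagFun n (q s) (a s) (v s))
      ((a' * ((n - 1) * (1 / (n - q t))) * a t ^ ((n - 1) * (1 / (n - q t)) - 1) +
        (n - 1) * (q' / (n - q t) ^ 2) * a t ^ ((n - 1) * (1 / (n - q t))) * Real.log (a t)) *
          v t ^ gagExp n (q t) +
        a t ^ ((n - 1) * (1 / (n - q t))) *
          (v' * gagExp n (q t) * v t ^ (gagExp n (q t) - 1) +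
            (n - 1) * (n * (q' / (n - q t) ^ 2)) * v t ^ gagExp n (q t) * Real.log (v t))) t := by
  have h0 : n - q t ≠ 0 := by linarith
  have e1 : HasDerivAt (fun s => 1 / (n - q s)) (q' / (n - q t) ^ 2) t := by
    have := (hq'.const_sub n).fun_inv h0
    simpa [one_div] using this
  have e2 : HasDerivAt (fun s => (n - 1) * (1 / (n - q s))) ((n - 1) * (q' / (n - q t) ^ 2)) t :=
    e1.const_mul _
  have e3 : HasDerivAt (fun s => gagExp n (q s)) ((n - 1) * (n * (q' / (n - q t) ^ 2))) t :=
    ((e1.const_mul n).sub_const 1).const_mul _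
  exact (ha'.rpow e2 ha).mul (hv'.rpow e3 hv)

theorem abs_deriv_gagFun_le {n p q p₀ q₁ A K a v q' a' v' T μ : ℝ} (hn : 2 ≤ n) (hp0 : 1 < p₀)
    (hp : p₀ ≤ p) (hpq : p ≤ q) (hq : q ≤ q₁) (hqn : q₁ < n) (hA : 1 ≤ A) (haA : a ≤ A)
    (hK : 0 ≤ K) (hratio : q ≤ (1 + 1 / n) * p) (ha : 0 < a) (hv : 0 < v) (hq' : |q'| ≤ K)
    (ha' : |a'| ≤ K) (hv' : |v'| ≤ T) (hμ : 1 ≤ μ) :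
    |(a' * ((n - 1) * (1 / (n - q))) * a ^ ((n - 1) * (1 / (n - q)) - 1) +
        (n - 1) * (q' / (n - q) ^ 2) * a ^ ((n - 1) * (1 / (n - q))) * Real.log a) *
          v ^ gagExp n q +
        a ^ ((n - 1) * (1 / (n - q))) *
          (v' * gagExp n q * v ^ (gagExp n q - 1) +
            (n - 1) * (n * (q' / (n - q) ^ 2)) * v ^ gagExp n q * Real.log v)| ≤
      gagConst n q₁ A K * (μ * (v ^ critExp n p + a ^ (critExp n q / q) * v ^ critExp n q) +
        μ ^ (-(q - 1)) * (a * T ^ q) + 1) := by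
  have hD : 0 < n - q₁ := sub_pos.2 hqn
  have hDq : n - q₁ ≤ n - q := by linarith
  have hnq : 0 < n - q := by linarith
  have hT : 0 ≤ T := (abs_nonneg _).trans hv'
  have hp1 : 1 < p := by linarith
  have hq1 : 1 < q := by linarith
  have hμ0 : 0 < μ := by linarith
  set X := v ^ critExp n p with hX
  set Y := a ^ (critExp n q / q) * v ^ critExp n q with hY
  have hX0 : 0 ≤ X := by positivity
  have hY0 : 0 ≤ Y := by positivity
  set s := (n - 1) * (1 / (n - q)) with hs
  have hs0 : 0 ≤ s := mul_nonneg (by linarith) (by positivity)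
  have hsS : s ≤ n / (n - q₁) := by
    rw [hs, mul_one_div]
    exact div_le_div₀ (by linarith) (by linarith) hD hDq
  set r := gagExp n q with hr
  have hr1 : 1 < r := one_lt_gagExp hn hq1 (by linarith)
  have hrR : r ≤ n * n / (n - q₁) := gagExp_le hn (by linarith) hq hqn
  have hdq : |q' / (n - q) ^ 2| ≤ K / (n - q₁) ^ 2 := by
    rw [abs_div, abs_of_pos (a := (n - q) ^ 2) (by positivity)]
    gcongr
  have hs' : |(n - 1) * (q' / (n - q) ^ 2)| ≤ n ^ 2 / (n - q₁) ^ 2 * K := by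
    rw [abs_mul, abs_of_nonneg (by linarith : (0:ℝ) ≤ n - 1)]
    calc (n - 1) * |q' / (n - q) ^ 2| ≤ n ^ 2 * (K / (n - q₁) ^ 2) := by gcongr; nlinarith
      _ = _ := by ring
  have hr' : |(n - 1) * (n * (q' / (n - q) ^ 2))| ≤ n ^ 2 / (n - q₁) ^ 2 * K := by
    rw [← mul_assoc, abs_mul, abs_of_nonneg (mul_nonneg (by linarith) (by linarith) : (0:ℝ) ≤ (n - 1) * n)]
    calc (n - 1) * n * |q' / (n - q) ^ 2| ≤ n ^ 2 * (K / (n - q₁) ^ 2) := by gcongr; nlinarith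
      _ = _ := by ring
  have b1 : a ^ (s - 1) * v ^ r ≤ 1 + X + Y :=
    rpow_sub_one_mul_le hn hp1 (by linarith) hq1 (by linarith) hratio hv ha.le
  have b2 : a ^ s * v ^ r * |Real.log v| ≤ (A ^ (n / (n - q₁)) + n) * (1 + X + Y) :=
    mul_abs_log_le hn hp1 (by linarith) hq1 (by linarith) hv hA ha.le haA hsS
  have b3 : a ^ s * |Real.log a| * v ^ r ≤ A ^ 2 * (1 + X + Y) := by
    have : a ^ s = a ^ (s - 1) * a := by
      rw [← Real.rpow_add_one ha.ne']; ring_nf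
    rw [this]
    calc a ^ (s - 1) * a * |Real.log a| * v ^ r
        = (a * |Real.log a|) * (a ^ (s - 1) * v ^ r) := by ring
      _ ≤ A ^ 2 * (1 + X + Y) := by
        gcongr; exact mul_abs_log_le_sq ha haA hA
  have b4 : a ^ s * (v ^ (r - 1) * T) ≤ μ * Y + μ ^ (-(q - 1)) * (a * T ^ q) := by
    have e := rpow_gagExp_sub_one_mul_le hn hq1 (by linarith : q < n)
      (V := a ^ (1 / q) * v) (T := a ^ (1 / q) * T) (by positivity) (by positivity) hμ0
    rw [Real.mul_rpow (by positivity) hv.le, Real.mul_rpow (by positivity) hv.le,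
      Real.mul_rpow (by positivity) hT, ← Real.rpow_mul ha.le, ← Real.rpow_mul ha.le,
      ← Real.rpow_mul ha.le] at e
    have e1 : 1 / q * q = 1 := by field_simp
    have e2 : 1 / q * critExp n q = critExp n q / q := by ring
    have e3 : a ^ s = a ^ (1 / q * (r - 1)) * a ^ (1 / q) := by
      rw [← Real.rpow_add ha]; congr 1
      rw [hs, hr]; unfold gagExp; field_simp; ring
    rw [e1, Real.rpow_one, e2] at e
    rw [e3]
    calc _ = a ^ (1 / q * (r - 1)) * v ^ (r - 1) * (a ^ (1 / q) * T) := by ring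
      _ ≤ _ := e
  have has : 0 ≤ a ^ s := by positivity
  have hvr : 0 ≤ v ^ r := by positivity
  have hXY : 0 ≤ 1 + X + Y := by linarith
  have t1 : |a' * s * a ^ (s - 1) * v ^ r| ≤ n / (n - q₁) * K * (1 + X + Y) := by
    rw [abs_mul, abs_mul, abs_mul, abs_of_nonneg hs0, abs_of_nonneg hvr,
      abs_of_nonneg (a := a ^ (s - 1)) (by positivity)]
    calc |a'| * s * a ^ (s - 1) * v ^ r = s * |a'| * (a ^ (s - 1) * v ^ r) := by ring
      _ ≤ _ := by gcongr
  have t2 : |(n - 1) * (q' / (n - q) ^ 2) * a ^ s * Real.log a * v ^ r| ≤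
      n ^ 2 / (n - q₁) ^ 2 * K * A ^ 2 * (1 + X + Y) := by
    rw [abs_mul, abs_mul, abs_mul, abs_of_nonneg has, abs_of_nonneg hvr]
    calc _ = |(n - 1) * (q' / (n - q) ^ 2)| * (a ^ s * |Real.log a| * v ^ r) := by ring
      _ ≤ n ^ 2 / (n - q₁) ^ 2 * K * (A ^ 2 * (1 + X + Y)) := by gcongr
      _ = _ := by ring
  have t3 : |a ^ s * (v' * r * v ^ (r - 1))| ≤
      n * n / (n - q₁) * (μ * Y + μ ^ (-(q - 1)) * (a * T ^ q)) := by
    rw [abs_mul, abs_mul, abs_mul, abs_of_nonneg has, abs_of_nonneg (by linarith : 0 ≤ r),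
      abs_of_nonneg (a := v ^ (r - 1)) (by positivity)]
    calc a ^ s * (|v'| * r * v ^ (r - 1)) ≤ a ^ s * (T * (n * n / (n - q₁)) * v ^ (r - 1)) := by
          gcongr
      _ = n * n / (n - q₁) * (a ^ s * (v ^ (r - 1) * T)) := by ring
      _ ≤ _ := by gcongr
  have t4 : |a ^ s * ((n - 1) * (n * (q' / (n - q) ^ 2)) * v ^ r * Real.log v)| ≤
      n ^ 2 / (n - q₁) ^ 2 * K * (A ^ (n / (n - q₁)) + n) * (1 + X + Y) := by
    rw [abs_mul, abs_mul _ (Real.log v), abs_mul _ (v ^ r), abs_of_nonneg has, abs_of_nonneg hvr]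
    calc _ = |(n - 1) * (n * (q' / (n - q) ^ 2))| * (a ^ s * v ^ r * |Real.log v|) := by ring
      _ ≤ n ^ 2 / (n - q₁) ^ 2 * K * ((A ^ (n / (n - q₁)) + n) * (1 + X + Y)) := by gcongr
      _ = _ := by ring
  have key : ∀ x₁ x₂ x₃ x₄ : ℝ, |x₁ + x₂ + (x₃ + x₄)| ≤ |x₁| + |x₂| + |x₃| + |x₄| := by
    intro x₁ x₂ x₃ x₄
    have := abs_add_le (x₁ + x₂) (x₃ + x₄)
    have := abs_add_le x₁ x₂
    have := abs_add_le x₃ x₄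
    linarith
  rw [add_mul, mul_add]
  refine (key _ _ _ _).trans ?_
  set Z := μ ^ (-(q - 1)) * (a * T ^ q) with hZ
  have hZ0 : 0 ≤ Z := by positivity
  have m0 : X + Y ≤ μ * (X + Y) := le_mul_of_one_le_left (by linarith) hμ
  have m1 : 1 + X + Y ≤ μ * (X + Y) + Z + 1 := by linarith
  have m2 : μ * Y + Z ≤ μ * (X + Y) + Z + 1 := by
    have : 0 ≤ μ * X := by positivity
    rw [mul_add]; linarith
  have hM : 0 ≤ μ * (X + Y) + Z + 1 := by positivity
  unfold gagConst
  rw [add_mul, add_mul, add_mul]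
  have c1 : 0 ≤ n / (n - q₁) * K := by positivity
  have c2 : 0 ≤ n ^ 2 / (n - q₁) ^ 2 * K * A ^ 2 := by positivity
  have c3 : 0 ≤ n ^ 2 / (n - q₁) ^ 2 * K * (A ^ (n / (n - q₁)) + n) := by positivity
  have c4 : 0 ≤ n * n / (n - q₁) := by positivity
  have f1 := mul_le_mul_of_nonneg_left m1 c1
  have f2 := mul_le_mul_of_nonneg_left m1 c2
  have f3 := mul_le_mul_of_nonneg_left m1 c3
  have f4 := mul_le_mul_of_nonneg_left m2 c4
  linarith

theorem norm_gradient_eq {N : ℕ} (u : EuclideanSpace ℝ (Fin N) → ℝ) (x : EuclideanSpace ℝ (Fin N)) :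
    ‖gradient u x‖ = ‖fderiv ℝ u x‖ := by
  unfold gradient; exact LinearIsometryEquiv.norm_map _ _

theorem continuous_gradient {N : ℕ} {u : EuclideanSpace ℝ (Fin N) → ℝ} (hu : ContDiff ℝ 1 u) :
    Continuous (gradient u) := by
  unfold gradient
  exact (LinearIsometryEquiv.continuous _).comp (hu.continuous_fderiv one_ne_zero)

theorem lipschitzWith_line {N : ℕ} (z : EuclideanSpace ℝ (Fin N)) (i : Fin N) :
    LipschitzWith 1 fun t : ℝ => z + t • EuclideanSpace.single i (1 : ℝ) := by
  apply LipschitzWith.of_dist_le_mul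
  intro s t
  rw [dist_add_left, dist_eq_norm, ← sub_smul, norm_smul, PiLp.norm_single, Real.dist_eq]
  simp

theorem abs_deriv_le_of_lipschitzWith {K : NNReal} {f : ℝ → ℝ} (hf : LipschitzWith K f) (t : ℝ) :
    |deriv f t| ≤ K := norm_deriv_le_of_lipschitz hf

section Sobolev

variable {N : ℕ} {p q a : EuclideanSpace ℝ (Fin N) → ℝ} {p₀ q₁ A : ℝ} {K : NNReal}

theorem PhaseBounds.absolutelyContinuousOnInterval_gagFun (h : PhaseBounds N p q a p₀ q₁ A K)
    {u : EuclideanSpace ℝ (Fin N) → ℝ} (hu : ContDiff ℝ 1 u) (k : ℝ)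
    (z : EuclideanSpace ℝ (Fin N)) (i : Fin N) (α β : ℝ) :
    AbsolutelyContinuousOnInterval (fun t : ℝ =>
      gagFun N (q (z + t • EuclideanSpace.single i (1 : ℝ)))
        (a (z + t • EuclideanSpace.single i (1 : ℝ)))
        (max (u (z + t • EuclideanSpace.single i (1 : ℝ)) - k) 0)) α β := by
  have hq : LipschitzWith K fun t : ℝ => q (z + t • EuclideanSpace.single i (1 : ℝ)) := by
    simpa using! h.lip_q.comp (lipschitzWith_line z i)
  have ha : LipschitzWith K fun t : ℝ => a (z + t • EuclideanSpace.single i (1 : ℝ)) := by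
    simpa using! h.lip_a.comp (lipschitzWith_line z i)
  obtain ⟨L, hL⟩ : ∃ L : NNReal, LipschitzOnWith L
      (fun t : ℝ => u (z + t • EuclideanSpace.single i (1 : ℝ))) (Set.uIcc α β) := by
    have hc : ContDiff ℝ 1 fun t : ℝ => u (z + t • EuclideanSpace.single i (1 : ℝ)) := by
      fun_prop
    exact hc.locallyLipschitz.locallyLipschitzOn.exists_lipschitzOnWith_of_compact isCompact_uIcc
  have hv : LipschitzOnWith L
      (fun t : ℝ => max (u (z + t • EuclideanSpace.single i (1 : ℝ)) - k) 0) (Set.uIcc α β) := by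
    apply LipschitzOnWith.of_dist_le_mul
    intro s hs t ht
    refine le_trans ?_ (hL.dist_le_mul s hs t ht)
    rw [Real.dist_eq, Real.dist_eq]
    refine (abs_max_sub_max_le_abs _ _ _).trans (le_of_eq ?_)
    congr 1; ring
  obtain ⟨L₁, hL₁⟩ := lipschitzWith_one_div_sub (c := (N : ℝ) - 1) hq (fun t => h.q_le _) h.q_lt
  obtain ⟨L₂, hL₂⟩ := lipschitzWith_one_div_sub (c := ((N : ℝ) - 1) * N) hq (fun t => h.q_le _) h.q_lt
  have hL₃ : LipschitzWith L₂ fun t : ℝ =>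
      gagExp N (q (z + t • EuclideanSpace.single i (1 : ℝ))) := by
    apply LipschitzWith.of_dist_le_mul
    intro s t
    refine le_trans (le_of_eq ?_) (hL₂.dist_le_mul s t)
    rw [Real.dist_eq, Real.dist_eq]
    congr 1; unfold gagExp; ring
  have hD : 0 < (N : ℝ) - q₁ := sub_pos.2 h.q_lt
  have hn := h.two_le
  refine AbsolutelyContinuousOnInterval.fun_mul
    (absolutelyContinuousOnInterval_rpow (R := N / (N - q₁)) (ha.lipschitzOnWith)
      hL₁.lipschitzOnWith (fun t => h.a_nonneg _) ?_)
    (absolutelyContinuousOnInterval_rpow (R := N * N / (N - q₁)) hv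
      hL₃.lipschitzOnWith (fun t => le_max_right _ _) ?_)
  · intro t
    set x := z + t • EuclideanSpace.single i (1 : ℝ)
    have h1 := h.q_le x
    have h2 : 1 < q x := h.one_lt.trans_le ((h.le_p x).trans (h.p_le_q x))
    rw [mul_one_div]
    constructor
    · rw [one_le_div (by linarith)]; linarith
    · exact div_le_div₀ (by linarith) (by linarith) hD (by linarith)
  · intro t
    set x := z + t • EuclideanSpace.single i (1 : ℝ)
    have h1 := h.q_le x
    have h2 : 1 < q x := h.one_lt.trans_le ((h.le_p x).trans (h.p_le_q x))
    exact ⟨(one_lt_gagExp hn h2 (h1.trans_lt h.q_lt)).le, gagExp_le hn (by linarith) h1 h.q_lt⟩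

theorem PhaseBounds.lintegral_phase_le (h : PhaseBounds N p q a p₀ q₁ A K)
    {u : EuclideanSpace ℝ (Fin N) → ℝ} (hu : ContDiff ℝ 1 u) (k : ℝ)
    (y : EuclideanSpace ℝ (Fin N)) {ℓ₀ ℓ μ π : ℝ} (hℓ₀ : 0 < ℓ₀) (hℓ : ℓ₀ ≤ ℓ) (hμ : 1 ≤ μ)
    (hπ : ∀ x ∈ cube y ℓ, π ≤ q x) :
    ∫⁻ x in cube y ℓ, ENNReal.ofReal
        (a x ^ (critExp N (q x) / q x) * max (u x - k) 0 ^ critExp N (q x)) ≤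
      (∫⁻ x in cube y ℓ ∩ {x | k < u x}, ENNReal.ofReal ((gagConst N q₁ A K + 1 / ℓ₀) *
        (μ * (max (u x - k) 0 ^ critExp N (p x) +
            a x ^ (critExp N (q x) / q x) * max (u x - k) 0 ^ critExp N (q x)) +
          μ ^ (-(π - 1)) * (a x * ‖gradient u x‖ ^ q x) + 1))) ^ ((N : ℝ) / (N - 1)) := by
  have hn := h.two_le
  have hN2 : 2 ≤ N := by exact_mod_cast hn
  have hpos : 0 ≤ (N : ℝ) / (N - 1) := div_nonneg (by linarith) (by linarith)
  have hp1 : ∀ x, 1 < p x := fun x => h.one_lt.trans_le (h.le_p x)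
  have hq1 : ∀ x, 1 < q x := fun x => (hp1 x).trans_le (h.p_le_q x)
  have hqN : ∀ x, q x < N := fun x => (h.q_le x).trans_lt h.q_lt
  have hC : 0 ≤ gagConst N q₁ A K := gagConst_nonneg hn h.q_lt h.one_le K.2
  have mp : Measurable p := h.lip_p.continuous.measurable
  have mq : Measurable q := h.lip_q.continuous.measurable
  have ma : Measurable a := h.lip_a.continuous.measurable
  have mu : Measurable u := hu.continuous.measurable
  have mg : Measurable fun x => ‖gradient u x‖ := (continuous_gradient hu).norm.measurable
  have mset : MeasurableSet {x | k < u x} := measurableSet_lt measurable_const mu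
  set g : EuclideanSpace ℝ (Fin N) → ℝ := fun x => (gagConst N q₁ A K + 1 / ℓ₀) *
        (μ * (max (u x - k) 0 ^ critExp N (p x) +
            a x ^ (critExp N (q x) / q x) * max (u x - k) 0 ^ critExp N (q x)) +
          μ ^ (-(π - 1)) * (a x * ‖gradient u x‖ ^ q x) + 1) with hg
  have mgm : Measurable g := by unfold critExp at hg; rw [hg]; fun_prop
  have hμ0 : 0 < μ := by linarith
  have hw0 : ∀ x, 0 ≤ gagFun N (q x) (a x) (max (u x - k) 0) := fun x =>
    gagFun_nonneg (h.a_nonneg x) (le_max_right _ _)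
  have hg0 : ∀ x, 0 ≤ g x := by
    intro x
    have := h.a_nonneg x
    have := le_max_right (u x - k) 0
    rw [hg]; positivity
  have key := lintegral_cube_rpow_le hN2 y (ℓ := ℓ)
    (w := fun x => gagFun N (q x) (a x) (max (u x - k) 0))
    (G := ({x | k < u x}).indicator g) (mgm.indicator mset) hw0
    (fun z i α β => h.absolutelyContinuousOnInterval_gagFun hu k z i α β) ?_
  · refine le_trans (le_of_eq ?_) (key.trans (le_of_eq ?_))
    · congr 1; ext x
      rw [ENNReal.ofReal_rpow_of_nonneg (hw0 x) hpos,
        gagFun_rpow hn (hq1 x) (hqN x) (h.a_nonneg x) (le_max_right _ _)]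
    · congr 1
      rw [Set.inter_comm, ← Measure.restrict_restrict mset, ← lintegral_indicator mset]
      congr 1; ext x
      by_cases hx : x ∈ {x | k < u x} <;> simp [hx, hg]
  intro z i
  have hql : LipschitzWith K fun t : ℝ => q (z + t • EuclideanSpace.single i (1 : ℝ)) := by
    simpa using! h.lip_q.comp (lipschitzWith_line z i)
  have hal : LipschitzWith K fun t : ℝ => a (z + t • EuclideanSpace.single i (1 : ℝ)) := by
    simpa using! h.lip_a.comp (lipschitzWith_line z i)
  filter_upwards [hql.ae_differentiableAt_real, hal.ae_differentiableAt_real] with t hqt hat hmem w' hw'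
  set x := z + t • EuclideanSpace.single i (1 : ℝ) with hx
  have hcase : gagFun N (q x) (a x) (max (u x - k) 0) = 0 →
      |w'| + gagFun N (q x) (a x) (max (u x - k) 0) / ℓ ≤ ({x | k < u x}).indicator g x := by
    intro h0
    have hmin : IsLocalMin (fun t : ℝ =>
      gagFun N (q (z + t • EuclideanSpace.single i (1 : ℝ)))
        (a (z + t • EuclideanSpace.single i (1 : ℝ)))
        (max (u (z + t • EuclideanSpace.single i (1 : ℝ)) - k) 0)) t := by
      refine Eventually.of_forall fun s => ?_
      simp only [← hx, h0]
      exact hw0 _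
    rw [hmin.hasDerivAt_eq_zero hw', h0]
    simp only [abs_zero, zero_div, add_zero]
    exact Set.indicator_nonneg (fun x _ => hg0 x) x
  rcases (h.a_nonneg x).eq_or_lt with ha0 | ha0
  · apply hcase
    have : ((N : ℝ) - 1) * (1 / (N - q x)) ≠ 0 := by
      have := hqN x
      have : (0:ℝ) < N - q x := by linarith
      have : (0:ℝ) < N - 1 := by linarith
      positivity
    unfold gagFun; rw [← ha0, Real.zero_rpow this, zero_mul]
  by_cases hk : k < u x
  swap
  · apply hcase
    have : gagExp N (q x) ≠ 0 := by
      have := one_lt_gagExp hn (hq1 x) (hqN x)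
      linarith
    unfold gagFun
    rw [max_eq_right (by linarith : u x - k ≤ 0), Real.zero_rpow this, mul_zero]
  rw [Set.indicator_of_mem (by exact hk)]
  have hU : HasDerivAt (fun t : ℝ => u (z + t • EuclideanSpace.single i (1 : ℝ)))
      (fderiv ℝ u x (EuclideanSpace.single i (1 : ℝ))) t := by
    have h1 : HasDerivAt (fun t : ℝ => z + t • EuclideanSpace.single i (1 : ℝ))
        (EuclideanSpace.single i (1 : ℝ)) t := by
      simpa using ((hasDerivAt_id t).smul_const (EuclideanSpace.single i (1 : ℝ))).const_add z
    exact ((hu.differentiable one_ne_zero) x).hasFDerivAt.comp_hasDerivAt t h1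
  have hUT : |fderiv ℝ u x (EuclideanSpace.single i (1 : ℝ))| ≤ ‖gradient u x‖ := by
    rw [norm_gradient_eq]
    simpa using (fderiv ℝ u x).le_opNorm (EuclideanSpace.single i (1 : ℝ))
  have hV : HasDerivAt (fun t : ℝ => max (u (z + t • EuclideanSpace.single i (1 : ℝ)) - k) 0)
      (fderiv ℝ u x (EuclideanSpace.single i (1 : ℝ))) t := by
    refine (hU.sub_const k).congr_of_eventuallyEq ?_
    have : ∀ᶠ s in nhds t, k < u (z + s • EuclideanSpace.single i (1 : ℝ)) :=
      hU.continuousAt.eventually (lt_mem_nhds hk)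
    filter_upwards [this] with s hs
    rw [max_eq_left (by linarith)]
  have hv0 : 0 < max (u x - k) 0 := lt_max_of_lt_left (by linarith)
  have hd := hasDerivAt_gagFun (n := N)
    (q := fun t => q (z + t • EuclideanSpace.single i (1 : ℝ)))
    (a := fun t => a (z + t • EuclideanSpace.single i (1 : ℝ)))
    (v := fun t => max (u (z + t • EuclideanSpace.single i (1 : ℝ)) - k) 0)
    (hqN x) ha0 hv0 hqt.hasDerivAt hat.hasDerivAt hV
  have hle := abs_deriv_gagFun_le hn h.one_lt (h.le_p x) (h.p_le_q x) (h.q_le x) h.q_lt h.one_le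
    (h.a_le x) K.2 (h.ratio x) ha0 hv0 (abs_deriv_le_of_lipschitzWith hql t)
    (abs_deriv_le_of_lipschitzWith hal t) hUT hμ
  rw [hw'.unique hd]
  have hle2 := gagFun_le hn (hq1 x) (hqN x) (h.a_nonneg x) hv0.le
  have hgl : gagFun N (q x) (a x) (max (u x - k) 0) / ℓ ≤
      1 / ℓ₀ * (1 + a x ^ (critExp N (q x) / q x) * max (u x - k) 0 ^ critExp N (q x)) := by
    rw [one_div_mul_eq_div]
    exact div_le_div₀ (add_nonneg zero_le_one (by have := h.a_nonneg x; positivity)) hle2 hℓ₀ hℓ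
  have hμq : μ ^ (-(q x - 1)) ≤ μ ^ (-(π - 1)) :=
    Real.rpow_le_rpow_of_exponent_le hμ (by linarith [hπ x hmem])
  refine (add_le_add hle hgl).trans ?_
  simp only [hg]
  set X := max (u x - k) 0 ^ critExp N (p x)
  set Y := a x ^ (critExp N (q x) / q x) * max (u x - k) 0 ^ critExp N (q x) with hY
  have hX0 : 0 ≤ X := by positivity
  have hY0 : 0 ≤ Y := by have := h.a_nonneg x; positivity
  have hT0 : 0 ≤ a x * ‖gradient u x‖ ^ q x := by have := h.a_nonneg x; positivity
  have m0 : X + Y ≤ μ * (X + Y) := le_mul_of_one_le_left (by linarith) hμ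
  rw [add_mul (gagConst N q₁ A K)]
  refine add_le_add (mul_le_mul_of_nonneg_left ?_ hC)
    (mul_le_mul_of_nonneg_left ?_ (by positivity))
  · gcongr
  · have : 0 ≤ μ ^ (-(π - 1)) * (a x * ‖gradient u x‖ ^ q x) := by positivity
    linarith

/-- The critical double phase integrand `v^{p*} + a^{q*/q} v^{q*}`. -/
noncomputable def critFun (n p q a v : ℝ) : ℝ :=
  v ^ critExp n p + a ^ (critExp n q / q) * v ^ critExp n q

/-- Sobolev-type modular inequality on cubes for truncations `(u - k)⁺`. -/
theorem PhaseBounds.lintegral_critFun_le (h : PhaseBounds N p q a p₀ q₁ A K)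
    {u : EuclideanSpace ℝ (Fin N) → ℝ} (hu : ContDiff ℝ 1 u) (k : ℝ)
    (y : EuclideanSpace ℝ (Fin N)) {ℓ₀ ℓ μ π : ℝ} (hℓ₀ : 0 < ℓ₀) (hℓ : ℓ₀ ≤ ℓ) (hμ : 1 ≤ μ)
    (hπ : ∀ x ∈ cube y ℓ, π ≤ p x) :
    ∫⁻ x in cube y ℓ, ENNReal.ofReal (critFun N (p x) (q x) (a x) (max (u x - k) 0)) ≤
      2 * (∫⁻ x in cube y ℓ ∩ {x | k < u x}, ENNReal.ofReal (2 * (gagConst N q₁ A K + 1 / ℓ₀) *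
        (μ * critFun N (p x) (q x) (a x) (max (u x - k) 0) +
          μ ^ (-(π - 1)) * Hfun p q a x ‖gradient u x‖ + 1))) ^ ((N : ℝ) / (N - 1)) := by
  have hn := h.two_le
  have hpos : 0 ≤ (N : ℝ) / (N - 1) := div_nonneg (by linarith) (by linarith)
  have hC : 0 ≤ gagConst N q₁ A K := gagConst_nonneg hn h.q_lt h.one_le K.2
  have hμ0 : 0 < μ := by linarith
  have mp : Measurable p := h.lip_p.continuous.measurable
  have mu : Measurable u := hu.continuous.measurable
  have h1 := h.fst.lintegral_phase_le hu k y hℓ₀ hℓ hμ hπ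
  have h2 := h.lintegral_phase_le hu k y hℓ₀ hℓ hμ (fun x hx => (hπ x hx).trans (h.p_le_q x))
  unfold critFun
  have e : ∀ x, ENNReal.ofReal (max (u x - k) 0 ^ critExp N (p x) +
      a x ^ (critExp N (q x) / q x) * max (u x - k) 0 ^ critExp N (q x)) =
      ENNReal.ofReal (max (u x - k) 0 ^ critExp N (p x)) +
      ENNReal.ofReal (a x ^ (critExp N (q x) / q x) * max (u x - k) 0 ^ critExp N (q x)) := by
    intro x
    have := h.a_nonneg x
    have := le_max_right (u x - k) 0
    exact ENNReal.ofReal_add (by positivity) (by positivity)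
  simp only [e]
  rw [lintegral_add_left (by unfold critExp; fun_prop), two_mul]
  simp only [Real.one_rpow, one_mul] at h1
  refine add_le_add (h1.trans ?_) (h2.trans ?_)
  all_goals
    apply ENNReal.rpow_le_rpow _ hpos
    apply lintegral_mono
    intro x
    apply ENNReal.ofReal_le_ofReal
    have := h.a_nonneg x
    have := le_max_right (u x - k) 0
    have hX : 0 ≤ max (u x - k) 0 ^ critExp N (p x) := by positivity
    have hY : 0 ≤ a x ^ (critExp N (q x) / q x) * max (u x - k) 0 ^ critExp N (q x) := by positivity
    have hT : 0 ≤ ‖gradient u x‖ ^ p x := by positivity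
    have hTq : 0 ≤ a x * ‖gradient u x‖ ^ q x := by positivity
    have hπ0 : 0 ≤ μ ^ (-(π - 1)) := by positivity
    rw [mul_comm (2:ℝ), mul_assoc]
    apply mul_le_mul_of_nonneg_left _ (by positivity)
    unfold Hfun
    have e1 := mul_nonneg hμ0.le hX
    have e2 := mul_nonneg hμ0.le hY
    have e3 := mul_nonneg hπ0 hT
    have e4 := mul_nonneg hπ0 hTq
    simp only [mul_add]
    linarith

end Sobolev

theorem lt_critExp_of_ratio {n p q : ℝ} (hn : 2 ≤ n) (hp1 : 1 < p) (hp : p < n)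
    (hratio : q ≤ (1 + 1 / n) * p) : q ≤ critExp n p := by
  refine hratio.trans ?_
  have h1 : 0 < n - p := by linarith
  unfold critExp
  rw [le_div_iff₀ h1]
  have : (1 + 1 / n) * p * (n - p) = p * ((n + 1) * (n - p) / n) := by field_simp
  rw [this, mul_comm n p]
  apply mul_le_mul_of_nonneg_left _ (by linarith)
  rw [div_le_iff₀ (by linarith)]
  nlinarith

/-- Young's inequality with a parameter, for a conjugate pair of exponents. -/
theorem mul_le_rpow_young {r k s Z θ : ℝ} (hr : 1 < r) (hk : 0 ≤ k) (hs : 0 ≤ s) (hZ : 0 < Z)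
    (hZ1 : Z ≤ 1) (hθ : θ * r ≤ 1) :
    k * s ≤ Z ^ θ * k ^ (r / (r - 1)) + Z ^ (θ - 1) * s ^ r := by
  have hr1 : 0 < r - 1 := by linarith
  have h := rpow_mul_le_young hr (A := k ^ (r / (r - 1))) (by positivity) hs
    (μ := Z ^ θ) (by positivity)
  rw [← Real.rpow_mul hk, ← Real.rpow_mul hZ.le] at h
  have e : r / (r - 1) * ((r - 1) / r) = 1 := by field_simp
  rw [e, Real.rpow_one] at h
  refine h.trans (add_le_add le_rfl ?_)
  apply mul_le_mul_of_nonneg_right _ (by positivity)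
  apply Real.rpow_le_rpow_of_exponent_ge hZ hZ1
  nlinarith

theorem critFun_nonneg {n p q a v : ℝ} (ha : 0 ≤ a) (hv : 0 ≤ v) : 0 ≤ critFun n p q a v := by
  unfold critFun; positivity

theorem mul_rpow_le_of_le {b s r Q : ℝ} (hb : 1 ≤ b) (hs : 0 ≤ s) (hr : r ≤ Q) :
    (b * s) ^ r ≤ b ^ Q * s ^ r := by
  rw [Real.mul_rpow (by linarith) hs]
  gcongr

set_option maxHeartbeats 1000000 in
/-- Pointwise absorption estimate behind the Caccioppoli inequality. -/
theorem absorption_le {n p q q₁ a A s u T b z z' Z θ ρ σ k d M L M₃ ε : ℝ} (hn : 2 ≤ n)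
    (hp1 : 1 < p) (hpq : p ≤ q) (hq : q ≤ q₁) (hqn : q₁ < n) (hratio : q ≤ (1 + 1 / n) * p)
    (ha : 0 ≤ a) (haA : a ≤ A) (hs : 0 ≤ s) (hu : 0 < u) (hus : u ≤ b * s) (hbs : 1 ≤ b * s)
    (hb : 1 ≤ b) (hT : 0 ≤ T) (hz : 0 ≤ z) (hz1 : z ≤ 1) (hz1' : z' ≤ 1)
    (hzp : z' ≤ z ^ ((p - 1) / p)) (hzq : z' ≤ z ^ ((q - 1) / q)) (hZ : 0 < Z) (hZ1 : Z ≤ 1)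
    (hθ1 : θ ≤ 1) (hρ : 1 < ρ) (hσ : 1 < σ) (hρp : ρ ≤ critExp n p) (hσp : σ ≤ critExp n p)
    (hθρ : θ * ρ ≤ 1) (hθσ : θ * σ ≤ 1) (hk : 0 ≤ k) (hd : 0 ≤ d) (hM : 0 ≤ M) (hL : 0 ≤ L)
    (hM₃ : 0 ≤ M₃) (hε : 0 < ε) (hε1 : ε ≤ 1) :
    M * (b * s * z') * (k + u ^ (critExp n p - 1) +
        a ^ (critExp n q / q) * u ^ (critExp n q - 1) + T ^ (p - 1) + a * T ^ (q - 1)) +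
      L * (s * z) * (d + u ^ (critExp n p - 1) +
        a ^ (critExp n q / q) * u ^ (critExp n q - 1) +
        T ^ (p / (critExp n p / (critExp n p - 1))) +
        a ^ ((n + 1) / n) * T ^ (q / (critExp n q / (critExp n q - 1)))) +
      M₃ * (critFun n p q a u + 1) ≤
    (M + L) * ε * (z * (T ^ p + a * T ^ q)) +
      (M * (2 + (1 + A) * ε ^ (-(n * n / (n - q₁)))) + L * (2 + 2 * ε ^ (-(n * n / (n - q₁)))) +
        2 * M₃) * b ^ (n * n / (n - q₁) + 1) *
        (Z ^ (θ - 1) * critFun n p q a s +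
          Z ^ θ * (k ^ (ρ / (ρ - 1)) + d ^ (σ / (σ - 1)))) := by
  have hq1 : 1 < q := by linarith
  have hpn : p < n := by linarith
  have hqn' : q < n := by linarith
  set Q := n * n / (n - q₁) with hQ
  set P := critExp n p with hP
  set R := critExp n q with hR
  have hpP : p < P := lt_critExp hp1 hpn
  have hqR : q < R := lt_critExp hq1 hqn'
  have hPQ : P ≤ Q := critExp_le (by linarith) (by linarith) hqn
  have hRQ : R ≤ Q := critExp_le (by linarith) hq hqn
  have hqP : q ≤ P := lt_critExp_of_ratio hn hp1 hpn hratio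
  have hb0 : 0 < b := by linarith
  set S := critFun n p q a s with hS
  have hA : 0 ≤ A := ha.trans haA
  have hSX : s ^ P ≤ S := by
    have : 0 ≤ a ^ (R / q) * s ^ R := by positivity
    simp only [hS, critFun]; linarith
  have hSY : a ^ (R / q) * s ^ R ≤ S := by
    have : 0 ≤ s ^ P := by positivity
    simp only [hS, critFun]; linarith
  have hS0 : 0 ≤ S := critFun_nonneg ha hs
  have hbQ : 1 ≤ b ^ Q := Real.one_le_rpow hb (by linarith)
  set w := Z ^ (θ - 1) with hw
  have hw1 : 1 ≤ w := Real.one_le_rpow_of_pos_of_le_one_of_nonpos hZ hZ1 (by linarith)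
  set E := ε ^ (-Q) with hE
  have hE1 : 1 ≤ E := Real.one_le_rpow_of_pos_of_le_one_of_nonpos hε hε1 (by linarith)
  have hEe : ∀ e, e ≤ Q → ε ^ (-e) ≤ E := fun e he =>
    Real.rpow_le_rpow_of_exponent_ge hε hε1 (by linarith)
  set D := b ^ (Q + 1) with hD
  have hDeq : D = b ^ Q * b := by rw [hD, Real.rpow_add hb0, Real.rpow_one]
  have hbQD : b ^ Q ≤ D := by rw [hDeq]; exact le_mul_of_one_le_right (by linarith) hb
  have hD1 : 1 ≤ D := hbQ.trans hbQD
  have hbD : b ≤ D := by rw [hDeq]; exact le_mul_of_one_le_left (by linarith) hbQ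
  have hD0 : 0 ≤ D := by linarith
  set F := D * (w * S) with hF
  have hbsr : ∀ r, r ≤ P → (b * s) ^ r ≤ b ^ Q * S := by
    intro r hr
    calc (b * s) ^ r ≤ (b * s) ^ P := Real.rpow_le_rpow_of_exponent_le hbs hr
      _ ≤ b ^ Q * s ^ P := mul_rpow_le_of_le hb hs hPQ
      _ ≤ b ^ Q * S := by gcongr
  have hwS : S ≤ w * S := le_mul_of_one_le_left hS0 hw1
  have hbF : b * (b ^ Q * S) ≤ F := by
    rw [hF, hDeq]
    calc b * (b ^ Q * S) = b ^ Q * b * S := by ring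
      _ ≤ _ := by gcongr
  have hQF : b ^ Q * S ≤ F := by
    rw [hF]; gcongr
  have hSF : S ≤ F := (le_mul_of_one_le_left hS0 hbQ).trans hQF
  have hF0 : 0 ≤ F := hS0.trans hSF
  have hur : ∀ r : ℝ, 1 ≤ r → b * s * u ^ (r - 1) ≤ (b * s) ^ r := by
    intro r hr
    calc b * s * u ^ (r - 1) ≤ b * s * (b * s) ^ (r - 1) := by gcongr
      _ = (b * s) ^ r := by
        rw [← Real.rpow_one_add' (by positivity) (by linarith)]; ring_nf
  have haY : a ^ (R / q) * (b * s) ^ R ≤ b ^ Q * (a ^ (R / q) * s ^ R) := by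
    calc a ^ (R / q) * (b * s) ^ R ≤ a ^ (R / q) * (b ^ Q * s ^ R) := by
          gcongr; exact mul_rpow_le_of_le hb hs hRQ
      _ = _ := by ring
  have hGbs : (b * s) ^ P + a ^ (R / q) * (b * s) ^ R ≤ b ^ Q * S := by
    have := mul_rpow_le_of_le (Q := Q) hb hs hPQ
    simp only [hS, critFun]
    rw [mul_add]
    exact add_le_add this haY
  have hG' : b * s * (u ^ (P - 1) + a ^ (R / q) * u ^ (R - 1)) ≤ b ^ Q * S := by
    refine le_trans ?_ hGbs
    have e1 := hur P (by linarith)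
    have e2 := mul_le_mul_of_nonneg_left (hur R (by linarith)) (by positivity : 0 ≤ a ^ (R / q))
    linarith
  have hGu : critFun n p q a u ≤ b ^ Q * S := by
    refine le_trans ?_ hGbs
    unfold critFun
    have : 0 ≤ critExp n p := by linarith
    have : 0 ≤ critExp n q := by linarith
    gcongr
  have h1S : 1 ≤ b ^ Q * S := by simpa using hbsr 0 (by linarith)
  have hG'0 : 0 ≤ u ^ (P - 1) + a ^ (R / q) * u ^ (R - 1) := by positivity
  -- terms multiplied by `M`
  have m1 : b * s * z' * k ≤ D * (Z ^ θ * k ^ (ρ / (ρ - 1))) + F := by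
    have e := mul_le_rpow_young hρ hk hs hZ hZ1 hθρ
    have e2 : s ^ ρ ≤ b ^ Q * S := (Real.rpow_le_rpow hs (le_mul_of_one_le_left hs hb)
      (by linarith)).trans (hbsr ρ hρp)
    have hkk : 0 ≤ Z ^ θ * k ^ (ρ / (ρ - 1)) := by positivity
    calc b * s * z' * k ≤ b * s * 1 * k := by gcongr
      _ = b * (k * s) := by ring
      _ ≤ b * (Z ^ θ * k ^ (ρ / (ρ - 1)) + w * (b ^ Q * S)) := by
        gcongr; refine e.trans ?_; gcongr
      _ = b * (Z ^ θ * k ^ (ρ / (ρ - 1))) + F := by rw [hF, hDeq]; ring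
      _ ≤ _ := by gcongr
  have m2 : b * s * z' * (u ^ (P - 1) + a ^ (R / q) * u ^ (R - 1)) ≤ F := by
    calc _ ≤ b * s * 1 * (u ^ (P - 1) + a ^ (R / q) * u ^ (R - 1)) := by gcongr
      _ ≤ b ^ Q * S := by rw [mul_one]; exact hG'
      _ ≤ F := hQF
  have young : ∀ r, 1 < r → r ≤ q → z' ≤ z ^ ((r - 1) / r) →
      b * s * z' * T ^ (r - 1) ≤ ε * (z * T ^ r) + E * F := by
    intro r hr hrq hzr
    have e := rpow_mul_le_young hr (A := z * T ^ r) (T := b * s) (by positivity) (by positivity) hε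
    rw [Real.mul_rpow hz (by positivity), ← Real.rpow_mul hT] at e
    have e1 : r * ((r - 1) / r) = r - 1 := by field_simp
    rw [e1] at e
    calc b * s * z' * T ^ (r - 1) ≤ b * s * z ^ ((r - 1) / r) * T ^ (r - 1) := by gcongr
      _ = z ^ ((r - 1) / r) * T ^ (r - 1) * (b * s) := by ring
      _ ≤ _ := e
      _ ≤ _ := by
        gcongr
        · exact hEe _ (by linarith)
        · exact (hbsr r (by linarith)).trans hQF
  have m3 := young p hp1 hpq hzp
  have m4 : b * s * z' * (a * T ^ (q - 1)) ≤ ε * (z * (a * T ^ q)) + A * E * F := by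
    have e := mul_le_mul_of_nonneg_left (young q hq1 le_rfl hzq) ha
    have e2 : a * (E * F) ≤ A * (E * F) := by gcongr
    rw [mul_add] at e
    linarith
  -- terms multiplied by `L`
  have l1 : s * z * d ≤ D * (Z ^ θ * d ^ (σ / (σ - 1))) + F := by
    have e := mul_le_rpow_young hσ hd hs hZ hZ1 hθσ
    have e2 : s ^ σ ≤ b ^ Q * S := (Real.rpow_le_rpow hs (le_mul_of_one_le_left hs hb)
      (by linarith)).trans (hbsr σ hσp)
    have hkk : 0 ≤ Z ^ θ * d ^ (σ / (σ - 1)) := by positivity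
    calc s * z * d ≤ s * 1 * d := by gcongr
      _ = d * s := by ring
      _ ≤ Z ^ θ * d ^ (σ / (σ - 1)) + w * (b ^ Q * S) := by refine e.trans ?_; gcongr
      _ ≤ D * (Z ^ θ * d ^ (σ / (σ - 1))) + D * (w * S) := by
        apply add_le_add (le_mul_of_one_le_left hkk hD1)
        calc w * (b ^ Q * S) = b ^ Q * (w * S) := by ring
          _ ≤ _ := by gcongr
  have l2 : s * z * (u ^ (P - 1) + a ^ (R / q) * u ^ (R - 1)) ≤ F := by
    calc _ ≤ b * s * 1 * (u ^ (P - 1) + a ^ (R / q) * u ^ (R - 1)) := by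
          gcongr; exact le_mul_of_one_le_left hs hb
      _ ≤ b ^ Q * S := by rw [mul_one]; exact hG'
      _ ≤ F := hQF
  have l3 : s * z * T ^ (p / (P / (P - 1))) ≤ ε * (z * T ^ p) + E * F := by
    have e := rpow_mul_le_young (p := P) (by linarith) (A := T ^ p) (T := s) (by positivity) hs hε
    rw [← Real.rpow_mul hT] at e
    have e1 : p / (P / (P - 1)) = p * ((P - 1) / P) := by
      have : P ≠ 0 := by linarith
      have : P - 1 ≠ 0 := by linarith
      field_simp
    rw [e1]
    calc s * z * T ^ (p * ((P - 1) / P)) = z * (T ^ (p * ((P - 1) / P)) * s) := by ring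
      _ ≤ z * (ε * T ^ p + ε ^ (-(P - 1)) * s ^ P) := by gcongr
      _ ≤ z * (ε * T ^ p) + 1 * (ε ^ (-(P - 1)) * s ^ P) := by
        rw [mul_add]; gcongr
      _ ≤ z * (ε * T ^ p) + 1 * (E * F) := by
        gcongr
        · exact hEe _ (by linarith)
        · exact hSX.trans hSF
      _ = _ := by ring
  have l4 : s * z * (a ^ ((n + 1) / n) * T ^ (q / (R / (R - 1)))) ≤
      ε * (z * (a * T ^ q)) + E * F := by
    have e := rpow_mul_le_young (p := R) (by linarith) (A := a * T ^ q) (T := a ^ (1 / q) * s)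
      (by positivity) (by positivity) hε
    rw [Real.mul_rpow ha (by positivity), ← Real.rpow_mul hT, Real.mul_rpow (by positivity) hs,
      ← Real.rpow_mul ha] at e
    have e1 : q / (R / (R - 1)) = q * ((R - 1) / R) := by
      have : R ≠ 0 := by linarith
      have : R - 1 ≠ 0 := by linarith
      field_simp
    have e2 : a ^ ((n + 1) / n) = a ^ ((R - 1) / R) * a ^ (1 / q) := by
      have hR0 : 0 < R := by linarith
      rw [← Real.rpow_add_of_nonneg ha (div_nonneg (by linarith) hR0.le) (by positivity)]
      congr 1
      have : n - q ≠ 0 := by linarith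
      have : q ≠ 0 := by linarith
      have : n ≠ 0 := by linarith
      rw [hR]; unfold critExp; field_simp; ring
    have e3 : 1 / q * R = R / q := by ring
    rw [e3] at e
    rw [e1, e2]
    calc s * z * (a ^ ((R - 1) / R) * a ^ (1 / q) * T ^ (q * ((R - 1) / R)))
        = z * (a ^ ((R - 1) / R) * T ^ (q * ((R - 1) / R)) * (a ^ (1 / q) * s)) := by ring
      _ ≤ z * (ε * (a * T ^ q) + ε ^ (-(R - 1)) * (a ^ (R / q) * s ^ R)) := by gcongr
      _ ≤ z * (ε * (a * T ^ q)) + 1 * (ε ^ (-(R - 1)) * (a ^ (R / q) * s ^ R)) := by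
        rw [mul_add]; gcongr
      _ ≤ z * (ε * (a * T ^ q)) + 1 * (E * F) := by
        gcongr
        · exact hEe _ (by linarith)
        · exact hSY.trans hSF
      _ = _ := by ring
  have hMt := mul_le_mul_of_nonneg_left (add_le_add (add_le_add (add_le_add m1 m2) m3) m4) hM
  have hLt := mul_le_mul_of_nonneg_left (add_le_add (add_le_add (add_le_add l1 l2) l3) l4) hL
  have hM3t : M₃ * (critFun n p q a u + 1) ≤ M₃ * (2 * F) :=
    mul_le_mul_of_nonneg_left (by linarith) hM₃
  have hsum := add_le_add (add_le_add hMt hLt) hM3t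
  set kk := Z ^ θ * k ^ (ρ / (ρ - 1)) with hkk
  set dd := Z ^ θ * d ^ (σ / (σ - 1)) with hdd
  have hkk0 : 0 ≤ D * kk := by positivity
  have hdd0 : 0 ≤ D * dd := by positivity
  set C := M * (2 + (1 + A) * E) + L * (2 + 2 * E) + 2 * M₃ with hC
  have hMC : M ≤ C := by
    have : 0 ≤ M * (1 + (1 + A) * E) := by positivity
    have : 0 ≤ L * (2 + 2 * E) := by positivity
    have e : C = M + (M * (1 + (1 + A) * E) + L * (2 + 2 * E) + 2 * M₃) := by rw [hC]; ring
    linarith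
  have hLC : L ≤ C := by
    have : 0 ≤ L * (1 + 2 * E) := by positivity
    have : 0 ≤ M * (2 + (1 + A) * E) := by positivity
    have e : C = L + (M * (2 + (1 + A) * E) + L * (1 + 2 * E) + 2 * M₃) := by rw [hC]; ring
    linarith
  have hkC := mul_le_mul_of_nonneg_right hMC hkk0
  have hdC := mul_le_mul_of_nonneg_right hLC hdd0
  have eR : C * D * (w * S + Z ^ θ * (k ^ (ρ / (ρ - 1)) + d ^ (σ / (σ - 1)))) =
      C * F + C * (D * kk) + C * (D * dd) := by rw [hF, hkk, hdd]; ring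
  rw [eR]
  clear_value C F kk dd D w S P R Q E
  calc _ = M * (b * s * z' * k + b * s * z' * (u ^ (P - 1) + a ^ (R / q) * u ^ (R - 1)) +
          b * s * z' * T ^ (p - 1) + b * s * z' * (a * T ^ (q - 1))) +
        L * (s * z * d + s * z * (u ^ (P - 1) + a ^ (R / q) * u ^ (R - 1)) +
          s * z * T ^ (p / (P / (P - 1))) +
          s * z * (a ^ ((n + 1) / n) * T ^ (q / (R / (R - 1))))) +
        M₃ * (critFun n p q a u + 1) := by ring
    _ ≤ _ := hsum
    _ = (M + L) * ε * (z * (T ^ p + a * T ^ q)) + C * F + M * (D * kk) + L * (D * dd) := by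
      rw [hC]; ring
    _ ≤ _ := by linarith

/-- The square of the positive part, a convenient `C¹` building block. -/
noncomputable def sqPos (s : ℝ) : ℝ := (max s 0) ^ 2

theorem sqPos_of_nonpos {s : ℝ} (hs : s ≤ 0) : sqPos s = 0 := by simp [sqPos, max_eq_right hs]

theorem sqPos_of_nonneg {s : ℝ} (hs : 0 ≤ s) : sqPos s = s ^ 2 := by simp [sqPos, max_eq_left hs]

theorem sqPos_nonneg (s : ℝ) : 0 ≤ sqPos s := by unfold sqPos; positivity

theorem hasDerivAt_sqPos (s : ℝ) : HasDerivAt sqPos (2 * max s 0) s := by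
  rcases lt_trichotomy s 0 with hs | rfl | hs
  · have : sqPos =ᶠ[nhds s] fun _ => 0 := by
      filter_upwards [Iio_mem_nhds hs] with t ht
      exact sqPos_of_nonpos (le_of_lt ht)
    rw [max_eq_right hs.le, mul_zero]
    exact (hasDerivAt_const s (0 : ℝ)).congr_of_eventuallyEq this
  · rw [max_self, mul_zero, hasDerivAt_iff_isLittleO_nhds_zero]
    refine Asymptotics.IsBigO.trans_isLittleO (g := fun h : ℝ => h ^ 2) ?_ ?_
    · refine Asymptotics.IsBigO.of_bound 1 (Eventually.of_forall fun h => ?_)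
      rcases le_total h 0 with h0 | h0
      · simp [sqPos_of_nonpos h0, sqPos_of_nonpos le_rfl]; positivity
      · simp [sqPos_of_nonneg h0, sqPos_of_nonpos le_rfl]
    · simpa using Asymptotics.isLittleO_pow_id (𝕜 := ℝ) (n := 2) (by norm_num)
  · have : sqPos =ᶠ[nhds s] fun t => t ^ 2 := by
      filter_upwards [Ioi_mem_nhds hs] with t ht
      exact sqPos_of_nonneg (le_of_lt ht)
    rw [max_eq_left hs.le]
    simpa using (hasDerivAt_pow 2 s).congr_of_eventuallyEq this

theorem contDiff_sqPos : ContDiff ℝ 1 sqPos := by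
  rw [contDiff_one_iff_deriv]
  refine ⟨fun s => (hasDerivAt_sqPos s).differentiableAt, ?_⟩
  have : deriv sqPos = fun s => 2 * max s 0 := funext fun s => (hasDerivAt_sqPos s).deriv
  rw [this]; fun_prop

/-- A `C¹` truncation: zero below `m`, with slope one above `m + h`. -/
noncomputable def truncFun (m h t : ℝ) : ℝ := (sqPos (t - m) - sqPos (t - m - h)) / (2 * h)

/-- The derivative of `truncFun`. -/
noncomputable def truncDeriv (m h t : ℝ) : ℝ := (max (t - m) 0 - max (t - m - h) 0) / h

theorem hasDerivAt_truncFun {m h : ℝ} (hh : 0 < h) (t : ℝ) :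
    HasDerivAt (truncFun m h) (truncDeriv m h t) t := by
  have h1 : HasDerivAt (fun t => sqPos (t - m)) (2 * max (t - m) 0) t := by
    simpa using! (hasDerivAt_sqPos (t - m)).comp t ((hasDerivAt_id t).sub_const m)
  have h2 : HasDerivAt (fun t => sqPos (t - m - h)) (2 * max (t - m - h) 0) t := by
    simpa using! (hasDerivAt_sqPos (t - m - h)).comp t (((hasDerivAt_id t).sub_const m).sub_const h)
  refine ((h1.sub h2).div_const (2 * h)).congr_deriv ?_
  unfold truncDeriv; field_simp

theorem contDiff_truncFun (m h : ℝ) : ContDiff ℝ 1 (truncFun m h) := by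
  unfold truncFun
  exact ((contDiff_sqPos.comp (by fun_prop)).sub (contDiff_sqPos.comp (by fun_prop))).div_const _

theorem truncDeriv_mem {m h : ℝ} (hh : 0 < h) (t : ℝ) :
    0 ≤ truncDeriv m h t ∧ truncDeriv m h t ≤ 1 := by
  unfold truncDeriv
  constructor
  · apply div_nonneg _ hh.le
    rw [sub_nonneg]; exact max_le_max (by linarith) le_rfl
  · rw [div_le_one hh]
    rcases le_total (t - m) 0 with h0 | h0
    · rw [max_eq_right h0, max_eq_right (by linarith)]; linarith
    · rw [max_eq_left h0]; linarith [le_max_left (t - m - h) 0]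

theorem truncDeriv_eq_one {m h t : ℝ} (hh : 0 < h) (ht : m + h ≤ t) : truncDeriv m h t = 1 := by
  unfold truncDeriv
  rw [max_eq_left (by linarith), max_eq_left (by linarith)]; field_simp; ring

theorem truncFun_eq_zero {m h t : ℝ} (hh : 0 < h) (ht : t ≤ m) : truncFun m h t = 0 := by
  unfold truncFun
  rw [sqPos_of_nonpos (by linarith), sqPos_of_nonpos (by linarith)]; simp

theorem truncDeriv_eq_zero {m h t : ℝ} (hh : 0 < h) (ht : t ≤ m) : truncDeriv m h t = 0 := by
  unfold truncDeriv
  rw [max_eq_right (by linarith), max_eq_right (by linarith)]; simp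

theorem truncFun_nonneg {m h : ℝ} (hh : 0 < h) (t : ℝ) : 0 ≤ truncFun m h t := by
  unfold truncFun sqPos
  apply div_nonneg _ (by linarith)
  rw [sub_nonneg]
  exact pow_le_pow_left₀ (le_max_right _ _) (max_le_max (by linarith) le_rfl) 2

theorem truncFun_le {m h t : ℝ} (hh : 0 < h) (ht : m ≤ t) :
    truncFun m h t ≤ truncDeriv m h t * (t - m) := by
  unfold truncFun truncDeriv sqPos
  rw [max_eq_left (by linarith : (0 : ℝ) ≤ t - m), div_mul_eq_mul_div, div_le_div_iff₀ (by linarith) hh]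
  rcases le_total (t - m - h) 0 with h0 | h0
  · rw [max_eq_right h0]; nlinarith [mul_nonneg hh.le (sq_nonneg (t - m))]
  · rw [max_eq_left h0]; nlinarith [mul_nonneg (mul_nonneg hh.le hh.le) h0]

theorem cube_mono {N : ℕ} (y : EuclideanSpace ℝ (Fin N)) {r s : ℝ} (hrs : r ≤ s) :
    cube y r ⊆ cube y s := fun x hx i => (hx i).trans_le (by linarith)

theorem norm_le_sum_abs {N : ℕ} (x : EuclideanSpace ℝ (Fin N)) : ‖x‖ ≤ ∑ i, |x i| := by
  rw [EuclideanSpace.norm_eq]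
  apply Real.sqrt_le_iff.mpr
  refine ⟨Finset.sum_nonneg fun i _ => abs_nonneg _, ?_⟩
  simp only [Real.norm_eq_abs]
  exact Finset.sum_sq_le_sq_sum_of_nonneg (fun i _ => abs_nonneg _)

theorem cube_subset_closedBall {N : ℕ} (y : EuclideanSpace ℝ (Fin N)) (r : ℝ) :
    cube y r ⊆ Metric.closedBall y (N * (r / 2)) := by
  intro x hx
  rw [Metric.mem_closedBall, dist_eq_norm]
  refine (norm_le_sum_abs _).trans ?_
  refine (Finset.sum_le_sum (g := fun _ => r / 2) fun i _ => ?_).trans (by simp)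
  simpa using (hx i).le

theorem exists_cube_cutoff {N : ℕ} (y : EuclideanSpace ℝ (Fin N)) {α β : ℝ} (hα : 0 < α)
    (hαβ : α < β) :
    ∃ ζ : EuclideanSpace ℝ (Fin N) → ℝ, ContDiff ℝ 1 ζ ∧ (∀ x, 0 ≤ ζ x ∧ ζ x ≤ 1) ∧
      (∀ x ∈ cube y (2 * α), ζ x = 1) ∧ (∀ x, x ∉ cube y (2 * β) → ζ x = 0) ∧
      ∀ x, ‖gradient ζ x‖ ≤ 8 * N / (β - α) := by
  set D : ℝ := β ^ 2 - α ^ 2 with hD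
  have hDpos : 0 < D := by rw [hD]; nlinarith
  have hβ : 0 < β := hα.trans hαβ
  set ψ : EuclideanSpace ℝ (Fin N) → ℝ := fun x => ∑ i, sqPos ((x i - y i) ^ 2 - α ^ 2) / D ^ 2 with hψ
  have hψC : ContDiff ℝ 1 ψ := by
    refine ContDiff.sum fun i _ => ContDiff.div_const (contDiff_sqPos.comp (by fun_prop)) _
  have hψ0 : ∀ x, 0 ≤ ψ x := fun x => Finset.sum_nonneg fun i _ =>
    div_nonneg (sqPos_nonneg _) (by positivity)
  have hout : ∀ x, ψ x < 1 → x ∈ cube y (2 * β) := by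
    intro x hx i
    by_contra hc
    push Not at hc
    have hc' : β ≤ |x i - y i| := by linarith
    have h1 : D ≤ (x i - y i) ^ 2 - α ^ 2 := by
      rw [hD, ← sq_abs (x i - y i)]; nlinarith
    have h2 : 1 ≤ sqPos ((x i - y i) ^ 2 - α ^ 2) / D ^ 2 := by
      rw [sqPos_of_nonneg (by linarith), one_le_div (by positivity)]
      exact pow_le_pow_left₀ hDpos.le h1 2
    have h3 : sqPos ((x i - y i) ^ 2 - α ^ 2) / D ^ 2 ≤ ψ x :=
      Finset.single_le_sum (f := fun i => sqPos ((x i - y i) ^ 2 - α ^ 2) / D ^ 2)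
        (fun i _ => div_nonneg (sqPos_nonneg _) (by positivity)) (Finset.mem_univ i)
    linarith
  refine ⟨fun x => sqPos (1 - ψ x), contDiff_sqPos.comp (by fun_prop), fun x => ⟨sqPos_nonneg _, ?_⟩,
    fun x hx => ?_, fun x hx => ?_, fun x => ?_⟩
  · unfold sqPos
    have : max (1 - ψ x) 0 ≤ 1 := max_le (by linarith [hψ0 x]) zero_le_one
    exact pow_le_one₀ (le_max_right _ _) this
  · have : ψ x = 0 := by
      refine Finset.sum_eq_zero fun i _ => ?_
      have h1 := hx i
      rw [sqPos_of_nonpos, zero_div]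
      have : |x i - y i| ≤ α := by linarith
      rw [← sq_abs (x i - y i)]
      nlinarith [abs_nonneg (x i - y i)]
    simp only [this, sub_zero]; rw [sqPos_of_nonneg zero_le_one]; norm_num
  · apply sqPos_of_nonpos
    by_contra hc
    exact hx (hout x (by linarith))
  · have hproj : ∀ i, HasFDerivAt (fun x : EuclideanSpace ℝ (Fin N) => x i)
        (EuclideanSpace.proj i : EuclideanSpace ℝ (Fin N) →L[ℝ] ℝ) x := fun i =>
      (EuclideanSpace.proj i : EuclideanSpace ℝ (Fin N) →L[ℝ] ℝ).hasFDerivAt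
    have hprojn : ∀ i, ‖(EuclideanSpace.proj i : EuclideanSpace ℝ (Fin N) →L[ℝ] ℝ)‖ ≤ 1 := fun i =>
      ContinuousLinearMap.opNorm_le_bound _ zero_le_one fun z => by
        simpa using PiLp.norm_apply_le z i
    have h1 : HasFDerivAt ψ (∑ i, (2 * max ((x i - y i) ^ 2 - α ^ 2) 0 * (2 * (x i - y i)) / D ^ 2) •
        (EuclideanSpace.proj i : EuclideanSpace ℝ (Fin N) →L[ℝ] ℝ)) x := by
      refine HasFDerivAt.fun_sum fun i _ => ?_
      have hd : HasDerivAt (fun t : ℝ => sqPos ((t - y i) ^ 2 - α ^ 2) / D ^ 2)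
          (2 * max ((x i - y i) ^ 2 - α ^ 2) 0 * (2 * (x i - y i)) / D ^ 2) (x i) := by
        have hin : HasDerivAt (fun t : ℝ => (t - y i) ^ 2 - α ^ 2) (2 * (x i - y i)) (x i) := by
          simpa using! (((hasDerivAt_id (x i)).sub_const (y i)).pow 2).sub_const (α ^ 2)
        exact ((hasDerivAt_sqPos _).comp (x i) hin).div_const _
      exact hd.comp_hasFDerivAt x (hproj i)
    have h2 : HasFDerivAt (sqPos ∘ fun x => 1 - ψ x) _ x :=
      (hasDerivAt_sqPos (1 - ψ x)).comp_hasFDerivAt x (h1.const_sub 1)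
    rw [norm_gradient_eq]
    change ‖fderiv ℝ (sqPos ∘ fun x => 1 - ψ x) x‖ ≤ _
    rw [h2.fderiv, norm_smul, norm_neg]
    by_cases hx : ψ x < 1
    · have hcx := hout x hx
      have hb : ‖∑ i, (2 * max ((x i - y i) ^ 2 - α ^ 2) 0 * (2 * (x i - y i)) / D ^ 2) •
        (EuclideanSpace.proj i : EuclideanSpace ℝ (Fin N) →L[ℝ] ℝ)‖ ≤ N * (4 / (β - α)) := by
        refine (norm_sum_le_of_le (n := fun _ => 4 / (β - α)) _ fun i _ => ?_).trans (by simp)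
        rw [norm_smul]
        have hci : |x i - y i| ≤ β := by have := hcx i; linarith
        have e1 : max ((x i - y i) ^ 2 - α ^ 2) 0 ≤ D := by
          apply max_le _ hDpos.le
          rw [hD, ← sq_abs (x i - y i)]
          nlinarith [abs_nonneg (x i - y i)]
        have e2 : ‖2 * max ((x i - y i) ^ 2 - α ^ 2) 0 * (2 * (x i - y i)) / D ^ 2‖ ≤ 4 / (β - α) := by
          rw [Real.norm_eq_abs, abs_div, abs_mul, abs_mul, abs_mul, abs_of_nonneg (le_max_right _ (0:ℝ)),
            abs_of_pos (by positivity : 0 < D ^ 2), abs_two]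
          have : 2 * max ((x i - y i) ^ 2 - α ^ 2) 0 * (2 * |x i - y i|) ≤ 2 * D * (2 * β) := by
            gcongr
          refine (div_le_div_of_nonneg_right this (by positivity)).trans ?_
          rw [div_le_div_iff₀ (by positivity) (by linarith)]
          have hD2 : D = (β - α) * (β + α) := by rw [hD]; ring
          nlinarith [mul_pos hDpos (mul_pos (sub_pos.mpr hαβ) hα)]
        calc _ ≤ 4 / (β - α) * 1 := by
              gcongr; exact hprojn i
          _ = _ := mul_one _
      have hm : ‖2 * max (1 - ψ x) 0‖ ≤ 2 := by
        rw [Real.norm_eq_abs, abs_of_nonneg (by positivity)]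
        have : max (1 - ψ x) 0 ≤ 1 := max_le (by linarith [hψ0 x]) zero_le_one
        linarith
      calc _ ≤ 2 * (N * (4 / (β - α))) := by gcongr
        _ = _ := by ring
    · rw [max_eq_right (by linarith)]
      have : 0 ≤ 8 * (N : ℝ) / (β - α) := div_nonneg (by positivity) (by linarith)
      simpa using this

theorem gradient_sub_eq {N : ℕ} (φ ψ : EuclideanSpace ℝ (Fin N) → ℝ) (x : EuclideanSpace ℝ (Fin N)) :
    ‖gradient φ x - gradient ψ x‖ = ‖fderiv ℝ φ x - fderiv ℝ ψ x‖ := by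
  unfold gradient; rw [← map_sub]; exact LinearIsometryEquiv.norm_map _ _

/-- A compactly supported `C¹` function is a `C¹`-limit of smooth functions supported in a fixed
compact set. -/
theorem exists_smooth_approx {N : ℕ} {φ : EuclideanSpace ℝ (Fin N) → ℝ} (hφ : ContDiff ℝ 1 φ)
    (hc : HasCompactSupport φ) {ε : ℝ} (hε : 0 < ε) :
    ∃ ψ : EuclideanSpace ℝ (Fin N) → ℝ, ContDiff ℝ (⊤ : ℕ∞) ψ ∧ HasCompactSupport ψ ∧
      (∀ x, |ψ x - φ x| ≤ ε) ∧ (∀ x, ‖gradient ψ x - gradient φ x‖ ≤ ε) ∧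
      ∀ x, x ∉ Metric.cthickening 1 (tsupport φ) → ψ x = φ x ∧ gradient ψ x = gradient φ x := by
  have hcont : Continuous (fderiv ℝ φ) := hφ.continuous_fderiv one_ne_zero
  have hu1 : UniformContinuous φ := hc.uniformContinuous_of_continuous hφ.continuous
  have hu2 : UniformContinuous (fderiv ℝ φ) := (hc.fderiv ℝ).uniformContinuous_of_continuous hcont
  obtain ⟨δ₁, hδ₁, h1⟩ := Metric.uniformContinuous_iff.mp hu1 ε hε
  obtain ⟨δ₂, hδ₂, h2⟩ := Metric.uniformContinuous_iff.mp hu2 ε hε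
  set δ := min 1 (min δ₁ δ₂) with hδdef
  have hδ : 0 < δ := by positivity
  let b : ContDiffBump (0 : EuclideanSpace ℝ (Fin N)) := ⟨δ / 2, δ, by linarith, by linarith⟩
  have hbo : b.rOut = δ := rfl
  set ψ := convolution (b.normed volume) φ (ContinuousLinearMap.lsmul ℝ ℝ) volume with hψ
  have hψd : ∀ x, HasFDerivAt ψ (convolution (b.normed volume) (fderiv ℝ φ)
      (ContinuousLinearMap.lsmul ℝ ℝ) volume x) x := fun x =>
    hc.hasFDerivAt_convolution_right (ContinuousLinearMap.lsmul ℝ ℝ)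
      b.continuous_normed.locallyIntegrable hφ x
  have e1 : ∀ x c, (∀ z ∈ Metric.ball x δ, dist (φ z) (φ x) ≤ c) → dist (ψ x) (φ x) ≤ c :=
    fun x c hx => b.dist_normed_convolution_le hφ.continuous.aestronglyMeasurable (by rwa [hbo])
  have e2 : ∀ x c, (∀ z ∈ Metric.ball x δ, dist (fderiv ℝ φ z) (fderiv ℝ φ x) ≤ c) →
      ‖gradient ψ x - gradient φ x‖ ≤ c := by
    intro x c hx
    rw [gradient_sub_eq, (hψd x).fderiv, ← dist_eq_norm]
    exact b.dist_normed_convolution_le hcont.aestronglyMeasurable (by rwa [hbo])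
  have hoff : ∀ x, x ∉ Metric.cthickening 1 (tsupport φ) → ψ x = φ x ∧ gradient ψ x = gradient φ x := by
    intro x hx
    have hz : ∀ z ∈ Metric.ball x δ, z ∉ tsupport φ := by
      intro z hz hzt
      apply hx
      refine Metric.mem_cthickening_of_dist_le x z 1 _ hzt ?_
      rw [dist_comm]
      exact (Metric.mem_ball.mp hz).le.trans (min_le_left _ _)
    have hx' := hz x (Metric.mem_ball_self hδ)
    have f1 : ∀ z, z ∉ tsupport φ → φ z = 0 := fun z => image_eq_zero_of_notMem_tsupport
    have f2 : ∀ z, z ∉ tsupport φ → fderiv ℝ φ z = 0 := fun z hz =>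
      image_eq_zero_of_notMem_tsupport fun hz' => hz (tsupport_fderiv_subset ℝ hz')
    constructor
    · have := e1 x 0 (fun z hzb => by rw [f1 z (hz z hzb), f1 x hx', dist_self])
      exact dist_le_zero.mp this
    · have := e2 x 0 (fun z hzb => by rw [f2 z (hz z hzb), f2 x hx', dist_self])
      exact sub_eq_zero.mp (norm_le_zero_iff.mp this)
  refine ⟨ψ, ?_, ?_, fun x => ?_, fun x => ?_, hoff⟩
  · exact b.hasCompactSupport_normed.contDiff_convolution_left _ b.contDiff_normed
      hφ.continuous.locallyIntegrable
  · refine HasCompactSupport.intro (hc.isCompact.cthickening (r := 1)) fun x hx => ?_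
    rw [(hoff x hx).1]
    refine image_eq_zero_of_notMem_tsupport fun h => hx (Metric.self_subset_cthickening _ h)
  · rw [← Real.dist_eq]
    refine e1 x ε fun z hz => (h1 ?_).le
    exact (Metric.mem_ball.mp hz).trans_le ((min_le_right _ _).trans (min_le_left _ _))
  · refine e2 x ε fun z hz => (h2 ?_).le
    exact (Metric.mem_ball.mp hz).trans_le ((min_le_right _ _).trans (min_le_right _ _))

theorem integrable_inner_gradient {N : ℕ} {F : EuclideanSpace ℝ (Fin N) → EuclideanSpace ℝ (Fin N)}
    (hF : LocallyIntegrable F volume) {φ : EuclideanSpace ℝ (Fin N) → ℝ} (hφ : ContDiff ℝ 1 φ)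
    (hc : HasCompactSupport φ) : Integrable fun x => @inner ℝ _ _ (F x) (gradient φ x) := by
  have hg : Continuous (gradient φ) := continuous_gradient hφ
  have hK : IsCompact (tsupport φ) := hc
  have h0 : ∀ x, x ∉ tsupport φ → gradient φ x = 0 := fun z hz => by
    unfold gradient
    rw [image_eq_zero_of_notMem_tsupport fun hz' => hz (tsupport_fderiv_subset ℝ hz'), map_zero]
  obtain ⟨C, hC⟩ := hK.exists_bound_of_continuousOn hg.continuousOn
  have hFi : IntegrableOn F (tsupport φ) := hF.integrableOn_isCompact hK
  have : IntegrableOn (fun x => @inner ℝ _ _ (F x) (gradient φ x)) (tsupport φ) := by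
    refine Integrable.mono' (hFi.norm.mul_const C) (hFi.aestronglyMeasurable.inner
      hg.aestronglyMeasurable) ?_
    filter_upwards [ae_restrict_mem hK.measurableSet] with x hx
    exact (norm_inner_le_norm _ _).trans (mul_le_mul_of_nonneg_left (hC x hx) (norm_nonneg _))
  exact (integrableOn_iff_integrable_of_support_subset fun x hx => by
    by_contra hx'
    exact hx (by simp [h0 x hx'])).mp this

/-- A weak formulation against smooth test functions extends to `C¹` test functions. -/
theorem weak_form_contDiff_one {N : ℕ} {F : EuclideanSpace ℝ (Fin N) → EuclideanSpace ℝ (Fin N)}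
    {G : EuclideanSpace ℝ (Fin N) → ℝ}
    (hF : LocallyIntegrable F volume) (hG : LocallyIntegrable G volume)
    (hw : ∀ φ : EuclideanSpace ℝ (Fin N) → ℝ, ContDiff ℝ (⊤ : ℕ∞) φ → HasCompactSupport φ →
      (∫ x, @inner ℝ _ _ (F x) (gradient φ x)) + ∫ x, G x * φ x = 0)
    {φ : EuclideanSpace ℝ (Fin N) → ℝ} (hφ : ContDiff ℝ 1 φ) (hc : HasCompactSupport φ) :
    (∫ x, @inner ℝ _ _ (F x) (gradient φ x)) + ∫ x, G x * φ x = 0 := by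
  have hi : ∀ φ : EuclideanSpace ℝ (Fin N) → ℝ, ContDiff ℝ 1 φ → HasCompactSupport φ →
      Integrable fun x => G x * φ x := fun φ h1 h2 => by
    simpa [mul_comm] using hG.integrable_smul_left_of_hasCompactSupport h1.continuous h2
  set S := Metric.cthickening 1 (tsupport φ) with hS
  have hSc : IsCompact S := hc.isCompact.cthickening (r := 1)
  set J := ∫ x in S, (‖F x‖ + |G x|) with hJ
  have hJi : IntegrableOn (fun x => ‖F x‖ + |G x|) S :=
    (hF.integrableOn_isCompact hSc).norm.add (hG.integrableOn_isCompact hSc).abs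
  have hJ0 : 0 ≤ J := integral_nonneg fun x => by positivity
  have key : ∀ ε : ℝ, 0 < ε → |(∫ x, @inner ℝ _ _ (F x) (gradient φ x)) + ∫ x, G x * φ x| ≤ ε * J := by
    intro ε hε
    obtain ⟨ψ, h1, h2, h3, h4, h5⟩ := exists_smooth_approx hφ hc hε
    have h1' : ContDiff ℝ 1 ψ := h1.of_le (by exact_mod_cast le_top)
    have hz := hw ψ h1 h2
    have i1 := integrable_inner_gradient hF hφ hc
    have i2 := integrable_inner_gradient hF h1' h2
    have i3 := hi φ hφ hc
    have i4 := hi ψ h1' h2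
    have e : (∫ x, @inner ℝ _ _ (F x) (gradient φ x)) + ∫ x, G x * φ x =
        ∫ x, ((@inner ℝ _ _ (F x) (gradient φ x) - @inner ℝ _ _ (F x) (gradient ψ x)) +
          (G x * φ x - G x * ψ x)) := by
      refine Eq.trans ?_ (integral_add (i1.sub i2) (i3.sub i4)).symm
      have s1 := integral_sub i1 i2
      have s2 := integral_sub i3 i4
      simp only [Pi.sub_apply] at s1 s2 ⊢
      rw [s1, s2]
      linarith
    rw [e, ← Real.norm_eq_abs, hJ, ← integral_const_mul]
    have e2 : ∫ x in S, ε * (‖F x‖ + |G x|) = ∫ x, S.indicator (fun x => ε * (‖F x‖ + |G x|)) x :=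
      (integral_indicator hSc.measurableSet).symm
    rw [e2]
    refine norm_integral_le_of_norm_le ((integrable_indicator_iff hSc.measurableSet).mpr (hJi.const_mul ε))
      (Eventually.of_forall fun x => ?_)
    by_cases hx : x ∈ S
    · rw [Set.indicator_of_mem hx]
      refine (norm_add_le _ _).trans ?_
      rw [← inner_sub_right, ← mul_sub, norm_mul, Real.norm_eq_abs (G x), Real.norm_eq_abs (φ x - ψ x),
        abs_sub_comm]
      have a1 := (norm_inner_le_norm (𝕜 := ℝ) (F x) (gradient φ x - gradient ψ x))
      rw [norm_sub_rev (gradient φ x)] at a1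
      have a2 := mul_le_mul_of_nonneg_left (h4 x) (norm_nonneg (F x))
      have a3 := mul_le_mul_of_nonneg_left (h3 x) (abs_nonneg (G x))
      linarith
    · rw [Set.indicator_of_notMem hx, (h5 x hx).1, (h5 x hx).2]; simp
  by_contra hne
  have hpos := abs_pos.mpr hne
  set I := |(∫ x, @inner ℝ _ _ (F x) (gradient φ x)) + ∫ x, G x * φ x| with hI
  have := key (I / (2 * (J + 1))) (by positivity)
  rw [div_mul_eq_mul_div, le_div_iff₀ (by positivity)] at this
  nlinarith

theorem testing_pointwise {n g g' s b z z' I₁ I₂ G H M₁ M₂ M₃ L c X Y R D : ℝ} (hn : 0 ≤ n)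
    (hg : 0 ≤ g) (hgs : g ≤ g' * s) (hg'0 : 0 ≤ g') (hg'1 : g' ≤ 1) (hz : 0 ≤ z) (hz1 : z ≤ 1)
    (hz' : 0 ≤ z') (hI₁ : M₂ * H - M₃ * (c + 1) ≤ I₁) (hI₂ : |I₂| ≤ M₁ * X * D)
    (hG : -(L * Y) ≤ G) (hX : 0 ≤ M₁ * X) (hY : 0 ≤ L * Y) (hDb : D ≤ b)
    (hc : 0 ≤ M₃ * (c + 1)) (hR : 0 ≤ R)
    (habs : n * M₁ * (b * s * z') * X + L * (s * z) * Y + M₃ * (c + 1) ≤ M₂ / 2 * (z * H) + R) :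
    M₂ / 2 * (g' * z * H) ≤ (g' * z * I₁ + n * g * z' * I₂) + G * (g * z) + R := by
  have hb : 0 ≤ g' * s := hg.trans hgs
  have e1 : g' * z * (M₂ * H) - g' * (M₃ * (c + 1)) ≤ g' * z * I₁ := by
    have h1 := mul_le_mul_of_nonneg_left hI₁ (mul_nonneg hg'0 hz)
    have h2 : g' * z * (M₃ * (c + 1)) ≤ g' * (M₃ * (c + 1)) :=
      mul_le_mul_of_nonneg_right (mul_le_of_le_one_right hg'0 hz1) hc
    linarith
  have e2 : -(g' * (n * M₁ * (b * s * z') * X)) ≤ n * g * z' * I₂ := by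
    have h1 : -(M₁ * X * b) ≤ I₂ := by
      have := neg_abs_le I₂
      have := mul_le_mul_of_nonneg_left hDb hX
      linarith
    have h2 : 0 ≤ M₁ * X * b := by
      have := abs_nonneg I₂
      have := mul_le_mul_of_nonneg_left hDb hX
      linarith
    have h3 := mul_le_mul_of_nonneg_left h1 (mul_nonneg (mul_nonneg hn hg) hz')
    have h4 := mul_le_mul_of_nonneg_right hgs (mul_nonneg (mul_nonneg hn hz') h2)
    linarith
  have e3 : -(g' * (L * (s * z) * Y)) ≤ G * (g * z) := by
    have h3 := mul_le_mul_of_nonneg_right hG (mul_nonneg hg hz)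
    have h4 := mul_le_mul_of_nonneg_right hgs (mul_nonneg hz hY)
    linarith
  have e4 := mul_le_mul_of_nonneg_left habs hg'0
  have e5 : g' * R ≤ R := mul_le_of_le_one_left hR hg'1
  linarith

theorem ofReal_integral_le_lintegral {α : Type*} {m : MeasurableSpace α} {μ : Measure α} {f : α → ℝ}
    (hf : Integrable f μ) : ENNReal.ofReal (∫ x, f x ∂μ) ≤ ∫⁻ x, ENNReal.ofReal (f x) ∂μ := by
  rw [integral_eq_lintegral_pos_part_sub_lintegral_neg_part hf]
  refine (ENNReal.ofReal_le_ofReal (sub_le_self _ ENNReal.toReal_nonneg)).trans ?_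
  exact ENNReal.ofReal_toReal_le

theorem lt_critExp_pos {n p : ℝ} (hn : 0 < n) (hp0 : 0 < p) (hp : p < n) : 0 < critExp n p :=
  div_pos (mul_pos hn hp0) (sub_pos.mpr hp)

section

variable {N : ℕ} {p q a : EuclideanSpace ℝ (Fin N) → ℝ} {p₀ q₁ A : ℝ} {K : NNReal}

theorem PhaseBounds.p_lt (h : PhaseBounds N p q a p₀ q₁ A K) (x) : p x < N :=
  ((h.p_le_q x).trans (h.q_le x)).trans_lt h.q_lt

theorem PhaseBounds.q_lt_dim (h : PhaseBounds N p q a p₀ q₁ A K) (x) : q x < N :=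
  (h.q_le x).trans_lt h.q_lt

theorem PhaseBounds.one_lt_p (h : PhaseBounds N p q a p₀ q₁ A K) (x) : 1 < p x :=
  h.one_lt.trans_le (h.le_p x)

theorem PhaseBounds.one_lt_q (h : PhaseBounds N p q a p₀ q₁ A K) (x) : 1 < q x :=
  (h.one_lt_p x).trans_le (h.p_le_q x)

theorem PhaseBounds.continuous_critExp_fst (h : PhaseBounds N p q a p₀ q₁ A K) :
    Continuous fun x => critExp N (p x) := by
  unfold critExp
  exact (continuous_const.mul h.lip_p.continuous).div₀ (continuous_const.sub h.lip_p.continuous)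
    fun x => (sub_pos.mpr (h.p_lt x)).ne'

theorem PhaseBounds.continuous_critExp_snd (h : PhaseBounds N p q a p₀ q₁ A K) :
    Continuous fun x => critExp N (q x) := by
  unfold critExp
  exact (continuous_const.mul h.lip_q.continuous).div₀ (continuous_const.sub h.lip_q.continuous)
    fun x => (sub_pos.mpr (h.q_lt_dim x)).ne'

theorem PhaseBounds.continuous_rpow_critExp (h : PhaseBounds N p q a p₀ q₁ A K) :
    Continuous fun x => a x ^ (critExp N (q x) / q x) := by
  have hn := h.two_le
  refine h.lip_a.continuous.rpow (h.continuous_critExp_snd.div₀ h.lip_q.continuous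
    fun x => (zero_lt_one.trans (h.one_lt_q x)).ne') fun x => Or.inr ?_
  have h1 := h.one_lt_q x
  exact div_pos (lt_critExp_pos (by linarith) (by linarith) (h.q_lt_dim x)) (by linarith)

theorem PhaseBounds.continuous_critFun (h : PhaseBounds N p q a p₀ q₁ A K)
    {v : EuclideanSpace ℝ (Fin N) → ℝ} (hv : Continuous v) :
    Continuous fun x => critFun N (p x) (q x) (a x) (v x) := by
  have hn := h.two_le
  unfold critFun
  refine (hv.rpow h.continuous_critExp_fst fun x => Or.inr ?_).add
    (h.continuous_rpow_critExp.mul (hv.rpow h.continuous_critExp_snd fun x => Or.inr ?_))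
  · have h1 := h.one_lt_p x
    exact lt_critExp_pos (by linarith) (by linarith) (h.p_lt x)
  · have h1 := h.one_lt_q x
    exact lt_critExp_pos (by linarith) (by linarith) (h.q_lt_dim x)

theorem PhaseBounds.continuous_Hfun (h : PhaseBounds N p q a p₀ q₁ A K)
    {v : EuclideanSpace ℝ (Fin N) → ℝ} (hv : Continuous v) :
    Continuous fun x => Hfun p q a x (v x) := by
  unfold Hfun
  refine (hv.rpow h.lip_p.continuous fun x => Or.inr ?_).add
    (h.lip_a.continuous.mul (hv.rpow h.lip_q.continuous fun x => Or.inr ?_))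
  · linarith [h.one_lt_p x]
  · linarith [h.one_lt_q x]

theorem PhaseBounds.Hfun_nonneg (h : PhaseBounds N p q a p₀ q₁ A K) (x : EuclideanSpace ℝ (Fin N))
    {t : ℝ} (ht : 0 ≤ t) : 0 ≤ Hfun p q a x t := by
  have := h.a_nonneg x
  unfold Hfun; positivity

end

/-- A `C¹` function `u` which, where positive, is a weak subsolution of `-div F + G = 0` for fields
with critical growth. -/
structure CritSubsolution (N : ℕ) (p q a ρ σ k d : EuclideanSpace ℝ (Fin N) → ℝ) (M₁ M₂ M₃ L : ℝ)
    (u : EuclideanSpace ℝ (Fin N) → ℝ) (F : EuclideanSpace ℝ (Fin N) → EuclideanSpace ℝ (Fin N))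
    (G : EuclideanSpace ℝ (Fin N) → ℝ) : Prop where
  contDiff : ContDiff ℝ 1 u
  locInt_F : LocallyIntegrable F volume
  locInt_G : LocallyIntegrable G volume
  growth_F : ∀ᵐ x, ‖F x‖ ≤ M₁ * (|k x| + |u x| ^ (critExp N (p x) - 1) +
    a x ^ (critExp N (q x) / q x) * |u x| ^ (critExp N (q x) - 1) +
    ‖gradient u x‖ ^ (p x - 1) + a x * ‖gradient u x‖ ^ (q x - 1))
  coercive : ∀ᵐ x, M₂ * (‖gradient u x‖ ^ p x + a x * ‖gradient u x‖ ^ q x) -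
    M₃ * (critFun N (p x) (q x) (a x) |u x| + 1) ≤ @inner ℝ _ _ (F x) (gradient u x)
  growth_G : ∀ᵐ x, 0 < u x → -(L * (|d x| + |u x| ^ (critExp N (p x) - 1) +
    a x ^ (critExp N (q x) / q x) * |u x| ^ (critExp N (q x) - 1) +
    ‖gradient u x‖ ^ (p x / (critExp N (p x) / (critExp N (p x) - 1))) +
    a x ^ (((N : ℝ) + 1) / N) *
      ‖gradient u x‖ ^ (q x / (critExp N (q x) / (critExp N (q x) - 1))))) ≤ G x
  weak : ∀ φ : EuclideanSpace ℝ (Fin N) → ℝ, ContDiff ℝ 1 φ → HasCompactSupport φ →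
    (∫ x, @inner ℝ _ _ (F x) (gradient φ x)) + ∫ x, G x * φ x = 0
  one_lt_ρ : ∀ x, 1 < ρ x
  one_lt_σ : ∀ x, 1 < σ x
  ρ_le : ∀ x, ρ x ≤ critExp N (p x)
  σ_le : ∀ x, σ x ≤ critExp N (p x)
  M₁_pos : 0 < M₁
  M₂_pos : 0 < M₂
  M₃_pos : 0 < M₃
  L_pos : 0 < L

/-- The weight `|k|^{ρ'} + |d|^{σ'}`. -/
noncomputable def dataWeight {N : ℕ} (ρ σ k d : EuclideanSpace ℝ (Fin N) → ℝ)
    (x : EuclideanSpace ℝ (Fin N)) : ℝ :=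
  |k x| ^ (ρ x / (ρ x - 1)) + |d x| ^ (σ x / (σ x - 1))

section

variable {N : ℕ} {p q a ρ σ k d : EuclideanSpace ℝ (Fin N) → ℝ} {p₀ q₁ A M₁ M₂ M₃ L : ℝ} {K : NNReal}
  {u : EuclideanSpace ℝ (Fin N) → ℝ} {F : EuclideanSpace ℝ (Fin N) → EuclideanSpace ℝ (Fin N)}
  {G : EuclideanSpace ℝ (Fin N) → ℝ}

theorem pow_pred_le_rpow {ζ p : ℝ} {n : ℕ} (hn : 2 ≤ n) (hζ0 : 0 ≤ ζ) (hζ1 : ζ ≤ 1) (hp : 0 < p)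
    (hpn : p ≤ n) : ζ ^ (n - 1) ≤ (ζ ^ n) ^ ((p - 1) / p) := by
  rcases hζ0.eq_or_lt with rfl | hζ
  · rw [zero_pow (by omega)]; positivity
  · rw [← Real.rpow_natCast, ← Real.rpow_natCast, ← Real.rpow_mul hζ.le]
    apply Real.rpow_le_rpow_of_exponent_ge hζ hζ1
    push_cast [Nat.cast_sub (by omega : 1 ≤ n)]
    rw [mul_div_assoc', div_le_iff₀ hp]
    nlinarith

theorem gradient_truncFun_mul_pow {ζ : EuclideanSpace ℝ (Fin N) → ℝ} (hu : ContDiff ℝ 1 u)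
    (hζ : ContDiff ℝ 1 ζ) {m η : ℝ} (hη : 0 < η) (n : ℕ) (x : EuclideanSpace ℝ (Fin N)) :
    gradient (fun x => truncFun m η (u x) * ζ x ^ n) x =
      (truncDeriv m η (u x) * ζ x ^ n) • gradient u x +
        (n * truncFun m η (u x) * ζ x ^ (n - 1)) • gradient ζ x := by
  have h1 : HasFDerivAt u (fderiv ℝ u x) x := (hu.differentiable one_ne_zero x).hasFDerivAt
  have h2 : HasFDerivAt ζ (fderiv ℝ ζ x) x := (hζ.differentiable one_ne_zero x).hasFDerivAt
  have h3 := (hasDerivAt_truncFun (m := m) hη (u x)).comp_hasFDerivAt x h1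
  have h4 := (hasDerivAt_pow n (ζ x)).comp_hasFDerivAt x h2
  have h5 : HasFDerivAt (fun x => truncFun m η (u x) * ζ x ^ n) _ x := h3.mul h4
  unfold gradient
  rw [h5.fderiv]
  simp only [map_add, map_smul, smul_smul]
  rw [add_comm]
  congr 2
  · simp [mul_comm]
  · simp; ring

theorem CritSubsolution.testing_le (h : PhaseBounds N p q a p₀ q₁ A K)
    (hS : CritSubsolution N p q a ρ σ k d M₁ M₂ M₃ L u F G) :
    ∃ C : ℝ, 1 ≤ C ∧ ∀ (y : EuclideanSpace ℝ (Fin N)) (β k₀ m η D b Z θ : ℝ)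
      (ζ : EuclideanSpace ℝ (Fin N) → ℝ), ContDiff ℝ 1 ζ → (∀ x, 0 ≤ ζ x ∧ ζ x ≤ 1) →
      (∀ x, x ∉ cube y (2 * β) → ζ x = 0) → (∀ x, ‖gradient ζ x‖ ≤ D) →
      0 ≤ k₀ → k₀ < m → 0 < η → D ≤ b → 1 ≤ b → 1 + k₀ ≤ (b - 1) * (m - k₀) →
      0 < Z → Z ≤ 1 → θ ≤ 1 → (∀ x ∈ cube y (2 * β), θ * ρ x ≤ 1 ∧ θ * σ x ≤ 1) →
      ∀ᵐ x, M₂ / 2 * (truncDeriv m η (u x) * ζ x ^ N * Hfun p q a x ‖gradient u x‖) ≤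
        @inner ℝ _ _ (F x) (gradient (fun x => truncFun m η (u x) * ζ x ^ N) x) +
          G x * (truncFun m η (u x) * ζ x ^ N) +
        (cube y (2 * β)).indicator (fun x => C * b ^ ((N : ℝ) * N / (N - q₁) + 1) *
          (Z ^ (θ - 1) * critFun N (p x) (q x) (a x) (max (u x - k₀) 0) +
            Z ^ θ * dataWeight ρ σ k d x)) x := by
  have hN := h.two_le
  have hN2 : 2 ≤ N := by exact_mod_cast hN
  have hM₁ := hS.M₁_pos
  have hM₂ := hS.M₂_pos
  have hM₃ := hS.M₃_pos
  have hL := hS.L_pos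
  set ε : ℝ := min 1 (M₂ / (2 * (N * M₁ + L))) with hε
  have hML : 0 < N * M₁ + L := by positivity
  have hε0 : 0 < ε := by positivity
  have hε1 : ε ≤ 1 := min_le_left _ _
  have hεM : (N * M₁ + L) * ε ≤ M₂ / 2 := by
    have : ε ≤ M₂ / (2 * (N * M₁ + L)) := min_le_right _ _
    rw [le_div_iff₀ (by positivity)] at this
    linarith
  set C : ℝ := N * M₁ * (2 + (1 + A) * ε ^ (-((N : ℝ) * N / (N - q₁)))) +
    L * (2 + 2 * ε ^ (-((N : ℝ) * N / (N - q₁)))) + 2 * M₃ with hC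
  have hA : 0 ≤ A := zero_le_one.trans h.one_le
  have hC0 : 0 ≤ C := by positivity
  refine ⟨C + 1, by linarith, ?_⟩
  intro y β k₀ m η D b Z θ ζ hζC hζ hζ0 hζD hk₀ hkm hη hDb hb hbm hZ hZ1 hθ hθρ
  filter_upwards [hS.growth_F, hS.coercive, hS.growth_G] with x hF hco hG
  rw [gradient_truncFun_mul_pow hS.contDiff hζC hη, inner_add_right, real_inner_smul_right,
    real_inner_smul_right]
  have hs0 : 0 ≤ max (u x - k₀) 0 := le_max_right _ _
  have hind : 0 ≤ (cube y (2 * β)).indicator (fun x => (C + 1) * b ^ ((N : ℝ) * N / (N - q₁) + 1) *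
          (Z ^ (θ - 1) * critFun N (p x) (q x) (a x) (max (u x - k₀) 0) +
            Z ^ θ * dataWeight ρ σ k d x)) x := by
    apply Set.indicator_nonneg
    intro z _
    have := critFun_nonneg (n := N) (p := p z) (q := q z) (h.a_nonneg z) (le_max_right (u z - k₀) 0)
    unfold dataWeight
    positivity
  by_cases hx : x ∈ cube y (2 * β)
  swap
  · rw [hζ0 x hx, zero_pow (by omega), zero_pow (by omega)]
    simpa using hind
  rcases le_or_gt (u x) m with hum | hum
  · rw [truncFun_eq_zero hη hum, truncDeriv_eq_zero hη hum]
    simpa using hind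
  have hux : 0 < u x := by linarith
  rw [Set.indicator_of_mem hx]
  have hs : max (u x - k₀) 0 = u x - k₀ := max_eq_left (by linarith)
  rw [hs]
  have hub : 1 + u x ≤ b * (u x - k₀) := by
    have : (b - 1) * (m - k₀) ≤ (b - 1) * (u x - k₀) :=
      mul_le_mul_of_nonneg_left (by linarith) (by linarith)
    linarith
  have hg' := truncDeriv_mem (m := m) hη (u x)
  have hg := truncFun_nonneg (m := m) hη (u x)
  have hgs : truncFun m η (u x) ≤ truncDeriv m η (u x) * (u x - k₀) :=
    (truncFun_le hη hum.le).trans (mul_le_mul_of_nonneg_left (by linarith) hg'.1)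
  have hz := pow_nonneg (hζ x).1 N
  have hz1 := pow_le_one₀ (n := N) (hζ x).1 (hζ x).2
  have hz' := pow_nonneg (hζ x).1 (N - 1)
  have hz1' := pow_le_one₀ (n := N - 1) (hζ x).1 (hζ x).2
  have ha := h.a_nonneg x
  have hp1 := h.one_lt_p x
  have hq1 := h.one_lt_q x
  rw [abs_of_pos hux] at hF hco
  have hG' := hG hux
  rw [abs_of_pos hux] at hG'
  have habs := absorption_le (n := N) (p := p x) (q := q x) (q₁ := q₁) (a := a x) (A := A)
    (s := u x - k₀) (u := u x) (T := ‖gradient u x‖) (b := b) (z := ζ x ^ N) (z' := ζ x ^ (N - 1))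
    (Z := Z) (θ := θ) (ρ := ρ x) (σ := σ x) (k := |k x|) (d := |d x|) (M := N * M₁) (L := L)
    (M₃ := M₃) (ε := ε) hN hp1 (h.p_le_q x) (h.q_le x) h.q_lt (h.ratio x) ha (h.a_le x)
    (by linarith) hux (by linarith) (by linarith) hb (norm_nonneg _) hz hz1 hz1'
    (pow_pred_le_rpow hN2 (hζ x).1 (hζ x).2 (by linarith) (h.p_lt x).le)
    (pow_pred_le_rpow hN2 (hζ x).1 (hζ x).2 (by linarith) (h.q_lt_dim x).le)
    hZ hZ1 hθ (hS.one_lt_ρ x) (hS.one_lt_σ x) (hS.ρ_le x) (hS.σ_le x) (hθρ x hx).1 (hθρ x hx).2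
    (abs_nonneg _) (abs_nonneg _) (by positivity) hL.le hM₃.le hε0 hε1
  rw [← hC] at habs
  have hcu := critFun_nonneg (n := N) (p := p x) (q := q x) ha hux.le
  have hcs := critFun_nonneg (n := N) (p := p x) (q := q x) ha (by linarith : 0 ≤ u x - k₀)
  have hI₂ : |@inner ℝ _ _ (F x) (gradient ζ x)| ≤ ‖F x‖ * D :=
    (abs_real_inner_le_norm _ _).trans (mul_le_mul_of_nonneg_left (hζD x) (norm_nonneg _))
  have hD : 0 ≤ D := (norm_nonneg _).trans (hζD x)
  have hT := norm_nonneg (gradient u x)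
  set R₀ : ℝ := b ^ ((N : ℝ) * N / (N - q₁) + 1) *
    (Z ^ (θ - 1) * critFun N (p x) (q x) (a x) (u x - k₀) + Z ^ θ * dataWeight ρ σ k d x) with hR₀
  have hR₀n : 0 ≤ R₀ := by rw [hR₀]; unfold dataWeight; positivity
  refine testing_pointwise (n := N) (s := u x - k₀) (b := b) (M₁ := M₁) (M₂ := M₂) (M₃ := M₃)
    (L := L) (c := critFun N (p x) (q x) (a x) (u x)) (D := D) (by positivity) hg hgs hg'.1 hg'.2
    hz hz1 hz' hco (hI₂.trans (mul_le_mul_of_nonneg_right hF hD)) hG' ?_ ?_ hDb ?_ ?_ ?_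
  · positivity
  · positivity
  · positivity
  · rw [mul_assoc]; positivity
  · refine habs.trans ?_
    have hH : 0 ≤ ζ x ^ N * (‖gradient u x‖ ^ p x + a x * ‖gradient u x‖ ^ q x) := by positivity
    have h1 := mul_le_mul_of_nonneg_right hεM hH
    have h2 : C * R₀ ≤ (C + 1) * R₀ := mul_le_mul_of_nonneg_right (by linarith) hR₀n
    rw [hR₀] at h2
    unfold dataWeight at h2 ⊢
    unfold Hfun
    linarith

end

section

variable {N : ℕ} {p q a ρ σ k d : EuclideanSpace ℝ (Fin N) → ℝ} {p₀ q₁ A M₁ M₂ M₃ L : ℝ} {K : NNReal}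
  {u : EuclideanSpace ℝ (Fin N) → ℝ} {F : EuclideanSpace ℝ (Fin N) → EuclideanSpace ℝ (Fin N)}
  {G : EuclideanSpace ℝ (Fin N) → ℝ}

/-- Caccioppoli inequality on concentric cubes and increasing levels. -/
theorem CritSubsolution.caccioppoli (h : PhaseBounds N p q a p₀ q₁ A K)
    (hS : CritSubsolution N p q a ρ σ k d M₁ M₂ M₃ L u F G) :
    ∃ C : ℝ, 1 ≤ C ∧ ∀ (y : EuclideanSpace ℝ (Fin N)) (α β k₀ m η b Z θ Mw : ℝ),
      0 < α → α < β → 2 * β ≤ 1 → 0 ≤ k₀ → k₀ < m → 0 < η → 8 * N / (β - α) ≤ b → 1 ≤ b →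
      1 + k₀ ≤ (b - 1) * (m - k₀) → 0 < Z → Z ≤ 1 → θ ≤ 1 →
      (∀ x ∈ cube y (2 * β), θ * ρ x ≤ 1 ∧ θ * σ x ≤ 1) → 0 ≤ Mw →
      ∫⁻ x in cube y 1, ENNReal.ofReal (dataWeight ρ σ k d x) ≤ ENNReal.ofReal Mw →
      ∫⁻ x in cube y (2 * β), ENNReal.ofReal (critFun N (p x) (q x) (a x) (max (u x - k₀) 0)) ≤
        ENNReal.ofReal Z →
      ∫⁻ x in cube y (2 * α) ∩ {x | m + η < u x}, ENNReal.ofReal (Hfun p q a x ‖gradient u x‖) ≤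
        ENNReal.ofReal (C * b ^ ((N : ℝ) * N / (N - q₁) + 1) * (1 + Mw) * Z ^ θ) := by
  obtain ⟨C, hC1, hC⟩ := hS.testing_le h
  have hM₂ := hS.M₂_pos
  have hu := hS.contDiff
  refine ⟨2 / M₂ * C + 1, by have : 0 ≤ 2 / M₂ * C := by positivity
                             linarith, ?_⟩
  intro y α β k₀ m η b Z θ Mw hα hαβ hβ hk₀ hkm hη hDb hb hbm hZ hZ1 hθ hθρ hMw hw hY
  obtain ⟨ζ, hζC, hζ, hζ1, hζ0, hζD⟩ := exists_cube_cutoff y hα hαβ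
  have hpt := hC y β k₀ m η _ b Z θ ζ hζC hζ hζ0 hζD hk₀ hkm hη hDb hb hbm hZ hZ1 hθ hθρ
  set φ : EuclideanSpace ℝ (Fin N) → ℝ := fun x => truncFun m η (u x) * ζ x ^ N with hφ
  have hN := h.two_le
  have hN2 : 2 ≤ N := by exact_mod_cast hN
  have hφC : ContDiff ℝ 1 φ := ((contDiff_truncFun m η).comp hu).mul (hζC.pow N)
  have hcomp : IsCompact (Metric.closedBall y (N * (2 * β / 2))) := isCompact_closedBall _ _
  have hoff : ∀ x, x ∉ Metric.closedBall y (N * (2 * β / 2)) → ζ x = 0 := fun x hx =>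
    hζ0 x fun hx' => hx (cube_subset_closedBall y _ hx')
  have hφc : HasCompactSupport φ := HasCompactSupport.intro hcomp fun x hx => by
    rw [hφ]; simp only []; rw [hoff x hx, zero_pow (by omega), mul_zero]
  have hi1 := integrable_inner_gradient hS.locInt_F hφC hφc
  have hi2 : Integrable fun x => G x * φ x := by
    simpa [mul_comm] using hS.locInt_G.integrable_smul_left_of_hasCompactSupport hφC.continuous hφc
  have hweak := hS.weak φ hφC hφc
  set f₁ : EuclideanSpace ℝ (Fin N) → ℝ := fun x =>
    M₂ / 2 * (truncDeriv m η (u x) * ζ x ^ N * Hfun p q a x ‖gradient u x‖) with hf₁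
  have hf₁0 : ∀ x, 0 ≤ f₁ x := fun x => by
    have := (truncDeriv_mem (m := m) hη (u x)).1
    have := h.Hfun_nonneg x (norm_nonneg (gradient u x))
    have := (hζ x).1
    rw [hf₁]; positivity
  have hf₁c : Continuous f₁ := by
    have h1 := h.continuous_Hfun (continuous_gradient hu).norm
    have h2 := hu.continuous
    have h3 := hζC.continuous
    rw [hf₁]; unfold truncDeriv; fun_prop
  have hf₁i : Integrable f₁ := hf₁c.integrable_of_hasCompactSupport
    (HasCompactSupport.intro hcomp fun x hx => by
      rw [hf₁]; simp only []; rw [hoff x hx, zero_pow (by omega)]; ring)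
  set B := b ^ ((N : ℝ) * N / (N - q₁) + 1) with hB
  have hB0 : 0 ≤ B := by positivity
  have hC0 : 0 ≤ C := by linarith
  have hcrit : ∀ x, 0 ≤ critFun N (p x) (q x) (a x) (max (u x - k₀) 0) := fun x =>
    critFun_nonneg (h.a_nonneg x) (le_max_right _ _)
  have hwt : ∀ x, 0 ≤ dataWeight ρ σ k d x := fun x => by unfold dataWeight; positivity
  have hfi : ENNReal.ofReal (∫ x, f₁ x) ≤ ENNReal.ofReal (C * B * (1 + Mw) * Z ^ θ) := by
    have e1 : ∫ x, f₁ x = ∫ x, (f₁ x - (@inner ℝ _ _ (F x) (gradient φ x) + G x * φ x)) := by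
      have s1 := integral_sub hf₁i (hi1.add hi2)
      have s2 := integral_add hi1 hi2
      simp only [Pi.add_apply] at s1 s2
      rw [s1, s2, hweak, sub_zero]
    rw [e1]
    refine (ofReal_integral_le_lintegral (hf₁i.sub (hi1.add hi2))).trans ?_
    calc _ ≤ ∫⁻ x, (cube y (2 * β)).indicator (fun x => ENNReal.ofReal (C * B *
          (Z ^ (θ - 1) * critFun N (p x) (q x) (a x) (max (u x - k₀) 0) +
            Z ^ θ * dataWeight ρ σ k d x))) x := by
          refine lintegral_mono_ae ?_
          filter_upwards [hpt] with x hx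
          change f₁ x ≤ @inner ℝ _ _ (F x) (gradient φ x) + G x * φ x + _ at hx
          simp only [Pi.sub_apply, Pi.add_apply]
          by_cases hxc : x ∈ cube y (2 * β)
          · rw [Set.indicator_of_mem hxc] at hx ⊢
            exact ENNReal.ofReal_le_ofReal (by linarith)
          · rw [Set.indicator_of_notMem hxc] at hx ⊢
            rw [nonpos_iff_eq_zero, ENNReal.ofReal_eq_zero]; linarith
      _ = ∫⁻ x in cube y (2 * β), (ENNReal.ofReal (C * B * Z ^ (θ - 1)) *
            ENNReal.ofReal (critFun N (p x) (q x) (a x) (max (u x - k₀) 0)) +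
            ENNReal.ofReal (C * B * Z ^ θ) * ENNReal.ofReal (dataWeight ρ σ k d x)) := by
          rw [lintegral_indicator (measurableSet_cube _ _)]
          refine lintegral_congr fun x => ?_
          rw [← ENNReal.ofReal_mul (by positivity), ← ENNReal.ofReal_mul (by positivity),
            ← ENNReal.ofReal_add (mul_nonneg (by positivity) (hcrit x))
              (mul_nonneg (by positivity) (hwt x))]
          congr 1; ring
      _ ≤ ENNReal.ofReal (C * B * Z ^ (θ - 1)) * ENNReal.ofReal Z +
          ENNReal.ofReal (C * B * Z ^ θ) * ENNReal.ofReal Mw := by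
          have hcm : Measurable fun x => critFun N (p x) (q x) (a x) (max (u x - k₀) 0) :=
            (h.continuous_critFun (v := fun x => max (u x - k₀) 0)
              (by have := hu.continuous; fun_prop)).measurable
          rw [lintegral_add_left (by fun_prop), lintegral_const_mul' _ _ ENNReal.ofReal_ne_top,
            lintegral_const_mul' _ _ ENNReal.ofReal_ne_top]
          gcongr
          exact (lintegral_mono_set (cube_mono y hβ)).trans hw
      _ = _ := by
          rw [← ENNReal.ofReal_mul (by positivity), ← ENNReal.ofReal_mul (by positivity),
            ← ENNReal.ofReal_add (by positivity) (by positivity)]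
          congr 1
          have : Z ^ (θ - 1) * Z = Z ^ θ := by
            rw [← Real.rpow_add_one hZ.ne']; congr 1; ring
          linear_combination C * B * this
  have hmset : MeasurableSet (cube y (2 * α) ∩ {x | m + η < u x}) :=
    (measurableSet_cube _ _).inter (measurableSet_lt measurable_const hu.continuous.measurable)
  have hlow : ENNReal.ofReal (M₂ / 2) * ∫⁻ x in cube y (2 * α) ∩ {x | m + η < u x},
      ENNReal.ofReal (Hfun p q a x ‖gradient u x‖) ≤ ENNReal.ofReal (∫ x, f₁ x) := by
    rw [ofReal_integral_eq_lintegral_ofReal hf₁i (Eventually.of_forall hf₁0),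
      ← lintegral_const_mul' _ _ ENNReal.ofReal_ne_top]
    refine (setLIntegral_mono' hmset fun x hx => ?_).trans (setLIntegral_le_lintegral _ _)
    rw [← ENNReal.ofReal_mul (by positivity), hf₁]
    simp only []
    rw [hζ1 x hx.1, truncDeriv_eq_one hη (le_of_lt hx.2)]
    simp
  have e2 : ENNReal.ofReal (M₂ / 2) ≠ 0 := by
    rw [Ne, ENNReal.ofReal_eq_zero, not_le]; positivity
  have h3 := hlow.trans hfi
  rw [mul_comm, ← ENNReal.le_div_iff_mul_le (Or.inl e2) (Or.inl ENNReal.ofReal_ne_top),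
    ← ENNReal.ofReal_div_of_pos (by positivity)] at h3
  refine h3.trans (ENNReal.ofReal_le_ofReal ?_)
  have h4 : 0 ≤ B * (1 + Mw) * Z ^ θ := by positivity
  have h5 : C * B * (1 + Mw) * Z ^ θ / (M₂ / 2) = 2 / M₂ * C * (B * (1 + Mw) * Z ^ θ) := by
    field_simp
  rw [h5]
  linarith

end

theorem critFun_mono {n p q a v w : ℝ} (ha : 0 ≤ a) (hv : 0 ≤ v) (hvw : v ≤ w)
    (hp : 0 ≤ critExp n p) (hq : 0 ≤ critExp n q) : critFun n p q a v ≤ critFun n p q a w := by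
  unfold critFun
  have h1 := Real.rpow_le_rpow hv hvw hp
  have h2 := mul_le_mul_of_nonneg_left (Real.rpow_le_rpow hv hvw hq)
    (Real.rpow_nonneg ha (critExp n q / q))
  linarith

theorem one_le_rpow_mul_critFun {n p q a b s Q : ℝ} (ha : 0 ≤ a) (hb : 1 ≤ b) (hs : 0 ≤ s)
    (hbs : 1 ≤ b * s) (hp : 0 ≤ critExp n p) (hpQ : critExp n p ≤ Q) :
    1 ≤ b ^ Q * critFun n p q a s := by
  have h1 : 1 ≤ (b * s) ^ critExp n p := Real.one_le_rpow hbs hp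
  rw [Real.mul_rpow (by linarith) hs] at h1
  have h2 : b ^ critExp n p ≤ b ^ Q := Real.rpow_le_rpow_of_exponent_le hb hpQ
  have h3 : s ^ critExp n p ≤ critFun n p q a s := by
    unfold critFun
    have : 0 ≤ a ^ (critExp n q / q) * s ^ critExp n q := by positivity
    linarith
  calc (1 : ℝ) ≤ _ := h1
    _ ≤ _ := by gcongr

section

variable {N : ℕ} {p q a ρ σ k d : EuclideanSpace ℝ (Fin N) → ℝ} {p₀ q₁ A M₁ M₂ M₃ L : ℝ} {K : NNReal}
  {u : EuclideanSpace ℝ (Fin N) → ℝ} {F : EuclideanSpace ℝ (Fin N) → EuclideanSpace ℝ (Fin N)}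
  {G : EuclideanSpace ℝ (Fin N) → ℝ}

theorem PhaseBounds.critExp_fst_pos (h : PhaseBounds N p q a p₀ q₁ A K) (x) :
    0 < critExp N (p x) := by
  have := h.two_le
  have := h.one_lt_p x
  exact lt_critExp_pos (by linarith) (by linarith) (h.p_lt x)

theorem PhaseBounds.critExp_snd_pos (h : PhaseBounds N p q a p₀ q₁ A K) (x) :
    0 < critExp N (q x) := by
  have := h.two_le
  have := h.one_lt_q x
  exact lt_critExp_pos (by linarith) (by linarith) (h.q_lt_dim x)

/-- One step of the De Giorgi iteration. -/
theorem CritSubsolution.deGiorgi_step (h : PhaseBounds N p q a p₀ q₁ A K)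
    (hS : CritSubsolution N p q a ρ σ k d M₁ M₂ M₃ L u F G) {ℓ₀ : ℝ} (hℓ₀ : 0 < ℓ₀) :
    ∃ C : ℝ, 1 ≤ C ∧ ∀ (y : EuclideanSpace ℝ (Fin N)) (α β k₀ m η b Z θ Mw τ π e : ℝ),
      ℓ₀ ≤ 2 * α → α < β → 2 * β ≤ 1 → 0 ≤ k₀ → k₀ < m → 0 < η → 8 * N / (β - α) ≤ b → 1 ≤ b →
      1 + k₀ ≤ (b - 1) * (m - k₀) → 0 < Z → Z ≤ 1 → θ ≤ 1 →
      (∀ x ∈ cube y (2 * β), θ * ρ x ≤ 1 ∧ θ * σ x ≤ 1) → (∀ x ∈ cube y (2 * β), π ≤ p x) →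
      0 ≤ τ → e ≤ 1 - τ → e ≤ θ + τ * (π - 1) → 0 ≤ Mw →
      ∫⁻ x in cube y 1, ENNReal.ofReal (dataWeight ρ σ k d x) ≤ ENNReal.ofReal Mw →
      ∫⁻ x in cube y (2 * β), ENNReal.ofReal (critFun N (p x) (q x) (a x) (max (u x - k₀) 0)) ≤
        ENNReal.ofReal Z →
      ∫⁻ x in cube y (2 * α),
          ENNReal.ofReal (critFun N (p x) (q x) (a x) (max (u x - (m + η)) 0)) ≤
        ENNReal.ofReal (2 * (C * (b ^ ((N : ℝ) * N / (N - q₁) + 1) * (1 + Mw) * Z ^ e)) ^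
          ((N : ℝ) / (N - 1))) := by
  obtain ⟨C, hC1, hC⟩ := hS.caccioppoli h
  have hu := hS.contDiff
  have hN := h.two_le
  have hgC := gagConst_nonneg hN h.q_lt h.one_le K.2
  set c : ℝ := 2 * (gagConst N q₁ A K + 1 / ℓ₀) with hc
  have hc0 : 0 < c := by positivity
  set Q : ℝ := (N : ℝ) * N / (N - q₁) with hQ
  refine ⟨c * (3 * C) + 1, by have : 0 ≤ c * (3 * C) := by positivity
                              linarith, ?_⟩
  intro y α β k₀ m η b Z θ Mw τ π e hℓ hαβ hβ hk₀ hkm hη hDb hb hbm hZ hZ1 hθ hθρ hπ hτ he1 he2 hMw hw hY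
  have hα : 0 < α := by linarith
  have hcac := hC y α β k₀ m η b Z θ Mw hα hαβ hβ hk₀ hkm hη hDb hb hbm hZ hZ1 hθ hθρ hMw hw hY
  have hsub : cube y (2 * α) ⊆ cube y (2 * β) := cube_mono y (by linarith)
  have hμ : 1 ≤ Z ^ (-τ) := Real.one_le_rpow_of_pos_of_le_one_of_nonpos hZ hZ1 (by linarith)
  have hsob := h.lintegral_critFun_le hu (m + η) y hℓ₀ hℓ hμ (fun x hx => hπ x (hsub hx))
  refine hsob.trans ?_
  have hr : 0 ≤ (N : ℝ) / (N - 1) := div_nonneg (by linarith) (by linarith)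
  have e0 : (2 : ℝ≥0∞) = ENNReal.ofReal 2 := by simp
  have hbQ : 0 ≤ b ^ (Q + 1) := by positivity
  rw [ENNReal.ofReal_mul zero_le_two, ← ENNReal.ofReal_rpow_of_nonneg (by positivity) hr, ← e0]
  gcongr
  have hcrit : ∀ x, 0 ≤ critFun N (p x) (q x) (a x) (max (u x - k₀) 0) := fun x =>
    critFun_nonneg (h.a_nonneg x) (le_max_right _ _)
  have hH : ∀ x, 0 ≤ Hfun p q a x ‖gradient u x‖ := fun x => h.Hfun_nonneg x (norm_nonneg _)
  have hmset : MeasurableSet (cube y (2 * α) ∩ {x | m + η < u x}) :=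
    (measurableSet_cube _ _).inter (measurableSet_lt measurable_const hu.continuous.measurable)
  have hcm : Measurable fun x => critFun N (p x) (q x) (a x) (max (u x - k₀) 0) :=
    (h.continuous_critFun (v := fun x => max (u x - k₀) 0)
      (by have := hu.continuous; fun_prop)).measurable
  set ν : ℝ := (Z ^ (-τ)) ^ (-(π - 1)) with hν
  have hν0 : 0 ≤ ν := by positivity
  calc _ ≤ ∫⁻ x in cube y (2 * α) ∩ {x | m + η < u x},
        (ENNReal.ofReal (c * (Z ^ (-τ) + b ^ Q)) *
          ENNReal.ofReal (critFun N (p x) (q x) (a x) (max (u x - k₀) 0)) +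
        ENNReal.ofReal (c * ν) * ENNReal.ofReal (Hfun p q a x ‖gradient u x‖)) := by
        refine setLIntegral_mono' hmset fun x hx => ?_
        have hx2 : m + η < u x := hx.2
        rw [← ENNReal.ofReal_mul (by positivity), ← ENNReal.ofReal_mul (by positivity),
          ← ENNReal.ofReal_add (mul_nonneg (by positivity) (hcrit x))
            (mul_nonneg (by positivity) (hH x))]
        apply ENNReal.ofReal_le_ofReal
        have h1 : critFun N (p x) (q x) (a x) (max (u x - (m + η)) 0) ≤
            critFun N (p x) (q x) (a x) (max (u x - k₀) 0) :=
          critFun_mono (h.a_nonneg x) (le_max_right _ _) (max_le_max (by linarith) le_rfl)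
            (h.critExp_fst_pos x).le (h.critExp_snd_pos x).le
        have h2 : 1 ≤ b ^ Q * critFun N (p x) (q x) (a x) (max (u x - k₀) 0) := by
          refine one_le_rpow_mul_critFun (h.a_nonneg x) hb (le_max_right _ _) ?_
            (h.critExp_fst_pos x).le
            (critExp_le (zero_lt_one.trans (h.one_lt_p x)) ((h.p_le_q x).trans (h.q_le x)) h.q_lt)
          rw [max_eq_left (by linarith)]
          have h3 : (b - 1) * (m - k₀) ≤ (b - 1) * (u x - k₀) :=
            mul_le_mul_of_nonneg_left (by linarith) (by linarith)
          linarith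
        have h3 := mul_le_mul_of_nonneg_left h1 (by linarith : 0 ≤ Z ^ (-τ))
        have h4 : c * (Z ^ (-τ) * critFun N (p x) (q x) (a x) (max (u x - (m + η)) 0) +
            ν * Hfun p q a x ‖gradient u x‖ + 1) ≤
            c * (Z ^ (-τ) * critFun N (p x) (q x) (a x) (max (u x - k₀) 0) +
            ν * Hfun p q a x ‖gradient u x‖ +
              b ^ Q * critFun N (p x) (q x) (a x) (max (u x - k₀) 0)) := by
          apply mul_le_mul_of_nonneg_left _ hc0.le
          linarith
        refine h4.trans (le_of_eq ?_)
        ring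
    _ ≤ ENNReal.ofReal (c * (Z ^ (-τ) + b ^ Q)) * ENNReal.ofReal Z +
        ENNReal.ofReal (c * ν) * ENNReal.ofReal (C * b ^ (Q + 1) * (1 + Mw) * Z ^ θ) := by
        rw [lintegral_add_left (by fun_prop), lintegral_const_mul' _ _ ENNReal.ofReal_ne_top,
          lintegral_const_mul' _ _ ENNReal.ofReal_ne_top]
        gcongr
        exact (lintegral_mono_set (Set.inter_subset_left.trans hsub)).trans hY
    _ ≤ _ := by
        rw [← ENNReal.ofReal_mul (by positivity), ← ENNReal.ofReal_mul (by positivity),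
            ← ENNReal.ofReal_add (by positivity) (by positivity)]
        apply ENNReal.ofReal_le_ofReal
        have z1 : Z ^ (-τ) * Z ≤ Z ^ e := by
          rw [← Real.rpow_add_one hZ.ne']
          exact Real.rpow_le_rpow_of_exponent_ge hZ hZ1 (by linarith)
        have z2 : Z ≤ Z ^ e := by
          conv_lhs => rw [← Real.rpow_one Z]
          exact Real.rpow_le_rpow_of_exponent_ge hZ hZ1 (by linarith)
        have z3 : ν * Z ^ θ ≤ Z ^ e := by
          rw [hν, ← Real.rpow_mul hZ.le, ← Real.rpow_add hZ]
          exact Real.rpow_le_rpow_of_exponent_ge hZ hZ1 (by linarith)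
        have hb1 : b ^ Q ≤ b ^ (Q + 1) := Real.rpow_le_rpow_of_exponent_le hb (by linarith)
        have hQ0 : 0 ≤ Q := by
          rw [hQ]; exact div_nonneg (by positivity) (sub_nonneg.mpr h.q_lt.le)
        have hb2 : 1 ≤ b ^ (Q + 1) := Real.one_le_rpow hb (by linarith)
        set W := b ^ (Q + 1) * (1 + Mw) with hW
        have hW1 : b ^ (Q + 1) ≤ W := by
          rw [hW]; exact le_mul_of_one_le_right hbQ (by linarith)
        have hZe : 0 ≤ Z ^ e := by positivity
        have hCW : W ≤ C * W := le_mul_of_one_le_left (by linarith) hC1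
        have t1 : Z ^ (-τ) * Z ≤ C * W * Z ^ e :=
          z1.trans (le_mul_of_one_le_left hZe (by linarith))
        have t2 : b ^ Q * Z ≤ C * W * Z ^ e :=
          mul_le_mul (by linarith) z2 hZ.le (by linarith)
        have t3 : C * W * (ν * Z ^ θ) ≤ C * W * Z ^ e :=
          mul_le_mul_of_nonneg_left z3 (by linarith)
        have t4 := mul_le_mul_of_nonneg_left (add_le_add (add_le_add t1 t2) t3) hc0.le
        have t5 : 0 ≤ W * Z ^ e := mul_nonneg (by linarith) hZe
        have t6 : c * (Z ^ (-τ) + b ^ Q) * Z + c * ν * (C * b ^ (Q + 1) * (1 + Mw) * Z ^ θ) =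
          c * (Z ^ (-τ) * Z + b ^ Q * Z + C * W * (ν * Z ^ θ)) := by rw [hW]; ring
        rw [t6]
        linarith

end

/-- Fast geometric convergence. -/
theorem exists_geometric_decay {C D δ : ℝ} (hC : 1 ≤ C) (hD : 1 < D) (hδ : 0 < δ) :
    ∃ lam ε₀ : ℝ, 0 < lam ∧ lam < 1 ∧ 0 < ε₀ ∧ ε₀ ≤ 1 ∧
      ∀ n : ℕ, C * D ^ n * (ε₀ * lam ^ n) ^ (1 + δ) ≤ ε₀ * lam ^ (n + 1) := by
  have hD0 : 0 < D := by linarith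
  set lam : ℝ := D ^ (-(1 / δ)) with hlam
  have hl0 : 0 < lam := by positivity
  have hl1 : lam < 1 := Real.rpow_lt_one_of_one_lt_of_neg hD (by simpa using hδ)
  have hlδ : lam ^ δ = D⁻¹ := by
    rw [hlam, ← Real.rpow_mul hD0.le, neg_mul, one_div_mul_cancel hδ.ne', Real.rpow_neg_one]
  set ε₀ : ℝ := (lam / C) ^ (1 / δ) with hε₀
  have hC0 : 0 < C := by linarith
  have he0 : 0 < ε₀ := by positivity
  have he1 : ε₀ ≤ 1 := by
    apply Real.rpow_le_one (by positivity) _ (by positivity)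
    rw [div_le_one hC0]; linarith
  have heδ : ε₀ ^ δ = lam / C := by
    rw [hε₀, ← Real.rpow_mul (by positivity), one_div_mul_cancel hδ.ne', Real.rpow_one]
  refine ⟨lam, ε₀, hl0, hl1, he0, he1, fun n => le_of_eq ?_⟩
  have hp : 0 < ε₀ * lam ^ n := by positivity
  rw [Real.rpow_add hp, Real.rpow_one, Real.mul_rpow he0.le (by positivity), heδ,
    ← Real.rpow_natCast lam n, ← Real.rpow_mul hl0.le, mul_comm (n : ℝ) δ, Real.rpow_mul hl0.le,
    hlδ, Real.rpow_natCast, Real.rpow_natCast, inv_pow]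
  field_simp
  ring

section

variable {N : ℕ} {p q a ρ σ k d : EuclideanSpace ℝ (Fin N) → ℝ} {p₀ q₁ A M₁ M₂ M₃ L : ℝ} {K : NNReal}
  {u : EuclideanSpace ℝ (Fin N) → ℝ} {F : EuclideanSpace ℝ (Fin N) → EuclideanSpace ℝ (Fin N)}
  {G : EuclideanSpace ℝ (Fin N) → ℝ}

theorem isOpen_cube (y : EuclideanSpace ℝ (Fin N)) (r : ℝ) : IsOpen (cube y r) := by
  have : cube y r = ⋂ i, {x : EuclideanSpace ℝ (Fin N) | |x i - y i| < r / 2} := by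
    ext; simp [cube]
  rw [this]
  exact isOpen_iInter_of_finite fun i => isOpen_lt (by fun_prop) (by fun_prop)

theorem mem_cube_self (y : EuclideanSpace ℝ (Fin N)) {r : ℝ} (hr : 0 < r) : y ∈ cube y r :=
  fun i => by simpa using by linarith

theorem PhaseBounds.le_of_lintegral_critFun_eq_zero (h : PhaseBounds N p q a p₀ q₁ A K)
    (hu : Continuous u) {y : EuclideanSpace ℝ (Fin N)} {r t : ℝ} (hr : 0 < r)
    (h0 : ∫⁻ x in cube y r, ENNReal.ofReal (critFun N (p x) (q x) (a x) (max (u x - t) 0)) = 0) :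
    u y ≤ t := by
  have hc : Continuous fun x => critFun N (p x) (q x) (a x) (max (u x - t) 0) :=
    h.continuous_critFun (v := fun x => max (u x - t) 0) (by fun_prop)
  have hm : Measurable fun x => ENNReal.ofReal (critFun N (p x) (q x) (a x) (max (u x - t) 0)) :=
    hc.measurable.ennreal_ofReal
  rw [lintegral_eq_zero_iff hm] at h0
  have h1 := (Measure.eqOn_open_of_ae_eq h0 (isOpen_cube y r)
    (ENNReal.continuous_ofReal.comp hc).continuousOn continuousOn_const) (mem_cube_self y hr)
  have h2 : critFun N (p y) (q y) (a y) (max (u y - t) 0) ≤ 0 := by simpa using h1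
  by_contra hlt
  push Not at hlt
  have h3 : 0 < max (u y - t) 0 := by rw [lt_max_iff]; left; linarith
  have : 0 < max (u y - t) 0 ^ critExp N (p y) := by positivity
  have : 0 ≤ a y ^ (critExp N (q y) / q y) * max (u y - t) 0 ^ critExp N (q y) := by
    have := h.a_nonneg y; positivity
  unfold critFun at h2
  linarith

/-- Smallness of the critical energy above level `1` on a cube forces `u ≤ 2` at its center. -/
theorem CritSubsolution.exists_smallness (h : PhaseBounds N p q a p₀ q₁ A K)
    (hS : CritSubsolution N p q a ρ σ k d M₁ M₂ M₃ L u F G) {r₀ e Mw : ℝ} (hr₀ : 0 < r₀)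
    (hr₁ : r₀ ≤ 1 / 2) (he : 1 < e * ((N : ℝ) / (N - 1))) (hMw : 0 ≤ Mw)
    (hw : ∀ y, ∫⁻ x in cube y 1, ENNReal.ofReal (dataWeight ρ σ k d x) ≤ ENNReal.ofReal Mw) :
    ∃ ε₀ : ℝ, 0 < ε₀ ∧ ∀ (y : EuclideanSpace ℝ (Fin N)) (θ τ π : ℝ), θ ≤ 1 →
      (∀ x ∈ cube y (2 * r₀), θ * ρ x ≤ 1 ∧ θ * σ x ≤ 1) → (∀ x ∈ cube y (2 * r₀), π ≤ p x) →
      0 ≤ τ → e ≤ 1 - τ → e ≤ θ + τ * (π - 1) →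
      ∫⁻ x in cube y (2 * r₀), ENNReal.ofReal (critFun N (p x) (q x) (a x) (max (u x - 1) 0)) ≤
        ENNReal.ofReal ε₀ → u y ≤ 2 := by
  obtain ⟨C, hC1, hC⟩ := hS.deGiorgi_step h hr₀
  have hN := h.two_le
  set Q : ℝ := (N : ℝ) * N / (N - q₁) with hQ
  have hQ0 : 0 ≤ Q := by
    rw [hQ]; exact div_nonneg (by positivity) (sub_nonneg.mpr h.q_lt.le)
  set r : ℝ := (N : ℝ) / (N - 1) with hr
  have hr0 : 0 < r := by rw [hr]; exact div_pos (by linarith) (by linarith)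
  set B₀ : ℝ := 13 + 32 * N / r₀ with hB₀
  have hB₀1 : 13 ≤ B₀ := by rw [hB₀]; have : 0 ≤ 32 * N / r₀ := by positivity
                            linarith
  set C' : ℝ := 2 * (C * (B₀ ^ (Q + 1) * (1 + Mw))) ^ r with hC'
  have hC'1 : 1 ≤ C' := by
    have h1 : 1 ≤ B₀ ^ (Q + 1) := Real.one_le_rpow (by linarith) (by linarith)
    have h2 : 1 ≤ C * (B₀ ^ (Q + 1) * (1 + Mw)) := by
      have : 1 ≤ B₀ ^ (Q + 1) * (1 + Mw) := by nlinarith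
      nlinarith
    have h3 : 1 ≤ (C * (B₀ ^ (Q + 1) * (1 + Mw))) ^ r := Real.one_le_rpow h2 hr0.le
    linarith
  set D : ℝ := (2 : ℝ) ^ ((Q + 1) * r) with hD
  have hD1 : 1 < D := Real.one_lt_rpow one_lt_two (by positivity)
  obtain ⟨lam, ε₀, hl0, hl1, he0, he1, hdec⟩ := exists_geometric_decay hC'1 hD1 (sub_pos.mpr he)
  refine ⟨ε₀, he0, ?_⟩
  intro y θ τ π hθ hθρ hπ hτ hτ1 hτ2 h0
  have hiter : ∀ n : ℕ, ∫⁻ x in cube y (2 * (r₀ / 2 * (1 + (1 / 2) ^ n))),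
      ENNReal.ofReal (critFun N (p x) (q x) (a x) (max (u x - (2 - (1 / 2) ^ n)) 0)) ≤
      ENNReal.ofReal (ε₀ * lam ^ n) := by
    intro n
    induction n with
    | zero =>
      have e1 : 2 * (r₀ / 2 * (1 + (1 / 2 : ℝ) ^ 0)) = 2 * r₀ := by ring
      have e2 : (2 : ℝ) - (1 / 2) ^ 0 = 1 := by norm_num
      rw [e1, e2, pow_zero, mul_one]; exact h0
    | succ n ih =>
      set x : ℝ := (1 / 2 : ℝ) ^ n with hx
      have hx0 : 0 < x := by positivity
      have hx1 : x ≤ 1 := pow_le_one₀ (by norm_num) (by norm_num)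
      have hxi : x * 2 ^ n = 1 := by rw [hx, ← mul_pow]; norm_num
      have hxs : (1 / 2 : ℝ) ^ (n + 1) = x / 2 := by rw [pow_succ, hx]; ring
      rw [hxs]
      have h2n : (1 : ℝ) ≤ 2 ^ n := one_le_pow₀ one_le_two
      have hsub : cube y (2 * (r₀ / 2 * (1 + x))) ⊆ cube y (2 * r₀) := cube_mono y (by nlinarith)
      have hstep := hC y (r₀ / 2 * (1 + x / 2)) (r₀ / 2 * (1 + x)) (2 - x) (2 - x + x / 4) (x / 4)
        (B₀ * 2 ^ n) (ε₀ * lam ^ n) θ Mw τ π e (by nlinarith) (by nlinarith) (by nlinarith)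
        (by linarith) (by linarith) (by linarith) ?_ ?_ ?_ (by positivity)
        (mul_le_one₀ he1 (by positivity) (pow_le_one₀ hl0.le hl1.le)) hθ
        (fun z hz => hθρ z (hsub hz)) (fun z hz => hπ z (hsub hz)) hτ hτ1 hτ2 hMw (hw y) ih
      · have e1 : 2 - x + x / 4 + x / 4 = 2 - x / 2 := by ring
        rw [e1] at hstep
        refine hstep.trans (ENNReal.ofReal_le_ofReal ((le_of_eq ?_).trans (hdec n)))
        have hZ : 0 < ε₀ * lam ^ n := by positivity
        have hB : 0 < B₀ := by linarith
        have e2 : (B₀ * 2 ^ n) ^ (Q + 1) = B₀ ^ (Q + 1) * (2 ^ (Q + 1)) ^ n := by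
          rw [Real.mul_rpow hB.le (by positivity)]
          congr 1
          rw [← Real.rpow_natCast, ← Real.rpow_natCast, ← Real.rpow_mul zero_le_two,
            ← Real.rpow_mul zero_le_two, mul_comm]
        have e3 : D ^ n = ((2 ^ (Q + 1)) ^ n) ^ r := by
          rw [hD, ← Real.rpow_natCast ((2 : ℝ) ^ (Q + 1)) n, ← Real.rpow_natCast _ n,
            ← Real.rpow_mul (by positivity), ← Real.rpow_mul (by positivity),
            ← Real.rpow_mul (by positivity)]
          congr 1; ring
        have e4 : (ε₀ * lam ^ n) ^ (1 + (e * r - 1)) = ((ε₀ * lam ^ n) ^ e) ^ r := by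
          rw [← Real.rpow_mul hZ.le]; congr 1; ring
        have hC0 : 0 ≤ C := by linarith
        rw [e2, e3, e4, hC', mul_assoc 2, mul_assoc 2, ← Real.mul_rpow (by positivity) (by positivity),
          ← Real.mul_rpow (by positivity) (by positivity)]
        congr 2; ring
      · have e1 : r₀ / 2 * (1 + x) - r₀ / 2 * (1 + x / 2) = r₀ * x / 4 := by ring
        rw [e1, div_le_iff₀ (by positivity), hB₀]
        have e2 : (13 + 32 * N / r₀) * 2 ^ n * (r₀ * x / 4) =
          13 * (r₀ / 4) * (x * 2 ^ n) + 8 * N * (x * 2 ^ n) := by field_simp; ring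
        rw [e2, hxi]; linarith
      · nlinarith
      · have : (B₀ * 2 ^ n - 1) * (2 - x + x / 4 - (2 - x)) = (B₀ * (x * 2 ^ n) - x) / 4 := by ring
        rw [this, hxi]; linarith
  apply h.le_of_lintegral_critFun_eq_zero hS.contDiff.continuous (r := r₀) (y := y) hr₀
  have hle : ∀ n : ℕ, ∫⁻ x in cube y r₀,
      ENNReal.ofReal (critFun N (p x) (q x) (a x) (max (u x - 2) 0)) ≤
      ENNReal.ofReal (ε₀ * lam ^ n) := by
    intro n
    have hx0 : 0 < (1 / 2 : ℝ) ^ n := by positivity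
    refine (lintegral_mono_set (cube_mono y (by nlinarith))).trans ((lintegral_mono ?_).trans (hiter n))
    intro x
    apply ENNReal.ofReal_le_ofReal
    exact critFun_mono (h.a_nonneg x) (le_max_right _ _) (max_le_max (by linarith) le_rfl)
      (h.critExp_fst_pos x).le (h.critExp_snd_pos x).le
  have hlim : Tendsto (fun n : ℕ => ENNReal.ofReal (ε₀ * lam ^ n)) atTop (nhds 0) := by
    have := (tendsto_pow_atTop_nhds_zero_of_lt_one hl0.le hl1).const_mul ε₀
    rw [mul_zero] at this
    simpa using ENNReal.tendsto_ofReal this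
  exact le_antisymm (ge_of_tendsto' hlim hle) bot_le

end

theorem exists_pos_le_mul_rpow_lt {C r ε : ℝ} (hC : 0 < C) (hr : 1 < r) (hε : 0 < ε) :
    ∃ τ : ℝ, 0 < τ ∧ τ ≤ ε ∧ C * τ ^ r < τ := by
  have hs : 0 < r - 1 := by linarith
  have h1 : 0 < (1 / (2 * C)) ^ (1 / (r - 1)) := by positivity
  refine ⟨min ε ((1 / (2 * C)) ^ (1 / (r - 1))), lt_min hε h1, min_le_left _ _, ?_⟩
  set τ := min ε ((1 / (2 * C)) ^ (1 / (r - 1))) with hτ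
  have h0 : 0 < τ := lt_min hε h1
  have h2 : τ ^ (r - 1) ≤ 1 / (2 * C) := by
    calc τ ^ (r - 1) ≤ ((1 / (2 * C)) ^ (1 / (r - 1))) ^ (r - 1) :=
          Real.rpow_le_rpow h0.le (min_le_right _ _) hs.le
      _ = 1 / (2 * C) := by
          rw [← Real.rpow_mul (by positivity), one_div_mul_cancel hs.ne', Real.rpow_one]
  have h3 : τ ^ r = τ * τ ^ (r - 1) := by
    rw [← Real.rpow_one_add' h0.le (by linarith)]; congr 1; ring
  have h4 : C * τ ^ (r - 1) ≤ 1 / 2 := by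
    rw [le_div_iff₀ (by positivity)] at h2; linarith
  rw [h3]
  nlinarith

section

variable {N : ℕ} {p q a : EuclideanSpace ℝ (Fin N) → ℝ} {p₀ q₁ A : ℝ} {K : NNReal}
  {u : EuclideanSpace ℝ (Fin N) → ℝ}

/-- If the gradient energy and the measure of `{u > 1}` in a cube are small, then so is the critical
energy above level `1`. -/
theorem PhaseBounds.exists_energy_small (h : PhaseBounds N p q a p₀ q₁ A K) {ℓ ε₀ : ℝ} (hℓ : 0 < ℓ)
    (hε₀ : 0 < ε₀) :
    ∃ η : ℝ, 0 < η ∧ ∀ u : EuclideanSpace ℝ (Fin N) → ℝ, ContDiff ℝ 1 u →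
      ∀ y : EuclideanSpace ℝ (Fin N),
      ∫⁻ x in cube y ℓ ∩ {x | 1 < u x}, ENNReal.ofReal (Hfun p q a x ‖gradient u x‖ + 1) ≤
        ENNReal.ofReal η →
      ∫⁻ x in cube y ℓ, ENNReal.ofReal (critFun N (p x) (q x) (a x) (max (u x - 1) 0)) ≤
        ENNReal.ofReal ε₀ := by
  have hN := h.two_le
  set c : ℝ := 2 * (gagConst N q₁ A K + 1 / ℓ) with hc
  have hg : 0 ≤ gagConst N q₁ A K :=
    gagConst_nonneg h.two_le h.q_lt h.one_le K.coe_nonneg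
  have hc0 : 0 < c := by positivity
  set r : ℝ := (N : ℝ) / (N - 1) with hr
  have hr1 : 1 < r := by rw [hr, lt_div_iff₀ (by linarith)]; linarith
  obtain ⟨τ, hτ0, hτε, hτ⟩ := exists_pos_le_mul_rpow_lt (C := 2 * (2 * c) ^ r) (by positivity) hr1 hε₀
  refine ⟨τ, hτ0, fun u hu y hη => ?_⟩
  have huc := hu.continuous
  have hcf : ∀ k : ℝ, Continuous fun x => critFun N (p x) (q x) (a x) (max (u x - k) 0) :=
    fun k => h.continuous_critFun (v := fun x => max (u x - k) 0) (by fun_prop)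
  have hnn : ∀ k x, 0 ≤ critFun N (p x) (q x) (a x) (max (u x - k) 0) := fun k x =>
    critFun_nonneg (h.a_nonneg x) (le_max_right _ _)
  have hfi : ∀ k : ℝ, IntegrableOn (fun x => critFun N (p x) (q x) (a x) (max (u x - k) 0))
      (cube y ℓ) := fun k =>
    ((hcf k).continuousOn.integrableOn_compact (isCompact_closedBall y (N * (ℓ / 2)))).mono_set
      (cube_subset_closedBall y ℓ)
  set Y : ℝ → ℝ := fun k => ∫ x in cube y ℓ, critFun N (p x) (q x) (a x) (max (u x - k) 0) with hY
  have hYeq : ∀ k, ∫⁻ x in cube y ℓ,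
      ENNReal.ofReal (critFun N (p x) (q x) (a x) (max (u x - k) 0)) = ENNReal.ofReal (Y k) :=
    fun k => (ofReal_integral_eq_lintegral_ofReal (hfi k) (Eventually.of_forall (hnn k))).symm
  have hYnn : ∀ k, 0 ≤ Y k := fun k => integral_nonneg (hnn k)
  have hYcont : ContinuousOn Y (Set.Ici 1) := by
    refine continuousOn_of_dominated (bound := fun x => critFun N (p x) (q x) (a x) (max (u x - 1) 0))
      (fun k _ => (hcf k).aestronglyMeasurable) ?_ (hfi 1) ?_
    · intro k hk
      refine Eventually.of_forall fun x => ?_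
      rw [Real.norm_of_nonneg (hnn k x)]
      exact critFun_mono (h.a_nonneg x) (le_max_right _ _)
        (max_le_max (by linarith [Set.mem_Ici.mp hk]) le_rfl)
        (h.critExp_fst_pos x).le (h.critExp_snd_pos x).le
    · refine Eventually.of_forall fun x => Continuous.continuousOn ?_
      have h1 := h.critExp_fst_pos x
      have h2 := h.critExp_snd_pos x
      unfold critFun
      have hm : Continuous fun k : ℝ => max (u x - k) 0 := by fun_prop
      exact (hm.rpow_const fun _ => Or.inr h1.le).add
        (continuous_const.mul (hm.rpow_const fun _ => Or.inr h2.le))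
  have hne : ∀ k, 1 ≤ k → Y k ≠ τ := by
    intro k hk hYk
    have hs := h.lintegral_critFun_le hu k y (μ := 1) (π := p₀) hℓ le_rfl le_rfl
      (fun x _ => h.le_p x)
    rw [hYeq, hYk] at hs
    have h1 : ∫⁻ x in cube y ℓ ∩ {x | k < u x}, ENNReal.ofReal (c * (1 * critFun N (p x) (q x) (a x)
        (max (u x - k) 0) + 1 ^ (-(p₀ - 1)) * Hfun p q a x ‖gradient u x‖ + 1)) ≤
        ENNReal.ofReal (2 * c * τ) := by
      calc _ ≤ ∫⁻ x in cube y ℓ ∩ {x | k < u x}, (ENNReal.ofReal c *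
            ENNReal.ofReal (critFun N (p x) (q x) (a x) (max (u x - k) 0)) +
            ENNReal.ofReal c * ENNReal.ofReal (Hfun p q a x ‖gradient u x‖ + 1)) := by
            refine lintegral_mono fun x => le_of_eq ?_
            have hH := h.Hfun_nonneg x (norm_nonneg (gradient u x))
            rw [← ENNReal.ofReal_mul hc0.le, ← ENNReal.ofReal_mul hc0.le, ← ENNReal.ofReal_add
              (mul_nonneg hc0.le (hnn k x)) (by positivity), Real.one_rpow]
            congr 1; ring
        _ = ENNReal.ofReal c * (∫⁻ x in cube y ℓ ∩ {x | k < u x},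
              ENNReal.ofReal (critFun N (p x) (q x) (a x) (max (u x - k) 0))) +
            ENNReal.ofReal c * ∫⁻ x in cube y ℓ ∩ {x | k < u x},
              ENNReal.ofReal (Hfun p q a x ‖gradient u x‖ + 1) := by
            rw [lintegral_add_left ((hcf k).measurable.ennreal_ofReal.const_mul _),
              lintegral_const_mul' _ _ ENNReal.ofReal_ne_top,
              lintegral_const_mul' _ _ ENNReal.ofReal_ne_top]
        _ ≤ ENNReal.ofReal c * ENNReal.ofReal τ + ENNReal.ofReal c * ENNReal.ofReal τ := by
            gcongr
            · refine (lintegral_mono_set Set.inter_subset_left).trans ?_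
              rw [hYeq, hYk]
            · refine (lintegral_mono_set ?_).trans hη
              exact Set.inter_subset_inter_right _ fun x hx => lt_of_le_of_lt hk hx
        _ = ENNReal.ofReal (2 * c * τ) := by
            rw [← ENNReal.ofReal_mul hc0.le, ← ENNReal.ofReal_add (by positivity) (by positivity)]
            congr 1; ring
    have h2 : ENNReal.ofReal τ ≤ ENNReal.ofReal (2 * (2 * c * τ) ^ r) := by
      refine hs.trans ?_
      rw [ENNReal.ofReal_mul zero_le_two, ← ENNReal.ofReal_rpow_of_nonneg (by positivity)
        (by linarith), ENNReal.ofReal_ofNat]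
      gcongr
    rw [ENNReal.ofReal_le_ofReal_iff (by positivity), Real.mul_rpow (by positivity) hτ0.le] at h2
    linarith
  obtain ⟨T, hT⟩ : ∃ T : ℝ, ∀ x ∈ cube y ℓ, u x ≤ T := by
    obtain ⟨T, hT⟩ := ((isCompact_closedBall y (N * (ℓ / 2))).image huc).bddAbove
    exact ⟨T, fun x hx => hT ⟨x, cube_subset_closedBall y ℓ hx, rfl⟩⟩
  have hYT : Y (max T 1) = 0 := by
    rw [hY]
    apply setIntegral_eq_zero_of_forall_eq_zero
    intro x hx
    have h1 : max (u x - max T 1) 0 = 0 :=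
      max_eq_right (by linarith [hT x hx, le_max_left T 1])
    rw [h1]
    unfold critFun
    rw [Real.zero_rpow (h.critExp_fst_pos x).ne', Real.zero_rpow (h.critExp_snd_pos x).ne']
    simp
  have hY1 : Y 1 < τ := by
    by_contra hge
    push Not at hge
    obtain ⟨k, hk, hkτ⟩ := intermediate_value_Icc' (le_max_right T 1)
      (hYcont.mono Set.Icc_subset_Ici_self) (show τ ∈ Set.Icc (Y (max T 1)) (Y 1) from
        ⟨by rw [hYT]; exact hτ0.le, hge⟩)
    exact hne k hk.1 hkτ
  rw [hYeq]
  exact ENNReal.ofReal_le_ofReal (hY1.le.trans hτε)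

end

section

variable {N : ℕ} {p q a ρ σ k d : EuclideanSpace ℝ (Fin N) → ℝ} {p₀ q₁ A M₁ M₂ M₃ L : ℝ} {K : NNReal}
  {u : EuclideanSpace ℝ (Fin N) → ℝ} {F : EuclideanSpace ℝ (Fin N) → EuclideanSpace ℝ (Fin N)}
  {G : EuclideanSpace ℝ (Fin N) → ℝ}

theorem PhaseBounds.add_mul_le_one (h : PhaseBounds N p q a p₀ q₁ A K) {c κ : ℝ} (hc : 0 < c)
    (x : EuclideanSpace ℝ (Fin N)) (hκ1 : 0 < κ) (hκ : κ ≤ critExp N (p x) / q x - c) :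
    ((N - p x) / N + c * ((N - q₁) / N) ^ 2) * κ ≤ 1 := by
  have hN : (0 : ℝ) < N := by linarith [h.two_le]
  have hp := h.one_lt_p x
  have hpN := h.p_lt x
  have hpq := h.p_le_q x
  have hq := h.q_le x
  have hqN := h.q_lt
  set X : ℝ := (N - p x) / N with hX
  have hX0 : 0 < X := div_pos (by linarith) hN
  have h1 : critExp N (p x) / q x ≤ 1 / X := by
    rw [critExp, hX, one_div_div, div_div, div_le_div_iff₀ (mul_pos (by linarith) (by linarith))
      (by linarith)]
    nlinarith [mul_nonneg hN.le (mul_nonneg (sub_nonneg.mpr hpN.le) (sub_nonneg.mpr hpq))]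
  have h2 : ((N - q₁) / N) ^ 2 ≤ X ^ 2 := by
    apply pow_le_pow_left₀ (div_nonneg (by linarith) hN.le)
    rw [hX]; gcongr; linarith
  have h3 : X * (1 / X) = 1 := by field_simp
  calc (X + c * ((N - q₁) / N) ^ 2) * κ ≤ (X + c * X ^ 2) * (1 / X - c) := by
        apply mul_le_mul _ (by linarith) hκ1.le (by positivity)
        gcongr
    _ = X * (1 / X) + c * X * (X * (1 / X)) - c * X - c ^ 2 * X ^ 2 := by ring
    _ ≤ 1 := by rw [h3]; nlinarith [sq_nonneg (c * X)]

/-- Subcriticality of `ρ`, `σ` leaves room, on small cubes, for a common superlinear exponent. -/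
theorem PhaseBounds.exists_exponents (h : PhaseBounds N p q a p₀ q₁ A K) {c : ℝ} (hc : 0 < c)
    (hρ : ∀ x, 1 < ρ x) (hσ : ∀ x, 1 < σ x)
    (hκ : ∀ x, max (ρ x) (σ x) ≤ critExp N (p x) / q x - c) :
    ∃ r₀ e : ℝ, 0 < r₀ ∧ r₀ ≤ 1 / 2 ∧ 1 < e * ((N : ℝ) / (N - 1)) ∧
      ∀ y, ∃ θ τ π : ℝ, θ ≤ 1 ∧ (∀ x ∈ cube y (2 * r₀), θ * ρ x ≤ 1 ∧ θ * σ x ≤ 1) ∧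
        (∀ x ∈ cube y (2 * r₀), π ≤ p x) ∧ 0 ≤ τ ∧ e ≤ 1 - τ ∧ e ≤ θ + τ * (π - 1) := by
  have hN2 := h.two_le
  have hN : (0 : ℝ) < N := by linarith
  have hqN := h.q_lt
  set c' : ℝ := c * ((N - q₁) / N) ^ 2 with hc'
  have hc'0 : 0 < c' := mul_pos hc (pow_pos (div_pos (by linarith) hN) 2)
  set t : ℝ := min (c' / (4 * N)) (1 / N) with ht
  have ht0 : 0 < t := lt_min (by positivity) (by positivity)
  have htc : t * N ≤ c' / 4 := by
    calc t * N ≤ c' / (4 * N) * N := by gcongr; exact min_le_left _ _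
      _ = c' / 4 := by field_simp
  have htN : t ≤ 1 / N := min_le_right _ _
  have hK := K.coe_nonneg
  set r₀ : ℝ := min (1 / 2) (c' / (4 * (K + 1))) with hr
  have hr0 : 0 < r₀ := lt_min (by norm_num) (by positivity)
  have hrK : K * r₀ ≤ c' / 4 := by
    calc K * r₀ ≤ (K + 1) * (c' / (4 * (K + 1))) := by
          gcongr
          · linarith
          · exact min_le_right _ _
      _ = c' / 4 := by field_simp
  have hp_osc : ∀ y, ∀ x ∈ cube y (2 * r₀), |p x - p y| ≤ N * (c' / 4) := by
    intro y x hx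
    have h1 := h.lip_p.dist_le_mul x y
    have h2 : dist x y ≤ N * (2 * r₀ / 2) := cube_subset_closedBall y _ hx
    rw [Real.dist_eq] at h1
    calc |p x - p y| ≤ K * dist x y := h1
      _ ≤ K * (N * (2 * r₀ / 2)) := by gcongr
      _ = N * (K * r₀) := by ring
      _ ≤ _ := by gcongr
  refine ⟨r₀, 1 - 1 / N + t, hr0, min_le_left _ _, ?_, fun y => ?_⟩
  · have h1 : (1 - 1 / (N : ℝ) + t) * (N / (N - 1)) = 1 + t * N / (N - 1) := by
      have : (N : ℝ) - 1 ≠ 0 := by linarith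
      field_simp
    rw [h1]
    have : 0 < t * N / (N - 1) := div_pos (by positivity) (by linarith)
    linarith
  have hbound : ∀ x ∈ cube y (2 * r₀), (N - p y) / N + 3 * c' / 4 ≤ (N - p x) / N + c' := by
    intro x hx
    have h1 := (abs_le.mp (hp_osc y x hx)).2
    have h2 : (p x - p y) / N ≤ c' / 4 := by rw [div_le_iff₀ hN]; linarith
    have h3 : (N - p y) / N - (N - p x) / N = (p x - p y) / N := by ring
    linarith
  have hmul : ∀ x ∈ cube y (2 * r₀), ∀ κ, 1 < κ → κ ≤ critExp N (p x) / q x - c →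
      ((N - p y) / N + 3 * c' / 4) * κ ≤ 1 := fun x hx κ hκ1 hκ2 =>
    (mul_le_mul_of_nonneg_right (hbound x hx) (by linarith)).trans
      (h.add_mul_le_one hc x (by linarith) hκ2)
  have hyy : y ∈ cube y (2 * r₀) := mem_cube_self y (by linarith)
  refine ⟨(N - p y) / N + 3 * c' / 4, 1 / N - t, p y - N * (c' / 4), ?_, ?_, ?_, by linarith,
    by linarith, ?_⟩
  · have h1 := hmul y hyy (ρ y) (hρ y) ((le_max_left _ _).trans (hκ y))
    have h2 := hρ y
    have h3 : 0 < (N - p y) / N := div_pos (by linarith [h.p_lt y]) hN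
    nlinarith
  · exact fun x hx => ⟨hmul x hx _ (hρ x) ((le_max_left _ _).trans (hκ x)),
      hmul x hx _ (hσ x) ((le_max_right _ _).trans (hκ x))⟩
  · intro x hx
    linarith [(abs_le.mp (hp_osc y x hx)).1]
  · have h1 : (N - p y) / N + 3 * c' / 4 + (1 / N - t) * (p y - N * (c' / 4) - 1) =
        1 - 1 / N + c' / 2 - t * (p y - N * (c' / 4) - 1) := by
      field_simp
      ring
    rw [h1]
    have h2 : t * (p y - N * (c' / 4) - 1) ≤ t * (N - 1) := by
      apply mul_le_mul_of_nonneg_left _ ht0.le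
      have := h.p_lt y
      have : 0 ≤ N * (c' / 4) := by positivity
      linarith
    linarith

/-- Finite gradient energy and finite measure of `{u > 1}` bound a subsolution from above. -/
theorem CritSubsolution.bddAbove (h : PhaseBounds N p q a p₀ q₁ A K)
    (hS : CritSubsolution N p q a ρ σ k d M₁ M₂ M₃ L u F G) {c Mw : ℝ} (hc : 0 < c)
    (hκ : ∀ x, max (ρ x) (σ x) ≤ critExp N (p x) / q x - c)
    (hw : ∀ y, ∫⁻ x in cube y 1, ENNReal.ofReal (dataWeight ρ σ k d x) ≤ ENNReal.ofReal Mw)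
    (hE : ∫⁻ x, ENNReal.ofReal (Hfun p q a x ‖gradient u x‖) < ⊤)
    (hvol : volume {x | 1 < u x} < ⊤) : ∃ C, ∀ x, u x ≤ C := by
  have huc := hS.contDiff.continuous
  obtain ⟨r₀, e, hr0, hr1, he, hexp⟩ := h.exists_exponents hc hS.one_lt_ρ hS.one_lt_σ hκ
  obtain ⟨ε₀, hε0, hsmall⟩ := hS.exists_smallness h hr0 hr1 he (le_max_right Mw 0)
    (fun y => (hw y).trans (ENNReal.ofReal_le_ofReal (le_max_left _ _)))
  obtain ⟨η, hη0, hη⟩ := h.exists_energy_small (ℓ := 2 * r₀) (by linarith) hε0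
  set g : EuclideanSpace ℝ (Fin N) → ℝ≥0∞ := fun x =>
    ENNReal.ofReal (Hfun p q a x ‖gradient u x‖) + {x | 1 < u x}.indicator 1 x with hg
  have hopen : MeasurableSet {x | 1 < u x} := (isOpen_lt continuous_const huc).measurableSet
  have hHm : Measurable fun x => ENNReal.ofReal (Hfun p q a x ‖gradient u x‖) :=
    (h.continuous_Hfun (continuous_gradient hS.contDiff).norm).measurable.ennreal_ofReal
  have hgm : Measurable g := hHm.add (measurable_one.indicator hopen)
  have hgfin : ∫⁻ x, g x ≠ ⊤ := by
    rw [hg, lintegral_add_left hHm, lintegral_indicator_one hopen]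
    exact (ENNReal.add_lt_top.mpr ⟨hE, hvol⟩).ne
  have htail : Tendsto (fun n : ℕ => ∫⁻ x in (Metric.closedBall 0 (n : ℝ))ᶜ, g x) atTop (nhds 0) := by
    have hms : ∀ n : ℕ, MeasurableSet (Metric.closedBall (0 : EuclideanSpace ℝ (Fin N)) (n : ℝ))ᶜ :=
      fun n => Metric.isClosed_closedBall.measurableSet.compl
    have h1 := tendsto_measure_iInter_atTop (μ := volume.withDensity g)
      (s := fun n : ℕ => (Metric.closedBall (0 : EuclideanSpace ℝ (Fin N)) (n : ℝ))ᶜ)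
      (fun n => (hms n).nullMeasurableSet)
      (fun m n hmn => Set.compl_subset_compl.mpr
        (Metric.closedBall_subset_closedBall (by exact_mod_cast hmn)))
      ⟨0, by
        rw [withDensity_apply _ (hms 0)]
        exact ne_top_of_le_ne_top hgfin (setLIntegral_le_lintegral _ _)⟩
    rw [← Set.compl_iUnion, Metric.iUnion_closedBall_nat, Set.compl_univ, measure_empty] at h1
    exact h1.congr fun n => withDensity_apply _ (hms n)
  obtain ⟨n, hn⟩ := ((ENNReal.tendsto_nhds_zero.mp htail) (ENNReal.ofReal η)
    (by simpa using hη0)).exists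
  have hfar : ∀ y, n + N * r₀ < ‖y‖ → u y ≤ 2 := by
    intro y hy
    obtain ⟨θ, τ, π, h1, h2, h3, h4, h5, h6⟩ := hexp y
    refine hsmall y θ τ π h1 h2 h3 h4 h5 h6 (hη u hS.contDiff y ?_)
    calc _ ≤ ∫⁻ x in cube y (2 * r₀) ∩ {x | 1 < u x}, g x := by
          refine setLIntegral_mono hgm fun x hx => ?_
          have h1 : {x | 1 < u x}.indicator (1 : EuclideanSpace ℝ (Fin N) → ℝ≥0∞) x = 1 :=
            Set.indicator_of_mem hx.2 _
          simp only [hg]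
          rw [h1, ENNReal.ofReal_add (h.Hfun_nonneg x (norm_nonneg _)) zero_le_one,
            ENNReal.ofReal_one]
      _ ≤ ∫⁻ x in (Metric.closedBall 0 (n : ℝ))ᶜ, g x := by
          refine lintegral_mono_set fun x hx => ?_
          have h2 : dist x y ≤ N * (2 * r₀ / 2) := cube_subset_closedBall y _ hx.1
          have h3 : ‖y‖ ≤ ‖x‖ + dist x y := by
            rw [dist_eq_norm]
            calc ‖y‖ = ‖x - (x - y)‖ := by congr 1; abel
              _ ≤ _ := norm_sub_le _ _
          simp only [Set.mem_compl_iff, Metric.mem_closedBall, dist_zero_right, not_le]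
          linarith
      _ ≤ _ := hn
  obtain ⟨T, hT⟩ := ((isCompact_closedBall (0 : EuclideanSpace ℝ (Fin N)) (n + N * r₀)).image
    huc).bddAbove
  refine ⟨max T 2, fun y => ?_⟩
  by_cases hy : n + N * r₀ < ‖y‖
  · exact (hfar y hy).trans (le_max_right _ _)
  · exact (hT ⟨y, by simpa using hy, rfl⟩).trans (le_max_left _ _)

end

theorem abs_rpow_mul_self_eq (t : ℝ) {r : ℝ} (hr : 1 < r) :
    |t| ^ (r - 2) * t = max t 0 ^ (r - 1) - max (-t) 0 ^ (r - 1) := by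
  have h0 : (0 : ℝ) ^ (r - 1) = 0 := Real.zero_rpow (by linarith)
  have h1 : ∀ s : ℝ, 0 < s → s ^ (r - 2) * s = s ^ (r - 1) := fun s hs => by
    rw [← Real.rpow_add_one hs.ne']; congr 1; ring
  rcases lt_trichotomy t 0 with ht | ht | ht
  · rw [abs_of_neg ht, max_eq_right ht.le, max_eq_left (by linarith), h0, ← h1 _ (neg_pos.mpr ht)]
    ring
  · subst ht; simp [h0]
  · rw [abs_of_pos ht, max_eq_left ht.le, max_eq_right (by linarith), h0, h1 _ ht, sub_zero]

section

variable {N : ℕ} {p q a ρ σ k d V : EuclideanSpace ℝ (Fin N) → ℝ} {p₀ q₁ A M₁ M₂ M₃ L : ℝ}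
  {K : NNReal} {u : EuclideanSpace ℝ (Fin N) → ℝ}

theorem continuous_abs_rpow_mul_self {r : EuclideanSpace ℝ (Fin N) → ℝ} (hu : Continuous u)
    (hr : Continuous r) (hr1 : ∀ x, 1 < r x) : Continuous fun x => |u x| ^ (r x - 2) * u x := by
  simp only [fun x => abs_rpow_mul_self_eq (u x) (hr1 x)]
  have h1 : ∀ x, 0 < r x - 1 := fun x => by linarith [hr1 x]
  exact ((hu.max continuous_const).rpow (hr.sub continuous_const) fun x => Or.inr (h1 x)).sub
    ((hu.neg.max continuous_const).rpow (hr.sub continuous_const) fun x => Or.inr (h1 x))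

theorem locallyIntegrable_of_lintegral_cube {s g : EuclideanSpace ℝ (Fin N) → ℝ} {M : ℝ}
    (hk : Measurable k) (hs : ∀ x, 1 ≤ s x) (hg : ∀ x, |k x| ^ s x ≤ g x)
    (h : ∀ y, ∫⁻ x in cube y 1, ENNReal.ofReal (g x) ≤ ENNReal.ofReal M) :
    LocallyIntegrable k volume := by
  intro y
  refine ⟨cube y 1, (isOpen_cube y 1).mem_nhds (mem_cube_self y one_pos), hk.aestronglyMeasurable, ?_⟩
  have hle : ∀ x, ‖k x‖ₑ ≤ 1 + ENNReal.ofReal (g x) := by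
    intro x
    have h1 : |k x| ≤ 1 + g x := by
      rcases le_total |k x| 1 with h1 | h1
      · have : 0 ≤ |k x| ^ s x := by positivity
        linarith [hg x]
      · linarith [Real.self_le_rpow_of_one_le h1 (hs x), hg x]
    rw [← ofReal_norm, Real.norm_eq_abs, ← ENNReal.ofReal_one]
    exact (ENNReal.ofReal_le_ofReal h1).trans ENNReal.ofReal_add_le
  calc ∫⁻ x in cube y 1, ‖k x‖ₑ ≤ ∫⁻ x in cube y 1, (1 + ENNReal.ofReal (g x)) := lintegral_mono hle
    _ = volume (cube y 1) + ∫⁻ x in cube y 1, ENNReal.ofReal (g x) := by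
        rw [lintegral_add_left measurable_const, lintegral_one, Measure.restrict_apply_univ]
    _ < ⊤ := by
        refine ENNReal.add_lt_top.mpr ⟨?_, (h y).trans_lt ENNReal.ofReal_lt_top⟩
        exact (measure_mono (cube_subset_closedBall y 1)).trans_lt measure_closedBall_lt_top

theorem LocallyIntegrable.of_norm_le {E : Type*} [NormedAddCommGroup E]
    {f : EuclideanSpace ℝ (Fin N) → E} {g : EuclideanSpace ℝ (Fin N) → ℝ} {M : ℝ}
    (hk : LocallyIntegrable k volume) (hg : Continuous g)
    (hf : AEStronglyMeasurable f volume) (hle : ∀ᵐ x, ‖f x‖ ≤ M * (|k x| + g x)) :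
    LocallyIntegrable f volume := by
  have h0 : LocallyIntegrable (fun x => |k x|) volume :=
    hk.mono hk.aestronglyMeasurable.norm (Eventually.of_forall fun x => by simp)
  have h1 : LocallyIntegrable (fun x => M * (|k x| + g x)) volume :=
    (h0.add hg.locallyIntegrable).smul M
  exact h1.mono hf (hle.mono fun x hx => hx.trans (le_abs_self _))

theorem gradient_neg_eq (u : EuclideanSpace ℝ (Fin N) → ℝ) (x : EuclideanSpace ℝ (Fin N)) :
    gradient (fun x => -u x) x = -gradient u x := by
  unfold gradient
  rw [fderiv_fun_neg, map_neg]

theorem CondO.exists_phaseBounds (hO : CondO N p q a V) :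
    ∃ p₀ q₁ A K, PhaseBounds N p q a p₀ q₁ A K := by
  obtain ⟨K₁, h1⟩ := hO.lip_p
  obtain ⟨K₂, h2⟩ := hO.lip_q
  obtain ⟨K₃, h3⟩ := hO.lip_a
  obtain ⟨p₀, hp₀, hp⟩ := hO.inf_p
  obtain ⟨q₁, hq₁, hq⟩ := hO.sup_q
  obtain ⟨C, hC⟩ := hO.a_bdd
  obtain ⟨κ, hκ, hr⟩ := hO.ratio
  refine ⟨p₀, q₁, max C 1, K₁ + K₂ + K₃, ?_, hp₀, hp, fun x => (hO.p_lt_q x).le, hq, hq₁,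
    h1.weaken (by rw [add_assoc]; exact le_self_add),
    h2.weaken (by rw [add_right_comm]; exact le_add_self),
    h3.weaken le_add_self, hO.a_nonneg, fun x => (hC x).trans (le_max_left _ _), le_max_right _ _, ?_⟩
  · have h : (1 : ℝ) < N := by
      linarith [hp 0, hO.p_lt_q 0, hO.q_lt_N 0]
    have : 1 < N := by exact_mod_cast h
    exact_mod_cast this
  · intro x
    have hpx : 0 < p x := by linarith [hp x]
    have := hr x
    rw [div_le_iff₀ hpx] at this
    exact this.trans (by gcongr)

theorem volume_lt_top_of_rhoV (h : PhaseBounds N p q a p₀ q₁ A K) (hO : CondO N p q a V)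
    (hu : Continuous u) (hfin : rhoV p q a V u < ⊤) : volume {x | 1 < |u x|} < ⊤ := by
  have hlow : ∀ x, 1 < |u x| → 1 ≤ Hfun p q a x |u x| := by
    intro x hx
    have h1 : 1 ≤ |u x| ^ p x := Real.one_le_rpow hx.le (by linarith [h.one_lt_p x])
    have h2 : 0 ≤ a x * |u x| ^ q x := mul_nonneg (h.a_nonneg x) (by positivity)
    unfold Hfun; linarith
  have key : ∀ (κ : ℝ) (Z : Set (EuclideanSpace ℝ (Fin N))), 0 < κ → volume Z < ⊤ →
      (∀ᵐ x, x ∉ Z → κ ≤ V x) → volume {x | 1 < |u x|} < ⊤ := by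
    intro κ Z hκ hZ hV
    have hκ' : ENNReal.ofReal κ ≠ 0 := by simpa using hκ
    have hB : volume ({x | 1 < |u x|} \ toMeasurable volume Z) < ⊤ := by
      have hm : MeasurableSet ({x | 1 < |u x|} \ toMeasurable volume Z) :=
        (isOpen_lt continuous_const hu.abs).measurableSet.diff (measurableSet_toMeasurable _ _)
      have h1 : ENNReal.ofReal κ * volume ({x | 1 < |u x|} \ toMeasurable volume Z) ≤
          rhoV p q a V u := by
        rw [← setLIntegral_const]
        refine (setLIntegral_mono_ae' hm ?_).trans (setLIntegral_le_lintegral _ _)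
        filter_upwards [hV] with x hx hxm
        have hxV : κ ≤ V x := hx fun hxZ => hxm.2 (subset_toMeasurable _ _ hxZ)
        refine le_add_of_le_right (ENNReal.ofReal_le_ofReal ?_)
        have := hlow x hxm.1
        nlinarith
      exact ENNReal.lt_top_of_mul_ne_top_right (h1.trans_lt hfin).ne hκ'
    refine (measure_mono ?_).trans_lt ((measure_union_le (toMeasurable volume Z) _).trans_lt
      (ENNReal.add_lt_top.mpr ⟨by rwa [measure_toMeasurable], hB⟩))
    intro x hx
    by_cases hxZ : x ∈ toMeasurable volume Z
    · exact Or.inl hxZ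
    · exact Or.inr ⟨hx, hxZ⟩
  rcases hO.V_alt with ⟨K₀, hK₀, -, hvol⟩ | ⟨R, hR, hess⟩
  · exact key K₀ _ hK₀ hvol (Eventually.of_forall fun x hx => (not_le.mp hx).le)
  · rw [essInf, Filter.liminf_eq] at hess
    obtain ⟨κ, hκ, hκ0⟩ : ∃ κ ∈ {b : ℝ | ∀ᵐ x ∂(volume.restrict
        {x : EuclideanSpace ℝ (Fin N) | R ≤ ‖x‖}), b ≤ V x}, 0 < κ := by
      refine exists_lt_of_lt_csSup ?_ hess
      by_contra hne
      rw [Set.not_nonempty_iff_eq_empty] at hne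
      rw [hne, Real.sSup_empty] at hess
      exact lt_irrefl _ hess
    refine key κ (Metric.ball 0 R) hκ0 measure_ball_lt_top ?_
    have hms : MeasurableSet {x : EuclideanSpace ℝ (Fin N) | R ≤ ‖x‖} :=
      (isClosed_le continuous_const continuous_norm).measurableSet
    have h2 := (ae_restrict_iff' hms).mp hκ
    filter_upwards [h2] with x hx hxb
    exact hx (by simpa using hxb)

end

section

variable {N : ℕ} {p q a : EuclideanSpace ℝ (Fin N) → ℝ} {p₀ q₁ A : ℝ}
  {K : NNReal} {u : EuclideanSpace ℝ (Fin N) → ℝ}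

/-- The part of the growth bounds that is continuous in `x` along a `C¹` function. -/
theorem PhaseBounds.continuous_growth (h : PhaseBounds N p q a p₀ q₁ A K) (hu : ContDiff ℝ 1 u)
    {s t b : EuclideanSpace ℝ (Fin N) → ℝ} (hs : Continuous s) (ht : Continuous t)
    (hb : Continuous b) (hs0 : ∀ x, 0 < s x) (ht0 : ∀ x, 0 < t x) :
    Continuous fun x => |u x| ^ (critExp N (p x) - 1) +
      a x ^ (critExp N (q x) / q x) * |u x| ^ (critExp N (q x) - 1) +
      ‖gradient u x‖ ^ s x + b x * ‖gradient u x‖ ^ t x := by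
  have hg := (continuous_gradient hu).norm
  have huc := hu.continuous.abs
  have h1 : ∀ x, 0 < critExp N (p x) - 1 := fun x => by
    linarith [lt_critExp (h.one_lt_p x) (h.p_lt x), h.one_lt_p x]
  have h2 : ∀ x, 0 < critExp N (q x) - 1 := fun x => by
    linarith [lt_critExp (h.one_lt_q x) (h.q_lt_dim x), h.one_lt_q x]
  exact (((huc.rpow (h.continuous_critExp_fst.sub continuous_const) fun x => Or.inr (h1 x)).add
    (h.continuous_rpow_critExp.mul
      (huc.rpow (h.continuous_critExp_snd.sub continuous_const) fun x => Or.inr (h2 x)))).add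
    (hg.rpow hs fun x => Or.inr (hs0 x))).add (hb.mul (hg.rpow ht fun x => Or.inr (ht0 x)))

end

/-- **Global boundedness, critical case, solutions in `X_V`.**
Under (O) and (H₂), every weak solution `u ∈ X_V` of the generalized
Schrödinger-type double phase problem with critical growth belongs to `L^∞(ℝ^N)`. -/
theorem stmt14 {N : ℕ} (p q a V : EuclideanSpace ℝ (Fin N) → ℝ) (hO : CondO N p q a V)
    (𝒜 : EuclideanSpace ℝ (Fin N) → ℝ → EuclideanSpace ℝ (Fin N) → EuclideanSpace ℝ (Fin N))
    (ℬ : EuclideanSpace ℝ (Fin N) → ℝ → EuclideanSpace ℝ (Fin N) → ℝ)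
    -- (H₂): Carathéodory conditions
    (h𝒜meas : ∀ (t : ℝ) (ξ : EuclideanSpace ℝ (Fin N)), Measurable fun x => 𝒜 x t ξ)
    (h𝒜cont : ∀ x, Continuous fun tξ : ℝ × EuclideanSpace ℝ (Fin N) => 𝒜 x tξ.1 tξ.2)
    (hℬmeas : ∀ (t : ℝ) (ξ : EuclideanSpace ℝ (Fin N)), Measurable fun x => ℬ x t ξ)
    (hℬcont : ∀ x, Continuous fun tξ : ℝ × EuclideanSpace ℝ (Fin N) => ℬ x tξ.1 tξ.2)
    -- (H₂): the exponents ρ, σ with κ = max{ρ,σ} ≪ p*/q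
    (ρ σ : EuclideanSpace ℝ (Fin N) → ℝ)
    (hρlip : ∃ K : NNReal, LipschitzWith K ρ) (hσlip : ∃ K : NNReal, LipschitzWith K σ)
    (hρbdd : ∃ C : ℝ, ∀ x, ρ x ≤ C) (hσbdd : ∃ C : ℝ, ∀ x, σ x ≤ C)
    (hρ1 : ∃ c > (1 : ℝ), ∀ x, c ≤ ρ x) (hσ1 : ∃ c > (1 : ℝ), ∀ x, c ≤ σ x)
    (hκ : ∃ c > (0 : ℝ), ∀ x, c ≤ N * p x / (N - p x) / q x - max (ρ x) (σ x))
    -- (H₂): the weights k, d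
    (k d : EuclideanSpace ℝ (Fin N) → ℝ) (hkmeas : Measurable k) (hdmeas : Measurable d)
    (hkd : ∃ M : ℝ, ∀ y : EuclideanSpace ℝ (Fin N),
      (∫⁻ x in cube y 1, ENNReal.ofReal
        (|k x| ^ (ρ x / (ρ x - 1)) + |d x| ^ (σ x / (σ x - 1)))) ≤ ENNReal.ofReal M)
    -- (H₂): critical growth/coercivity conditions
    (M₁ M₂ M₃ L : ℝ) (hM₁ : 0 < M₁) (hM₂ : 0 < M₂) (hM₃ : 0 < M₃) (hL : 0 < L)
    (hgrowthA : ∀ᵐ x ∂(volume : Measure (EuclideanSpace ℝ (Fin N))),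
      ∀ (t : ℝ) (ξ : EuclideanSpace ℝ (Fin N)),
        ‖𝒜 x t ξ‖ ≤ M₁ * (|k x| + |t| ^ (N * p x / (N - p x) - 1) +
          a x ^ ((N * q x / (N - q x)) / q x) * |t| ^ (N * q x / (N - q x) - 1) +
          ‖ξ‖ ^ (p x - 1) + a x * ‖ξ‖ ^ (q x - 1)))
    (hcoerciveA : ∀ᵐ x ∂(volume : Measure (EuclideanSpace ℝ (Fin N))),
      ∀ (t : ℝ) (ξ : EuclideanSpace ℝ (Fin N)),
        M₂ * (‖ξ‖ ^ p x + a x * ‖ξ‖ ^ q x) -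
          M₃ * (|t| ^ (N * p x / (N - p x)) +
            a x ^ ((N * q x / (N - q x)) / q x) * |t| ^ (N * q x / (N - q x)) + 1) ≤
          @inner ℝ _ _ (𝒜 x t ξ) ξ)
    (hgrowthB : ∀ᵐ x ∂(volume : Measure (EuclideanSpace ℝ (Fin N))),
      ∀ (t : ℝ) (ξ : EuclideanSpace ℝ (Fin N)),
        |ℬ x t ξ| ≤ L * (|d x| + |t| ^ (N * p x / (N - p x) - 1) +
          a x ^ ((N * q x / (N - q x)) / q x) * |t| ^ (N * q x / (N - q x) - 1) +
          ‖ξ‖ ^ (p x / ((N * p x / (N - p x)) / (N * p x / (N - p x) - 1))) +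
          a x ^ ((N + 1) / (N : ℝ)) *
            ‖ξ‖ ^ (q x / ((N * q x / (N - q x)) / (N * q x / (N - q x) - 1)))))
    :
    ∀ u : EuclideanSpace ℝ (Fin N) → ℝ, ContDiff ℝ 1 u →
      -- u ∈ X_V : finite modular and approximable by C_c^∞ functions in the norm of ρ_V
      rhoV p q a V u < ⊤ →
      (∃ φ : ℕ → EuclideanSpace ℝ (Fin N) → ℝ,
        (∀ n, ContDiff ℝ (⊤ : ℕ∞) (φ n) ∧ HasCompactSupport (φ n)) ∧
        Tendsto (fun n => VNorm p q a V fun x => u x - φ n x) atTop (nhds 0)) →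
      -- u is a weak solution
      (∀ φ : EuclideanSpace ℝ (Fin N) → ℝ, ContDiff ℝ (⊤ : ℕ∞) φ → HasCompactSupport φ →
        (∫ x, @inner ℝ _ _ (𝒜 x (u x) (gradient u x)) (gradient φ x)) +
          (∫ x, V x * ((|u x| ^ (p x - 2) * u x + a x * |u x| ^ (q x - 2) * u x) * φ x)) =
          ∫ x, ℬ x (u x) (gradient u x) * φ x) →
      -- conclusion: u ∈ L^∞(ℝ^N)
      eLpNorm u ⊤ volume < ⊤ := by
  intro u hu hfin _ hweak
  obtain ⟨p₀, q₁, A, K, h⟩ := hO.exists_phaseBounds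
  obtain ⟨c, hc, hκ⟩ := hκ
  obtain ⟨Mw, hw⟩ := hkd
  obtain ⟨cρ, hcρ, hρ⟩ := hρ1
  obtain ⟨cσ, hcσ, hσ⟩ := hσ1
  have hρ1 : ∀ x, 1 < ρ x := fun x => hcρ.trans_le (hρ x)
  have hσ1 : ∀ x, 1 < σ x := fun x => hcσ.trans_le (hσ x)
  have hmax : ∀ x, max (ρ x) (σ x) ≤ critExp N (p x) / q x - c := fun x => by
    have := hκ x
    unfold critExp
    linarith
  have hle : ∀ x, max (ρ x) (σ x) ≤ critExp N (p x) := fun x => by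
    have h1 : critExp N (p x) / q x ≤ critExp N (p x) :=
      div_le_self (h.critExp_fst_pos x).le (h.one_lt_q x).le
    linarith [hmax x]
  have huc := hu.continuous
  have hgc := continuous_gradient hu
  set F : EuclideanSpace ℝ (Fin N) → EuclideanSpace ℝ (Fin N) :=
    fun x => 𝒜 x (u x) (gradient u x) with hF
  set B : EuclideanSpace ℝ (Fin N) → ℝ := fun x => ℬ x (u x) (gradient u x) with hB
  set w : EuclideanSpace ℝ (Fin N) → ℝ :=
    fun x => |u x| ^ (p x - 2) * u x + a x * |u x| ^ (q x - 2) * u x with hwdef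
  set G : EuclideanSpace ℝ (Fin N) → ℝ := fun x => V x * w x - B x with hG
  have harg : Measurable fun x => ((u x, gradient u x), x) :=
    (huc.measurable.prodMk hgc.measurable).prodMk measurable_id
  have hFm : Measurable F := (measurable_uncurry_of_continuous_of_measurable
    (u := fun (tξ : ℝ × EuclideanSpace ℝ (Fin N)) x => 𝒜 x tξ.1 tξ.2) h𝒜cont
    fun tξ => h𝒜meas tξ.1 tξ.2).comp harg
  have hBm : Measurable B := (measurable_uncurry_of_continuous_of_measurable
    (u := fun (tξ : ℝ × EuclideanSpace ℝ (Fin N)) x => ℬ x tξ.1 tξ.2) hℬcont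
    fun tξ => hℬmeas tξ.1 tξ.2).comp harg
  have hconj : ∀ r : ℝ, 1 < r → 1 ≤ r / (r - 1) := fun r hr => by
    rw [le_div_iff₀ (by linarith)]; linarith
  have hk : LocallyIntegrable k volume := locallyIntegrable_of_lintegral_cube hkmeas
    (fun x => hconj _ (hρ1 x)) (fun x => le_add_of_nonneg_right (by positivity)) hw
  have hd : LocallyIntegrable d volume := locallyIntegrable_of_lintegral_cube hdmeas
    (fun x => hconj _ (hσ1 x)) (fun x => le_add_of_nonneg_left (by positivity)) hw
  have hpc := h.lip_p.continuous
  have hqc := h.lip_q.continuous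
  have hcp : ∀ x, 1 < critExp N (p x) := fun x =>
    (h.one_lt_p x).trans (lt_critExp (h.one_lt_p x) (h.p_lt x))
  have hcq : ∀ x, 1 < critExp N (q x) := fun x =>
    (h.one_lt_q x).trans (lt_critExp (h.one_lt_q x) (h.q_lt_dim x))
  have hFg : ∀ᵐ x, ‖F x‖ ≤ M₁ * (|k x| + |u x| ^ (critExp N (p x) - 1) +
      a x ^ (critExp N (q x) / q x) * |u x| ^ (critExp N (q x) - 1) +
      ‖gradient u x‖ ^ (p x - 1) + a x * ‖gradient u x‖ ^ (q x - 1)) :=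
    hgrowthA.mono fun x hx => hx (u x) (gradient u x)
  have hBg : ∀ᵐ x, |B x| ≤ L * (|d x| + |u x| ^ (critExp N (p x) - 1) +
      a x ^ (critExp N (q x) / q x) * |u x| ^ (critExp N (q x) - 1) +
      ‖gradient u x‖ ^ (p x / (critExp N (p x) / (critExp N (p x) - 1))) +
      a x ^ (((N : ℝ) + 1) / N) *
        ‖gradient u x‖ ^ (q x / (critExp N (q x) / (critExp N (q x) - 1)))) :=
    hgrowthB.mono fun x hx => hx (u x) (gradient u x)
  have hFi : LocallyIntegrable F volume := by
    refine LocallyIntegrable.of_norm_le (M := M₁) hk (h.continuous_growth hu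
      (s := fun x => p x - 1) (t := fun x => q x - 1) (by fun_prop) (by fun_prop)
      h.lip_a.continuous (fun x => by linarith [h.one_lt_p x]) (fun x => by linarith [h.one_lt_q x]))
      hFm.aestronglyMeasurable ?_
    filter_upwards [hFg] with x hx
    exact hx.trans (le_of_eq (by ring))
  have hBi : LocallyIntegrable B volume := by
    refine LocallyIntegrable.of_norm_le (M := L) hd (h.continuous_growth hu
      (s := fun x => p x / (critExp N (p x) / (critExp N (p x) - 1)))
      (t := fun x => q x / (critExp N (q x) / (critExp N (q x) - 1)))
      (b := fun x => a x ^ (((N : ℝ) + 1) / N)) ?_ ?_ ?_ ?_ ?_)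
      hBm.aestronglyMeasurable ?_
    · exact hpc.div₀ (h.continuous_critExp_fst.div₀ (h.continuous_critExp_fst.sub continuous_const)
        fun x => by linarith [hcp x])
        fun x => (div_pos (by linarith [hcp x]) (by linarith [hcp x])).ne'
    · exact hqc.div₀ (h.continuous_critExp_snd.div₀ (h.continuous_critExp_snd.sub continuous_const)
        fun x => by linarith [hcq x])
        fun x => (div_pos (by linarith [hcq x]) (by linarith [hcq x])).ne'
    · exact h.lip_a.continuous.rpow_const fun x => Or.inr (by positivity)
    · exact fun x => div_pos (by linarith [h.one_lt_p x])
        (div_pos (by linarith [hcp x]) (by linarith [hcp x]))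
    · exact fun x => div_pos (by linarith [h.one_lt_q x])
        (div_pos (by linarith [hcq x]) (by linarith [hcq x]))
    · filter_upwards [hBg] with x hx
      exact hx.trans (le_of_eq (by ring))
  have hwc : Continuous w := by
    simp only [hwdef, mul_assoc]
    exact (continuous_abs_rpow_mul_self huc hpc h.one_lt_p).add
      (h.lip_a.continuous.mul (continuous_abs_rpow_mul_self huc hqc h.one_lt_q))
  have hVw : LocallyIntegrable (fun x => V x * w x) volume := hO.V_loc.mul_continuous hwc
  have hGi : LocallyIntegrable G volume := hVw.sub hBi
  have hFG : ∀ φ : EuclideanSpace ℝ (Fin N) → ℝ, ContDiff ℝ 1 φ → HasCompactSupport φ →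
      (∫ x, @inner ℝ _ _ (F x) (gradient φ x)) + ∫ x, G x * φ x = 0 := by
    intro φ hφ hφc
    refine weak_form_contDiff_one hFi hGi (fun ψ hψ hψc => ?_) hφ hφc
    have h1 : Integrable fun x => V x * w x * ψ x := by
      simpa using hVw.integrable_smul_right_of_hasCompactSupport hψ.continuous hψc
    have h2 : Integrable fun x => B x * ψ x := by
      simpa using hBi.integrable_smul_right_of_hasCompactSupport hψ.continuous hψc
    have h3 : ∫ x, G x * ψ x = (∫ x, V x * (w x * ψ x)) - ∫ x, B x * ψ x := by
      simp only [← mul_assoc]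
      rw [← integral_sub h1 h2]
      simp only [hG, sub_mul]
    have h4 := hweak ψ hψ hψc
    rw [h3]
    linarith
  have hwpos : ∀ x, 0 < u x → 0 ≤ w x := fun x hx => by
    have := h.a_nonneg x
    simp only [hwdef]
    positivity
  have hwneg : ∀ x, u x < 0 → w x ≤ 0 := fun x hx => by
    have h1 : 0 ≤ |u x| ^ (p x - 2) + a x * |u x| ^ (q x - 2) := by
      have := h.a_nonneg x
      positivity
    have h2 : w x = (|u x| ^ (p x - 2) + a x * |u x| ^ (q x - 2)) * u x := by
      simp only [hwdef]; ring
    rw [h2]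
    exact mul_nonpos_of_nonneg_of_nonpos h1 hx.le
  have hcoer : ∀ᵐ x, M₂ * (‖gradient u x‖ ^ p x + a x * ‖gradient u x‖ ^ q x) -
      M₃ * (critFun N (p x) (q x) (a x) |u x| + 1) ≤ @inner ℝ _ _ (F x) (gradient u x) :=
    hcoerciveA.mono fun x hx => hx (u x) (gradient u x)
  have hS : CritSubsolution N p q a ρ σ k d M₁ M₂ M₃ L u F G :=
    { contDiff := hu
      locInt_F := hFi
      locInt_G := hGi
      growth_F := hFg
      coercive := hcoer
      growth_G := by
        filter_upwards [hBg, hO.V_nonneg] with x hx hVx hux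
        have h1 := mul_nonneg hVx (hwpos x hux)
        have h2 := le_abs_self (B x)
        simp only [hG]
        linarith
      weak := hFG
      one_lt_ρ := hρ1
      one_lt_σ := hσ1
      ρ_le := fun x => (le_max_left _ _).trans (hle x)
      σ_le := fun x => (le_max_right _ _).trans (hle x)
      M₁_pos := hM₁
      M₂_pos := hM₂
      M₃_pos := hM₃
      L_pos := hL }
  have hS' : CritSubsolution N p q a ρ σ k d M₁ M₂ M₃ L (fun x => -u x) (fun x => -F x)
      (fun x => -G x) :=
    { contDiff := hu.neg
      locInt_F := hFi.neg
      locInt_G := hGi.neg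
      growth_F := by simpa only [norm_neg, abs_neg, gradient_neg_eq] using hFg
      coercive := by
        simpa only [norm_neg, abs_neg, gradient_neg_eq, inner_neg_left, inner_neg_right, neg_neg]
          using hcoer
      growth_G := by
        filter_upwards [hBg, hO.V_nonneg] with x hx hVx hux
        have h1 := mul_nonneg hVx (neg_nonneg.mpr (hwneg x (neg_pos.mp hux)))
        have h2 := neg_abs_le (B x)
        simp only [hG, abs_neg, gradient_neg_eq, norm_neg]
        linarith
      weak := fun φ hφ hφc => by
        simp only [inner_neg_left, neg_mul, integral_neg]
        linarith [hFG φ hφ hφc]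
      one_lt_ρ := hρ1
      one_lt_σ := hσ1
      ρ_le := hS.ρ_le
      σ_le := hS.σ_le
      M₁_pos := hM₁
      M₂_pos := hM₂
      M₃_pos := hM₃
      L_pos := hL }
  have hE : ∫⁻ x, ENNReal.ofReal (Hfun p q a x ‖gradient u x‖) < ⊤ :=
    (lintegral_mono fun x => le_self_add).trans_lt hfin
  have hvol := volume_lt_top_of_rhoV h hO huc hfin
  obtain ⟨C₁, hC₁⟩ := hS.bddAbove h hc hmax hw hE
    ((measure_mono fun x (hx : 1 < u x) => show 1 < |u x| from hx.trans_le (le_abs_self _)).trans_lt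
      hvol)
  obtain ⟨C₂, hC₂⟩ := hS'.bddAbove h hc hmax hw
    (by simpa only [gradient_neg_eq, norm_neg] using hE)
    ((measure_mono fun x (hx : 1 < -u x) => show 1 < |u x| from hx.trans_le (neg_le_abs _)).trans_lt
      hvol)
  refine (memLp_top_of_bound huc.aestronglyMeasurable (max C₁ C₂) (Eventually.of_forall
    fun x => ?_)).eLpNorm_lt_top
  rw [Real.norm_eq_abs, abs_le]
  exact ⟨by linarith [hC₂ x, le_max_right C₁ C₂], (hC₁ x).trans (le_max_left _ _)⟩
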